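/- Suppose (A1)-(A3) hold and all coordinates of the mean vector M are nonnegative. Then: (i) for every strictly positive harmonic function f of the induced Markov chain X_M, the function h(x) = f(x^{Λ(M)}) − E_x[f(S^{Λ(M)}(τ)); τ < τ_{Λ(M)}] is strictly positive and harmonic for (Z(t)); (ii) for every fundamental sequence x_n ∈ ℤ_+^d with |x_n| → ∞ and x_n/|x_n| → M/|M| there is a strictly positive harmonic function f of X_M such that for every x ∈ ℤ_+^d, lim_n G(x,x_n)/G(x_0,x_n) = (f(x^{Λ(M)}) − E_x[f(S^{Λ(M)}(τ)); τ < τ_{Λ(M)}]) / (f(x_0^{Λ(M)}) − E_{x_0}[f(S^{Λ(M)}(τ)); τ < τ_{Λ(M)}]); (iii) if moreover the strictly positive harmonic function of X_M is unique up to constant multiples, then every sequence x_n ∈ ℤ_+^d with |x_n| → ∞ and x_n/|x_n| → M/|M| is fundamental for (Z(t)) and satisfies this limit identity. -/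

import Mathlib

open Filter Topology

attribute [local instance] Classical.propDecidable

noncomputable section

variable {V : Type*} [AddCommGroup V]

/-- `n`-step transition kernel of the random walk with step distribution `μ`,
killed upon leaving the set `A` : `kern μ A n x y = P_x(S n = y, τ_A > n)`,
where `τ_A` is the first exit time from `A`. -/
def kern (μ : V → ℝ) (A : Set V) : ℕ → V → V → ℝ
  | 0 => fun x y => if x = y ∧ x ∈ A then 1 else 0
  | n + 1 => fun x y => ∑' z : V, (if x ∈ A then μ (z - x) else 0) * kern μ A n z y

/-- Green function of the walk killed outside `A`. -/
def green (μ : V → ℝ) (A : Set V) (x y : V) : ℝ :=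
  ∑' n : ℕ, kern μ A n x y

/-- `E_x [ g(S τ) ; S τ ∈ B, τ < ∞ ]`, where `τ` is the first exit time from `A`. -/
def exitExp (μ : V → ℝ) (A B : Set V) (g : V → ℝ) (x : V) : ℝ :=
  ∑' n : ℕ, ∑' z : V, kern μ A n x z *
    ∑' y : V, (if y ∉ A ∧ y ∈ B then μ (y - z) else 0) * g y

/-- `ℝ≥0∞`-valued version of `exitExp`. -/
def exitExpE (μ : V → ℝ) (A B : Set V) (g : V → ℝ) (x : V) : ENNReal :=
  ∑' n : ℕ, ∑' z : V, ENNReal.ofReal (kern μ A n x z) *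
    ∑' y : V, ENNReal.ofReal ((if y ∉ A ∧ y ∈ B then μ (y - z) else 0) * g y)

/-- `P_x(S t = y for some t ≥ 0)` for the walk killed outside `A`
(first passage decomposition). -/
def hitProb (μ : V → ℝ) (A : Set V) (x y : V) : ℝ :=
  (if x = y ∧ x ∈ A then 1 else 0) +
    ∑' n : ℕ, ∑' z : V, kern μ (A \ {y}) n x z * (if y ∈ A then μ (y - z) else 0)

/-- `h` is (strictly speaking, satisfies the mean value property of a) harmonic
function on `A` for the walk with step distribution `μ` killed outside `A`. -/
def HarmOn (μ : V → ℝ) (A : Set V) (h : V → ℝ) : Prop :=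
  ∀ x ∈ A, h x = ∑' y : V, if y ∈ A then μ (y - x) * h y else 0

/-- Irreducibility of the walk killed outside `A`. -/
def Irred (μ : V → ℝ) (A : Set V) : Prop :=
  ∀ x ∈ A, ∀ x' ∈ A, ∃ (k : ℕ) (c : ℕ → V), c 0 = x ∧ c k = x' ∧
    (∀ j ≤ k, c j ∈ A) ∧ ∀ j < k, 0 < μ (c (j + 1) - c j)

/-- A sequence `xs` is fundamental for the walk killed outside `A` :
the Martin kernels `G(x, xs n)/G(x₀, xs n)` converge for every `x ∈ A`. -/
def Fundamental (μ : V → ℝ) (A : Set V) (x₀ : V) (xs : ℕ → V) : Prop :=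
  ∀ x ∈ A, ∃ L : ℝ,
    Tendsto (fun n => green μ A x (xs n) / green μ A x₀ (xs n)) atTop (𝓝 L)

/-- ℓ¹-norm of an integer vector. -/
def znorm {ι : Type*} [Fintype ι] (x : ι → ℤ) : ℝ := ∑ i, |(x i : ℝ)|

/-- ℓ¹-norm of a real vector. -/
def rnorm {ι : Type*} [Fintype ι] (q : ι → ℝ) : ℝ := ∑ i, |q i|

variable {d : ℕ}

/-- `ℤ^{Λ,d}_+ = {x ∈ ℤ^d : xⁱ > 0 for all i ∈ Λ}`. -/
def posDom (Λ : Set (Fin d)) : Set (Fin d → ℤ) := {x | ∀ i ∈ Λ, 0 < x i}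

/-- `ℤ^d_+ = {x ∈ ℤ^d : xⁱ > 0 for all i}`. -/
def posAll : Set (Fin d → ℤ) := {x | ∀ i, 0 < x i}

/-- `a · z` for `a ∈ ℝ^d`, `z ∈ ℤ^d`. -/
def dotZ (a : Fin d → ℝ) (z : Fin d → ℤ) : ℝ := ∑ i, a i * (z i : ℝ)

/-- `a · q` for `a, q ∈ ℝ^d`. -/
def dotR (a q : Fin d → ℝ) : ℝ := ∑ i, a i * q i

/-- jump generating function `φ(a) = Σ_z μ(z) exp(a·z)` (valued in `ℝ≥0∞`). -/
def phiE (μ : (Fin d → ℤ) → ℝ) (a : Fin d → ℝ) : ENNReal :=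
  ∑' z : Fin d → ℤ, ENNReal.ofReal (μ z * Real.exp (dotZ a z))

/-- `D = {a ∈ ℝ^d : φ(a) ≤ 1}`. -/
def Dset (μ : (Fin d → ℤ) → ℝ) : Set (Fin d → ℝ) := {a | phiE μ a ≤ 1}

/-- mean vector `M = Σ_z μ(z) z`. -/
def Mvec (μ : (Fin d → ℤ) → ℝ) : Fin d → ℝ := fun i => ∑' z : Fin d → ℤ, μ z * (z i : ℝ)

/-- `Λ(M) = {i : Mⁱ = 0}`. -/
def LambdaM (μ : (Fin d → ℤ) → ℝ) : Set (Fin d) := {i | Mvec μ i = 0}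

/-- Assumption (A1) : irreducibility on every `ℤ^{Λ,d}_+`. -/
def A1 (μ : (Fin d → ℤ) → ℝ) : Prop := ∀ Λ : Set (Fin d), Irred μ (posDom Λ)

/-- Assumption (A2) : `φ` is finite on a neighborhood of the set `D`. -/
def A2 (μ : (Fin d → ℤ) → ℝ) : Prop :=
  ∃ U : Set (Fin d → ℝ), IsOpen U ∧ Dset μ ⊆ U ∧ ∀ a ∈ U, phiE μ a ≠ ⊤

/-- Assumption (A3) : `M ≠ 0`. -/
def A3 (μ : (Fin d → ℤ) → ℝ) : Prop := Mvec μ ≠ 0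

/-- projection `x ↦ x^Λ`. -/
def projL (Λ : Set (Fin d)) (x : Fin d → ℤ) : ↥Λ → ℤ := fun i => x (i : Fin d)

/-- jump distribution `μ_Λ(v) = Σ_{x : x^Λ = v} μ(x)` of the projected walk. -/
def muL (μ : (Fin d → ℤ) → ℝ) (Λ : Set (Fin d)) (v : ↥Λ → ℤ) : ℝ :=
  ∑' x : Fin d → ℤ, if projL Λ x = v then μ x else 0

/-- `ℤ^Λ_+`. -/
def posL (Λ : Set (Fin d)) : Set (↥Λ → ℤ) := {u | ∀ i, 0 < u i}

end

/-- the function `h(x) = f(x^{Λ(M)}) − E_x[f(S^{Λ(M)}(τ)); τ < τ_{Λ(M)}]`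
built from a function `f` on `ℤ_+^{Λ(M)}` (formula (1.2) of the paper). -/
noncomputable def hfun {d : ℕ} (μ : (Fin d → ℤ) → ℝ)
    (f : (↥(LambdaM μ) → ℤ) → ℝ) (x : Fin d → ℤ) : ℝ :=
  f (projL (LambdaM μ) x) -
    exitExp μ posAll (posDom (LambdaM μ)) (fun y => f (projL (LambdaM μ) y)) x

section Helpers

open scoped ENNReal

section Operators

variable {V : Type*}

/-- Linear endomorphisms of the `ℝ≥0∞`-valued functions are monotone. -/
theorem endo_mono (L : Module.End ℝ≥0∞ (V → ℝ≥0∞)) {f g : V → ℝ≥0∞} (h : f ≤ g) :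
    L f ≤ L g := by
  have : g = f + (g - f) := by
    funext x
    exact (add_tsub_cancel_of_le (h x)).symm
  rw [this, map_add]
  exact le_self_add

theorem endo_pow_succ (L : Module.End ℝ≥0∞ (V → ℝ≥0∞)) (n : ℕ) (f : V → ℝ≥0∞) :
    (L ^ (n + 1)) f = L ((L ^ n) f) := by
  rw [pow_succ']
  rfl

theorem endo_pow_succ' (L : Module.End ℝ≥0∞ (V → ℝ≥0∞)) (n : ℕ) (f : V → ℝ≥0∞) :
    (L ^ (n + 1)) f = (L ^ n) (L f) := by
  rw [pow_succ]
  rfl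

/-- If `L f ≤ c f` then `L ^ n f ≤ c ^ n f`. -/
theorem endo_pow_le_smul (L : Module.End ℝ≥0∞ (V → ℝ≥0∞)) {f : V → ℝ≥0∞} {c : ℝ≥0∞}
    (h : L f ≤ c • f) (n : ℕ) : (L ^ n) f ≤ c ^ n • f := by
  induction n with
  | zero => simp
  | succ n ih =>
    rw [endo_pow_succ]
    calc L ((L ^ n) f) ≤ L (c ^ n • f) := endo_mono L ih
      _ = c ^ n • L f := map_smul _ _ _
      _ ≤ c ^ n • c • f := fun x => mul_le_mul_right (h x) _
      _ = c ^ (n + 1) • f := by rw [smul_smul, pow_succ]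

theorem endo_pow_le (L : Module.End ℝ≥0∞ (V → ℝ≥0∞)) {f : V → ℝ≥0∞}
    (h : L f ≤ f) (n : ℕ) : (L ^ n) f ≤ f := by
  simpa using endo_pow_le_smul L (c := 1) (by simpa using h) n

/-- The potential `∑ Lⁿ g`. -/
noncomputable def potential (L : Module.End ℝ≥0∞ (V → ℝ≥0∞)) (g : V → ℝ≥0∞) : V → ℝ≥0∞ :=
  fun x => ∑' n : ℕ, (L ^ n) g x

theorem sum_pow_le_of_add_le (L : Module.End ℝ≥0∞ (V → ℝ≥0∞)) {g v : V → ℝ≥0∞}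
    (h : g + L v ≤ v) (N : ℕ) : ∑ m ∈ Finset.range N, (L ^ m) g ≤ v := by
  induction N with
  | zero => simp
  | succ N ih =>
    rw [Finset.sum_range_succ']
    calc ∑ k ∈ Finset.range N, (L ^ (k + 1)) g + (L ^ 0) g
        = L (∑ k ∈ Finset.range N, (L ^ k) g) + g := by
          simp [map_sum, endo_pow_succ]
      _ ≤ L v + g := by gcongr; exact endo_mono L ih
      _ ≤ v := by rwa [add_comm]

theorem potential_le_of_add_le (L : Module.End ℝ≥0∞ (V → ℝ≥0∞)) {g v : V → ℝ≥0∞}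
    (h : g + L v ≤ v) : potential L g ≤ v := by
  intro x
  refine ENNReal.tsum_le_of_sum_range_le fun N => ?_
  simpa using sum_pow_le_of_add_le L h N x

theorem eq_pow_add_sum (L : Module.End ℝ≥0∞ (V → ℝ≥0∞)) {g v : V → ℝ≥0∞}
    (h : v = g + L v) (N : ℕ) : v = (L ^ N) v + ∑ m ∈ Finset.range N, (L ^ m) g := by
  induction N with
  | zero => simp
  | succ N ih =>
    rw [Finset.sum_range_succ, endo_pow_succ']
    nth_rw 1 [ih]
    nth_rw 1 [h]
    rw [map_add]
    abel

theorem eq_potential_of_tendsto (L : Module.End ℝ≥0∞ (V → ℝ≥0∞)) {g v : V → ℝ≥0∞}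
    (h : v = g + L v) (x : V) (ht : Tendsto (fun N => (L ^ N) v x) atTop (𝓝 0)) :
    v x = potential L g x := by
  have h1 : Tendsto (fun N => (L ^ N) v x + ∑ m ∈ Finset.range N, (L ^ m) g x) atTop
      (𝓝 (0 + potential L g x)) :=
    ht.add (ENNReal.tendsto_nat_tsum _)
  rw [zero_add] at h1
  refine tendsto_nhds_unique ?_ h1
  have : (fun N => (L ^ N) v x + ∑ m ∈ Finset.range N, (L ^ m) g x) = fun _ => v x := by
    funext N
    conv_rhs => rw [eq_pow_add_sum L h N]
    simp
  rw [this]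
  exact tendsto_const_nhds

theorem potential_mono (L : Module.End ℝ≥0∞ (V → ℝ≥0∞)) {f g : V → ℝ≥0∞} (h : f ≤ g) :
    potential L f ≤ potential L g :=
  fun x => ENNReal.tsum_le_tsum fun n => endo_mono (L ^ n) h x

/-- Geometric bound for potentials. -/
theorem potential_le_geom (L : Module.End ℝ≥0∞ (V → ℝ≥0∞)) {f : V → ℝ≥0∞} {c : ℝ≥0∞}
    (h : L f ≤ c • f) (x : V) : potential L f x ≤ (1 - c)⁻¹ * f x := by
  rw [← ENNReal.tsum_geometric, ← ENNReal.tsum_mul_right]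
  exact ENNReal.tsum_le_tsum fun n => endo_pow_le_smul L h n x

/-- Unit mass at `y`, restricted to `A`. -/
noncomputable def massAt (A : Set V) (y : V) : V → ℝ≥0∞ := fun x => if x = y ∧ x ∈ A then 1 else 0

theorem massAt_le_one (A : Set V) (y x : V) : massAt A y x ≤ 1 := by
  unfold massAt
  split_ifs <;> simp

theorem massAt_of_mem {A : Set V} {y : V} (h : y ∈ A) : massAt A y = Pi.single y 1 := by
  funext x
  by_cases hx : x = y
  · subst hx; simp [massAt, h]
  · simp [massAt, hx]

theorem massAt_of_notMem {A : Set V} {y : V} (h : y ∉ A) : massAt A y = 0 := by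
  funext x
  by_cases hx : x = y
  · subst hx; simp [massAt, h]
  · simp [massAt, hx]

theorem tsum_ofReal_eq_one {μ : V → ℝ} (hnn : ∀ z, 0 ≤ μ z) (hsum : HasSum μ 1) :
    ∑' z, ENNReal.ofReal (μ z) = 1 := by
  rw [← ENNReal.ofReal_tsum_of_nonneg hnn hsum.summable, hsum.tsum_eq]
  simp

variable [AddCommGroup V]

/-- Transition operator of the walk with step weights `ν` killed outside `A`. -/
noncomputable def stepOp (ν : V → ℝ≥0∞) (A : Set V) : Module.End ℝ≥0∞ (V → ℝ≥0∞) where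
  toFun f := fun x => if x ∈ A then ∑' z, ν z * f (x + z) else 0
  map_add' f g := by
    funext x
    by_cases hx : x ∈ A <;> simp [hx, mul_add, ENNReal.tsum_add]
  map_smul' c f := by
    funext x
    by_cases hx : x ∈ A
    · simp only [hx, if_true, Pi.smul_apply, smul_eq_mul, RingHom.id_apply,
        ← ENNReal.tsum_mul_left]
      exact tsum_congr fun z => by ring
    · simp [hx]

theorem stepOp_apply (ν : V → ℝ≥0∞) (A : Set V) (f : V → ℝ≥0∞) (x : V) :
    stepOp ν A f x = if x ∈ A then ∑' z, ν z * f (x + z) else 0 := rfl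

theorem stepOp_of_mem (ν : V → ℝ≥0∞) {A : Set V} (f : V → ℝ≥0∞) {x : V} (hx : x ∈ A) :
    stepOp ν A f x = ∑' z, ν z * f (x + z) := by simp [stepOp_apply, hx]

theorem stepOp_of_notMem (ν : V → ℝ≥0∞) {A : Set V} (f : V → ℝ≥0∞) {x : V} (hx : x ∉ A) :
    stepOp ν A f x = 0 := by simp [stepOp_apply, hx]

theorem stepOp_le_tsum (ν : V → ℝ≥0∞) (A : Set V) (f : V → ℝ≥0∞) (x : V) :
    stepOp ν A f x ≤ ∑' z, ν z * f (x + z) := by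
  rw [stepOp_apply]
  split_ifs <;> simp

theorem stepOp_tsum {ι : Type*} (ν : V → ℝ≥0∞) (A : Set V) (f : ι → V → ℝ≥0∞) :
    stepOp ν A (fun x => ∑' i, f i x) = fun x => ∑' i, stepOp ν A (f i) x := by
  funext x
  by_cases hx : x ∈ A
  · simp only [stepOp_of_mem _ _ hx, ← ENNReal.tsum_mul_left]
    exact ENNReal.tsum_comm
  · simp [stepOp_of_notMem _ _ hx]

theorem stepOp_mono_set (ν : V → ℝ≥0∞) {A B : Set V} (h : A ⊆ B) (f : V → ℝ≥0∞) :
    stepOp ν A f ≤ stepOp ν B f := by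
  intro x
  by_cases hx : x ∈ A
  · simp [stepOp_of_mem _ _ hx, stepOp_of_mem _ _ (h hx)]
  · simp [stepOp_of_notMem _ _ hx]

theorem stepOp_pow_mono_set (ν : V → ℝ≥0∞) {A B : Set V} (h : A ⊆ B) (f : V → ℝ≥0∞) (n : ℕ) :
    (stepOp ν A ^ n) f ≤ (stepOp ν B ^ n) f := by
  induction n with
  | zero => simp
  | succ n ih =>
    rw [endo_pow_succ, endo_pow_succ]
    exact (endo_mono _ ih).trans (stepOp_mono_set ν h _)

theorem stepOp_le_const {ν : V → ℝ≥0∞} (hν : ∑' z, ν z ≤ 1) (A : Set V) {f : V → ℝ≥0∞}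
    {c : ℝ≥0∞} (h : ∀ x, f x ≤ c) (x : V) : stepOp ν A f x ≤ c := by
  refine (stepOp_le_tsum ν A f x).trans ?_
  calc ∑' z, ν z * f (x + z) ≤ ∑' z, ν z * c :=
        ENNReal.tsum_le_tsum fun z => mul_le_mul_right (h _) _
    _ = (∑' z, ν z) * c := ENNReal.tsum_mul_right
    _ ≤ c := mul_le_of_le_one_left zero_le hν

theorem stepOp_pow_le_const {ν : V → ℝ≥0∞} (hν : ∑' z, ν z ≤ 1) (A : Set V) {f : V → ℝ≥0∞}
    {c : ℝ≥0∞} (h : ∀ x, f x ≤ c) (n : ℕ) (x : V) : (stepOp ν A ^ n) f x ≤ c := by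
  induction n generalizing x with
  | zero => simpa using h x
  | succ n ih =>
    rw [endo_pow_succ]
    exact stepOp_le_const hν A ih x

theorem potential_stepOp (ν : V → ℝ≥0∞) (A : Set V) (g : V → ℝ≥0∞) :
    potential (stepOp ν A) g = g + stepOp ν A (potential (stepOp ν A) g) := by
  have h := stepOp_tsum ν A (fun n => (stepOp ν A ^ n) g)
  funext x
  change ∑' n : ℕ, (stepOp ν A ^ n) g x = g x + stepOp ν A (fun x => ∑' n, (stepOp ν A ^ n) g x) x
  rw [h, tsum_eq_zero_add' ENNReal.summable]
  simp [endo_pow_succ]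

theorem potential_stepOp_comm (ν : V → ℝ≥0∞) (A : Set V) (g : V → ℝ≥0∞) :
    stepOp ν A (potential (stepOp ν A) g) = potential (stepOp ν A) (stepOp ν A g) := by
  refine (stepOp_tsum ν A (fun n => (stepOp ν A ^ n) g)).trans ?_
  funext x
  exact tsum_congr fun n => by rw [← endo_pow_succ, endo_pow_succ']

theorem pow_potential (ν : V → ℝ≥0∞) (A : Set V) (g : V → ℝ≥0∞) (N : ℕ) (x : V) :
    (stepOp ν A ^ N) (potential (stepOp ν A) g) x = ∑' n, (stepOp ν A ^ (n + N)) g x := by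
  induction N generalizing g with
  | zero => rfl
  | succ N ih =>
    rw [endo_pow_succ', potential_stepOp_comm, ih]
    exact tsum_congr fun n => by rw [← endo_pow_succ', add_assoc]

theorem tendsto_pow_potential (ν : V → ℝ≥0∞) (A : Set V) (g : V → ℝ≥0∞) (x : V)
    (h : potential (stepOp ν A) g x ≠ ⊤) :
    Tendsto (fun N => (stepOp ν A ^ N) (potential (stepOp ν A) g) x) atTop (𝓝 0) := by
  simp only [pow_potential]
  exact ENNReal.tendsto_sum_nat_add _ h

/-- Kernel representation of the iterates of the transition operator. -/
theorem stepOp_pow_eq_tsum (ν : V → ℝ≥0∞) (A : Set V) (f : V → ℝ≥0∞) (n : ℕ) (x : V) :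
    (stepOp ν A ^ n) f x = ∑' y, (stepOp ν A ^ n) (Pi.single y 1) x * f y := by
  induction n generalizing x with
  | zero =>
    rw [tsum_eq_single x]
    · simp
    · intro y hy
      simp [hy.symm]
  | succ n ih =>
    simp only [endo_pow_succ]
    by_cases hx : x ∈ A
    · simp only [stepOp_of_mem _ _ hx, ← ENNReal.tsum_mul_right]
      rw [ENNReal.tsum_comm]
      refine tsum_congr fun z => ?_
      rw [ih, ← ENNReal.tsum_mul_left]
      exact tsum_congr fun y => by ring
    · simp [stepOp_of_notMem _ _ hx]

variable {μ : V → ℝ}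

theorem kern_eq_toReal (hnn : ∀ z, 0 ≤ μ z) (hsum : HasSum μ 1) (A : Set V) (n : ℕ) (x y : V) :
    kern μ A n x y = ((stepOp (fun z => ENNReal.ofReal (μ z)) A ^ n) (massAt A y) x).toReal := by
  have hν := (tsum_ofReal_eq_one hnn hsum).le
  induction n generalizing x with
  | zero =>
    simp only [kern, pow_zero, Module.End.one_apply, massAt]
    split_ifs <;> simp
  | succ n ih =>
    rw [endo_pow_succ]
    by_cases hx : x ∈ A
    · rw [stepOp_of_mem _ _ hx, ENNReal.tsum_toReal_eq]
      · simp only [kern, hx, if_true, ENNReal.toReal_mul, ENNReal.toReal_ofReal (hnn _), ← ih]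
        rw [← (Equiv.addLeft x).tsum_eq]
        simp
      · intro z
        exact ENNReal.mul_ne_top ENNReal.ofReal_ne_top
          ((stepOp_pow_le_const hν A (massAt_le_one A y) n _).trans_lt ENNReal.one_lt_top).ne
    · simp [kern, hx, stepOp_of_notMem _ _ hx]

theorem green_eq_toReal (hnn : ∀ z, 0 ≤ μ z) (hsum : HasSum μ 1) (A : Set V) (x y : V) :
    green μ A x y =
      (potential (stepOp (fun z => ENNReal.ofReal (μ z)) A) (massAt A y) x).toReal := by
  have hν := (tsum_ofReal_eq_one hnn hsum).le
  unfold green potential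
  rw [ENNReal.tsum_toReal_eq]
  · simp only [kern_eq_toReal hnn hsum]
  · intro n
    exact ((stepOp_pow_le_const hν A (massAt_le_one A y) n _).trans_lt ENNReal.one_lt_top).ne

/-- Exit payoff supported on `B \ A`. -/
noncomputable def exitPayoff (A B : Set V) (g : V → ℝ≥0∞) : V → ℝ≥0∞ :=
  fun y => if y ∉ A ∧ y ∈ B then g y else 0

theorem exitExp_eq_toReal (hnn : ∀ z, 0 ≤ μ z) (hsum : HasSum μ 1) (A B : Set V) (g : V → ℝ)
    (hg : ∀ y ∈ B, 0 ≤ g y) (x : V)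
    (hfin : potential (stepOp (fun z => ENNReal.ofReal (μ z)) A)
      (stepOp (fun z => ENNReal.ofReal (μ z)) A
        (exitPayoff A B fun y => ENNReal.ofReal (g y))) x ≠ ⊤) :
    exitExp μ A B g x = (potential (stepOp (fun z => ENNReal.ofReal (μ z)) A)
      (stepOp (fun z => ENNReal.ofReal (μ z)) A
        (exitPayoff A B fun y => ENNReal.ofReal (g y))) x).toReal := by
  set Φ := exitPayoff A B fun y => ENNReal.ofReal (g y) with hΦ
  set ν : V → ℝ≥0∞ := fun z => ENNReal.ofReal (μ z) with hνdef
  set q : V → ℝ≥0∞ := fun z => ∑' y, ν (y - z) * Φ y with hq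
  have hqstep : ∀ z ∈ A, stepOp ν A Φ z = q z := by
    intro z hz
    rw [stepOp_of_mem _ _ hz, hq]
    simp only
    rw [← (Equiv.addLeft z).tsum_eq (fun y => ν (y - z) * Φ y)]
    simp
  have hinner : ∀ z, ∑' y, (if y ∉ A ∧ y ∈ B then μ (y - z) else 0) * g y = (q z).toReal := by
    intro z
    rw [hq, ENNReal.tsum_toReal_eq]
    · refine tsum_congr fun y => ?_
      by_cases h : y ∉ A ∧ y ∈ B
      · simp only [h, hΦ, exitPayoff, hνdef]
        simp [ENNReal.toReal_ofReal (hnn _), ENNReal.toReal_ofReal (hg y h.2)]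
      · simp [h, hΦ, exitPayoff]
    · intro y
      refine ENNReal.mul_ne_top ENNReal.ofReal_ne_top ?_
      simp only [hΦ, exitPayoff]
      split_ifs <;> simp
  have hterm : ∀ n, (stepOp ν A ^ n) (stepOp ν A Φ) x
      = ∑' z, (stepOp ν A ^ n) (massAt A z) x * q z := by
    intro n
    rw [stepOp_pow_eq_tsum]
    refine tsum_congr fun z => ?_
    by_cases hz : z ∈ A
    · rw [hqstep z hz, massAt_of_mem hz]
    · rw [stepOp_of_notMem _ _ hz, massAt_of_notMem hz]
      simp
  unfold potential at hfin ⊢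
  have hn : ∀ n, (stepOp ν A ^ n) (stepOp ν A Φ) x ≠ ⊤ := ENNReal.ne_top_of_tsum_ne_top hfin
  rw [ENNReal.tsum_toReal_eq hn]
  unfold exitExp
  refine tsum_congr fun n => ?_
  have h2 := hn n
  rw [hterm n] at h2 ⊢
  rw [ENNReal.tsum_toReal_eq (ENNReal.ne_top_of_tsum_ne_top h2)]
  refine tsum_congr fun z => ?_
  rw [hinner, ENNReal.toReal_mul, kern_eq_toReal hnn hsum]

/-- The function `f(· + w)`. -/
def shiftOp (w : V) : Module.End ℝ≥0∞ (V → ℝ≥0∞) where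
  toFun f := fun x => f (x + w)
  map_add' _ _ := rfl
  map_smul' _ _ := rfl

@[simp] theorem shiftOp_apply (w : V) (f : V → ℝ≥0∞) (x : V) : shiftOp w f x = f (x + w) := rfl

theorem stepOp_shiftOp_commute (ν : V → ℝ≥0∞) {A : Set V} {w : V}
    (h : ∀ x, x + w ∈ A ↔ x ∈ A) : Commute (stepOp ν A) (shiftOp w) := by
  refine LinearMap.ext fun f => ?_
  funext x
  change stepOp ν A (shiftOp w f) x = stepOp ν A f (x + w)
  by_cases hx : x ∈ A
  · rw [stepOp_of_mem _ _ hx, stepOp_of_mem _ _ ((h x).2 hx)]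
    simp [add_right_comm]
  · rw [stepOp_of_notMem _ _ hx, stepOp_of_notMem _ _ (fun h' => hx ((h x).1 h'))]

end Operators

section Reach

variable {V : Type*} [AddCommGroup V]

/-- `v` is reached from `u` at cost `k`: superharmonic functions satisfy
`exp (-k) * f v ≤ f u`. -/
def Reach (ν : V → ℝ≥0∞) (A : Set V) (k : ℝ) (u v : V) : Prop :=
  ∀ f : V → ℝ≥0∞, stepOp ν A f ≤ f → ENNReal.ofReal (Real.exp (-k)) * f v ≤ f u

variable {ν : V → ℝ≥0∞} {A : Set V}

theorem Reach.refl (u : V) : Reach ν A 0 u u := fun f _ => by simp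

theorem Reach.mono {k l : ℝ} {u v : V} (h : Reach ν A k u v) (hkl : k ≤ l) :
    Reach ν A l u v := fun f hf =>
  le_trans (mul_le_mul_left (ENNReal.ofReal_le_ofReal (by gcongr)) _) (h f hf)

theorem Reach.trans {k l : ℝ} {u v w : V} (h : Reach ν A k u v) (h' : Reach ν A l v w) :
    Reach ν A (k + l) u w := fun f hf => by
  rw [neg_add, Real.exp_add, ENNReal.ofReal_mul (Real.exp_pos _).le, mul_assoc]
  exact le_trans (mul_le_mul_right (h' f hf) _) (h f hf)

theorem Reach.shift {k : ℝ} {u v t : V} (ht : ∀ x ∈ A, x + t ∈ A) (h : Reach ν A k u v) :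
    Reach ν A k (u + t) (v + t) := fun f hf => by
  refine h (shiftOp t f) fun x => ?_
  by_cases hx : x ∈ A
  · have := hf (x + t)
    rw [stepOp_of_mem _ _ (ht x hx)] at this
    rw [stepOp_of_mem _ _ hx]
    simpa [add_right_comm] using this
  · simp [stepOp_of_notMem _ _ hx]

theorem exists_reach_of_irred {μ : V → ℝ} (hirr : Irred μ A) {x x' : V} (hx : x ∈ A)
    (hx' : x' ∈ A) :
    ∃ k : ℝ, 0 ≤ k ∧ Reach (fun z => ENNReal.ofReal (μ z)) A k x x' := by
  obtain ⟨n, c, h0, hn, hA, hpos⟩ := hirr x hx x' hx'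
  have key : ∀ j ≤ n, ∃ k : ℝ, 0 ≤ k ∧ Reach (fun z => ENNReal.ofReal (μ z)) A k x (c j) := by
    intro j
    induction j with
    | zero => exact fun _ => ⟨0, le_rfl, h0 ▸ Reach.refl _⟩
    | succ j ih =>
      intro hj
      obtain ⟨k, hk0, hk⟩ := ih (by omega)
      have hm := hpos j (by omega)
      refine ⟨k + |Real.log (μ (c (j + 1) - c j))|, by positivity, hk.trans fun f hf => ?_⟩
      have h1 := hf (c j)
      rw [stepOp_of_mem _ _ (hA j (by omega))] at h1
      refine le_trans ?_ ((ENNReal.le_tsum (c (j + 1) - c j)).trans h1)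
      rw [add_sub_cancel]
      gcongr
      calc Real.exp (-|Real.log (μ (c (j + 1) - c j))|)
          ≤ Real.exp (Real.log (μ (c (j + 1) - c j))) :=
            Real.exp_le_exp.2 (neg_abs_le _)
        _ = _ := Real.exp_log hm
  exact hn ▸ key n le_rfl

end Reach

section Lattice

variable {d : ℕ}

/-- The `ℓ¹`-norm as a natural number. -/
def oneNorm (x : Fin d → ℤ) : ℕ := ∑ i, (x i).natAbs

theorem znorm_eq_oneNorm (x : Fin d → ℤ) : znorm x = (oneNorm x : ℝ) := by
  simp [znorm, oneNorm, Nat.cast_natAbs]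

theorem oneNorm_add_le (x y : Fin d → ℤ) : oneNorm (x + y) ≤ oneNorm x + oneNorm y := by
  unfold oneNorm
  rw [← Finset.sum_add_distrib]
  exact Finset.sum_le_sum fun i _ => Int.natAbs_add_le _ _

theorem oneNorm_neg (x : Fin d → ℤ) : oneNorm (-x) = oneNorm x := by
  simp [oneNorm]

theorem oneNorm_sub_comm (x y : Fin d → ℤ) : oneNorm (x - y) = oneNorm (y - x) := by
  rw [← oneNorm_neg, neg_sub]

theorem oneNorm_sub_le (x y : Fin d → ℤ) : oneNorm (x - y) ≤ oneNorm x + oneNorm y := by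
  rw [sub_eq_add_neg, ← oneNorm_neg y]
  exact oneNorm_add_le _ _

theorem oneNorm_le_add_sub (x y : Fin d → ℤ) : oneNorm x ≤ oneNorm y + oneNorm (x - y) := by
  simpa using oneNorm_add_le y (x - y)

theorem oneNorm_smul (n : ℕ) (x : Fin d → ℤ) : oneNorm (n • x) = n * oneNorm x := by
  simp [oneNorm, Int.natAbs_mul, Finset.mul_sum]

theorem oneNorm_single (i : Fin d) (k : ℤ) : oneNorm (Pi.single i k) = k.natAbs := by
  unfold oneNorm
  rw [Finset.sum_eq_single i]
  · simp
  · intro j _ hj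
    simp [hj]
  · simp

theorem oneNorm_eq_zero {x : Fin d → ℤ} : oneNorm x = 0 ↔ x = 0 := by
  simp [oneNorm, funext_iff]

theorem natAbs_le_oneNorm (x : Fin d → ℤ) (i : Fin d) : (x i).natAbs ≤ oneNorm x :=
  Finset.single_le_sum (f := fun i => (x i).natAbs) (fun _ _ => Nat.zero_le _) (Finset.mem_univ i)

theorem exists_unit_step {u v : Fin d → ℤ} (h : u ≠ v) :
    ∃ (i : Fin d) (ε : ℤ), (ε = 1 ∨ ε = -1) ∧ u i ≠ v i ∧
      oneNorm (v - (u + Pi.single i ε)) + 1 = oneNorm (v - u) ∧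
      ∀ Λ : Set (Fin d), u ∈ posDom Λ → v ∈ posDom Λ → u + Pi.single i ε ∈ posDom Λ := by
  obtain ⟨i, hi⟩ := Function.ne_iff.1 h
  have key : ∀ ε : ℤ, (v i - (u i + ε)).natAbs + 1 = (v i - u i).natAbs →
      oneNorm (v - (u + Pi.single i ε)) + 1 = oneNorm (v - u) := by
    intro ε hε
    unfold oneNorm
    rw [← Finset.add_sum_erase _ _ (Finset.mem_univ i),
      ← Finset.add_sum_erase _ _ (Finset.mem_univ i), add_right_comm]
    congr 1
    · simpa using hε
    · refine Finset.sum_congr rfl fun j hj => ?_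
      simp [Finset.ne_of_mem_erase hj]
  rcases lt_or_gt_of_ne hi with hlt | hgt
  · refine ⟨i, 1, Or.inl rfl, hi, key 1 (by omega), fun Λ hu hv j hj => ?_⟩
    have := hu j hj
    by_cases hij : j = i
    · subst hij; simp; omega
    · simpa [hij] using this
  · refine ⟨i, -1, Or.inr rfl, hi, key (-1) (by omega), fun Λ hu hv j hj => ?_⟩
    have h1 := hu j hj
    have h2 := hv j hj
    by_cases hij : j = i
    · subst hij; simp; omega
    · simpa [hij] using h1

theorem one_mem_posDom (Λ : Set (Fin d)) : (1 : Fin d → ℤ) ∈ posDom Λ := fun i _ => by simp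

theorem posDom_add {Λ : Set (Fin d)} {x t : Fin d → ℤ} (hx : x ∈ posDom Λ)
    (ht : ∀ i ∈ Λ, 0 ≤ t i) : x + t ∈ posDom Λ := fun i hi => by
  have := hx i hi
  have := ht i hi
  simp
  omega

theorem posAll_subset_posDom (Λ : Set (Fin d)) : (posAll : Set (Fin d → ℤ)) ⊆ posDom Λ :=
  fun _ hx i _ => hx i

theorem posDom_univ : posDom (Set.univ : Set (Fin d)) = posAll := by
  ext x
  simp [posDom, posAll]

/-- Points of `posDom Λ` are reached from each other at a cost linear in their distance. -/
theorem exists_reach_linear {μ : (Fin d → ℤ) → ℝ} {Λ : Set (Fin d)}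
    (hirr : Irred μ (posDom Λ)) :
    ∃ κ : ℝ, 0 ≤ κ ∧ ∀ u ∈ posDom Λ, ∀ v ∈ posDom Λ,
      Reach (fun z => ENNReal.ofReal (μ z)) (posDom Λ) (κ * oneNorm (v - u)) u v := by
  have h1 := one_mem_posDom Λ
  have h2 : ∀ i : Fin d, (1 : Fin d → ℤ) + Pi.single i 1 ∈ posDom Λ := fun i =>
    posDom_add h1 fun j _ => by
      by_cases hij : j = i
      · subst hij; simp
      · simp [hij]
  choose kp hkp0 hkp using fun i => exists_reach_of_irred hirr h1 (h2 i)
  choose km hkm0 hkm using fun i => exists_reach_of_irred hirr (h2 i) h1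
  set κ : ℝ := ∑ i, (kp i + km i) with hκ
  have hle : ∀ i, kp i + km i ≤ κ := fun i =>
    Finset.single_le_sum (f := fun i => kp i + km i)
      (fun j _ => add_nonneg (hkp0 j) (hkm0 j)) (Finset.mem_univ i)
  have hκ0 : 0 ≤ κ := Finset.sum_nonneg fun j _ => add_nonneg (hkp0 j) (hkm0 j)
  have hunit : ∀ u ∈ posDom Λ, ∀ i, ∀ ε : ℤ, (ε = 1 ∨ ε = -1) → u + Pi.single i ε ∈ posDom Λ →
      Reach (fun z => ENNReal.ofReal (μ z)) (posDom Λ) κ u (u + Pi.single i ε) := by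
    intro u hu i ε hε hu'
    rcases hε with rfl | rfl
    · have := (hkp i).shift (t := u - 1) fun x hx => posDom_add hx fun j hj => by
        have := hu j hj
        simp
        omega
      refine Reach.mono ?_ ((le_add_of_nonneg_right (hkm0 i)).trans (hle i))
      convert this using 1 <;> abel
    · have := (hkm i).shift (t := u - (1 + Pi.single i 1)) fun x hx =>
        posDom_add hx fun j hj => by
          have h3 := hu j hj
          have h4 := hu' j hj
          by_cases hij : j = i
          · subst hij; simp at h4 ⊢; omega
          · simp [hij]; omega
      refine Reach.mono ?_ ((le_add_of_nonneg_left (hkp0 i)).trans (hle i))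
      rw [Pi.single_neg]
      convert this using 1 <;> abel
  refine ⟨κ, hκ0, ?_⟩
  have key : ∀ n : ℕ, ∀ u ∈ posDom Λ, ∀ v ∈ posDom Λ, oneNorm (v - u) = n →
      Reach (fun z => ENNReal.ofReal (μ z)) (posDom Λ) (κ * n) u v := by
    intro n
    induction n with
    | zero =>
      intro u _ v _ h
      rw [oneNorm_eq_zero, sub_eq_zero] at h
      subst h
      simpa using Reach.refl _
    | succ n ih =>
      intro u hu v hv h
      have huv : u ≠ v := by
        rintro rfl
        simp [oneNorm] at h
      obtain ⟨i, ε, hε, -, hn, hmem⟩ := exists_unit_step huv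
      have hu' := hmem Λ hu hv
      have := (hunit u hu i ε hε hu').trans (ih _ hu' v hv (by omega))
      refine this.mono (le_of_eq ?_)
      push_cast
      ring
  exact fun u hu v hv => key _ u hu v hv rfl

end Lattice

section Exponentials

variable {d : ℕ}

theorem dotZ_add (a : Fin d → ℝ) (x y : Fin d → ℤ) : dotZ a (x + y) = dotZ a x + dotZ a y := by
  simp [dotZ, mul_add, Finset.sum_add_distrib]

theorem dotZ_neg (a : Fin d → ℝ) (x : Fin d → ℤ) : dotZ a (-x) = -dotZ a x := by
  simp [dotZ]

theorem dotZ_sub (a : Fin d → ℝ) (x y : Fin d → ℤ) : dotZ a (x - y) = dotZ a x - dotZ a y := by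
  rw [sub_eq_add_neg, dotZ_add, dotZ_neg]
  ring

theorem dotZ_add_left (a b : Fin d → ℝ) (x : Fin d → ℤ) :
    dotZ (a + b) x = dotZ a x + dotZ b x := by
  simp [dotZ, add_mul, Finset.sum_add_distrib]

theorem dotZ_single (j : Fin d) (t : ℝ) (x : Fin d → ℤ) : dotZ (Pi.single j t) x = t * x j := by
  unfold dotZ
  rw [Finset.sum_eq_single j]
  · simp
  · intro i _ hi
    simp [hi]
  · simp

theorem dotR_single (j : Fin d) (t : ℝ) (q : Fin d → ℝ) : dotR (Pi.single j t) q = t * q j := by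
  unfold dotR
  rw [Finset.sum_eq_single j]
  · simp
  · intro i _ hi
    simp [hi]
  · simp

theorem abs_dotZ_le (a : Fin d → ℝ) (x : Fin d → ℤ) : |dotZ a x| ≤ ‖a‖ * oneNorm x := by
  unfold dotZ oneNorm
  push_cast
  rw [Finset.mul_sum]
  refine (Finset.abs_sum_le_sum_abs _ _).trans (Finset.sum_le_sum fun i _ => ?_)
  rw [abs_mul, Nat.cast_natAbs]
  push_cast
  gcongr
  exact norm_le_pi_norm a i

/-- The vector of signs `±1` encoded by `s`. -/
def signVec (s : Fin d → Bool) : Fin d → ℝ := fun i => if s i then 1 else -1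

theorem abs_signVec (s : Fin d → Bool) (i : Fin d) : |signVec s i| = 1 := by
  unfold signVec
  split_ifs <;> simp

theorem norm_signVec_le (s : Fin d → Bool) : ‖signVec s‖ ≤ 1 :=
  (pi_norm_le_iff_of_nonneg zero_le_one).2 fun i => (abs_signVec s i).le

theorem exists_signVec (x : Fin d → ℤ) : ∃ s, dotZ (signVec s) x = oneNorm x := by
  refine ⟨fun i => decide (0 ≤ x i), ?_⟩
  unfold dotZ oneNorm signVec
  push_cast
  refine Finset.sum_congr rfl fun i _ => ?_
  rw [Nat.cast_natAbs]
  push_cast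
  by_cases h : 0 ≤ x i
  · have : (0 : ℝ) ≤ x i := by exact_mod_cast h
    simp [h, abs_of_nonneg this]
  · have : (x i : ℝ) < 0 := by exact_mod_cast not_le.1 h
    simp [h, abs_of_neg this]

theorem dotZ_smul (t : ℝ) (a : Fin d → ℝ) (x : Fin d → ℤ) :
    dotZ (t • a) x = t * dotZ a x := by
  simp [dotZ, Finset.mul_sum, mul_assoc]

theorem exp_oneNorm_le (δ : ℝ) (x : Fin d → ℤ) :
    Real.exp (δ * oneNorm x) ≤ ∑ s : Fin d → Bool, Real.exp (dotZ (δ • signVec s) x) := by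
  obtain ⟨s, hs⟩ := exists_signVec x
  rw [← hs, ← dotZ_smul]
  exact Finset.single_le_sum (f := fun s => Real.exp (dotZ (δ • signVec s) x))
    (fun _ _ => (Real.exp_pos _).le) (Finset.mem_univ s)

theorem exp_le_taylor (t : ℝ) : Real.exp t ≤ 1 + t + t ^ 2 * Real.exp |t| := by
  have he : 1 ≤ Real.exp |t| := Real.one_le_exp (abs_nonneg t)
  rcases le_or_gt |t| 1 with h | h
  · have := (abs_le.1 (Real.abs_exp_sub_one_sub_id_le h)).2
    nlinarith [sq_nonneg t]
  · rcases lt_abs.1 h with h | h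
    · rw [abs_of_pos (by linarith)]
      have h1 : Real.exp t ≤ t ^ 2 * Real.exp t :=
        le_mul_of_one_le_left (Real.exp_pos t).le (by nlinarith)
      linarith
    · have h1 : Real.exp t ≤ 1 := Real.exp_le_one_iff.2 (by linarith)
      nlinarith [sq_nonneg t]

theorem sq_le_exp {r : ℝ} (hr : 0 < r) (x : ℝ) (hx : 0 ≤ x) :
    x ^ 2 ≤ 8 / r ^ 2 * Real.exp (r / 2 * x) := by
  have h := Real.quadratic_le_exp_of_nonneg (x := r / 2 * x) (by positivity)
  have h2 : (r / 2 * x) ^ 2 / 2 ≤ Real.exp (r / 2 * x) := by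
    have : 0 ≤ r / 2 * x := by positivity
    linarith
  calc x ^ 2 = 8 / r ^ 2 * ((r / 2 * x) ^ 2 / 2) := by field_simp; norm_num
    _ ≤ _ := by gcongr

/-- Exponential moment of order `r`. -/
def ExpMoment (μ : (Fin d → ℤ) → ℝ) (r : ℝ) : Prop :=
  Summable fun z => μ z * Real.exp (r * oneNorm z)

section
variable {μ : (Fin d → ℤ) → ℝ}

theorem ExpMoment.summable_exp (hnn : ∀ z, 0 ≤ μ z) {r : ℝ} (h : ExpMoment μ r)
    {a : Fin d → ℝ} (ha : ‖a‖ ≤ r) : Summable fun z => μ z * Real.exp (dotZ a z) := by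
  refine Summable.of_nonneg_of_le (fun z => mul_nonneg (hnn z) (Real.exp_pos _).le)
    (fun z => ?_) h
  have h1 := (abs_le.1 (abs_dotZ_le a z)).2
  have := hnn z
  gcongr
  exact h1.trans (by gcongr)

theorem ExpMoment.summable_mul (hnn : ∀ z, 0 ≤ μ z) {r : ℝ} (hr : 0 < r) (h : ExpMoment μ r)
    (i : Fin d) : Summable fun z => μ z * (z i : ℝ) := by
  refine Summable.of_norm_bounded (h.mul_left r⁻¹) fun z => ?_
  have h1 : |(z i : ℝ)| ≤ oneNorm z := by
    have := natAbs_le_oneNorm z i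
    rw [← Int.cast_abs, ← Nat.cast_natAbs]
    exact_mod_cast this
  have h2 : r * oneNorm z ≤ Real.exp (r * oneNorm z) := by
    linarith [Real.add_one_le_exp (r * (oneNorm z : ℝ))]
  rw [Real.norm_eq_abs, abs_mul, abs_of_nonneg (hnn z), mul_left_comm]
  have := hnn z
  gcongr
  rw [le_inv_mul_iff₀ hr]
  exact le_trans (by gcongr) h2

theorem ExpMoment.summable_dotZ (hnn : ∀ z, 0 ≤ μ z) {r : ℝ} (hr : 0 < r) (h : ExpMoment μ r)
    (a : Fin d → ℝ) : HasSum (fun z => μ z * dotZ a z) (dotR a (Mvec μ)) := by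
  have := hasSum_sum (s := Finset.univ)
    fun i (_ : i ∈ Finset.univ) => ((h.summable_mul hnn hr i).hasSum.mul_left (a i))
  have h2 : (fun z => μ z * dotZ a z) = fun z => ∑ i, a i * (μ z * (z i : ℝ)) := by
    funext z
    rw [dotZ, Finset.mul_sum]
    exact Finset.sum_congr rfl fun i _ => by ring
  rw [h2]
  exact this

theorem ExpMoment.summable (hnn : ∀ z, 0 ≤ μ z) {r : ℝ} (hr : 0 < r) (h : ExpMoment μ r) :
    Summable μ := by
  simpa [dotZ] using h.summable_exp hnn (a := 0) (by simpa using hr.le)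

/-- Second order upper Taylor bound for the generating function. -/
theorem ExpMoment.taylor (hnn : ∀ z, 0 ≤ μ z) {r : ℝ} (hr : 0 < r) (h : ExpMoment μ r) :
    ∃ K : ℝ, 0 ≤ K ∧ ∀ a : Fin d → ℝ, ‖a‖ ≤ r / 2 →
      ∑' z, μ z * Real.exp (dotZ a z) ≤ ∑' z, μ z + dotR a (Mvec μ) + K * ‖a‖ ^ 2 := by
  refine ⟨8 / r ^ 2 * ∑' z, μ z * Real.exp (r * oneNorm z),
    mul_nonneg (by positivity) (tsum_nonneg fun z => mul_nonneg (hnn z) (Real.exp_pos _).le),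
    fun a ha => ?_⟩
  have h1 : HasSum (fun z => μ z + μ z * dotZ a z +
      8 / r ^ 2 * (μ z * Real.exp (r * oneNorm z)) * ‖a‖ ^ 2)
      (∑' z, μ z + dotR a (Mvec μ) + 8 / r ^ 2 * (∑' z, μ z * Real.exp (r * oneNorm z)) * ‖a‖ ^ 2) :=
    ((h.summable hnn hr).hasSum.add (h.summable_dotZ hnn hr a)).add
      (((Summable.hasSum h).mul_left _).mul_right _)
  rw [← h1.tsum_eq]
  refine (h.summable_exp hnn (by linarith)).tsum_le_tsum (fun z => ?_) h1.summable
  have h2 := exp_le_taylor (dotZ a z)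
  have h3 := abs_dotZ_le a z
  have h4 : (dotZ a z) ^ 2 ≤ ‖a‖ ^ 2 * (oneNorm z : ℝ) ^ 2 := by
    rw [← sq_abs, ← mul_pow]
    gcongr
  have h5 := sq_le_exp hr (oneNorm z) (Nat.cast_nonneg _)
  have h6 : Real.exp |dotZ a z| ≤ Real.exp (r / 2 * oneNorm z) := by
    gcongr
    exact h3.trans (by gcongr)
  have h7 : (dotZ a z) ^ 2 * Real.exp |dotZ a z| ≤
      ‖a‖ ^ 2 * (8 / r ^ 2 * Real.exp (r / 2 * oneNorm z)) * Real.exp (r / 2 * oneNorm z) :=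
    mul_le_mul (h4.trans (by gcongr)) h6 (Real.exp_pos _).le (by positivity)
  have h8 : Real.exp (r / 2 * oneNorm z) * Real.exp (r / 2 * oneNorm z)
      = Real.exp (r * oneNorm z) := by
    rw [← Real.exp_add]
    ring_nf
  calc μ z * Real.exp (dotZ a z)
      ≤ μ z * (1 + dotZ a z + ‖a‖ ^ 2 * (8 / r ^ 2 * Real.exp (r / 2 * oneNorm z)) *
          Real.exp (r / 2 * oneNorm z)) := by
        have := hnn z
        gcongr
        linarith
    _ = _ := by rw [← h8]; ring

theorem phiE_eq_ofReal (hnn : ∀ z, 0 ≤ μ z) {a : Fin d → ℝ}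
    (h : Summable fun z => μ z * Real.exp (dotZ a z)) :
    phiE μ a = ENNReal.ofReal (∑' z, μ z * Real.exp (dotZ a z)) :=
  (ENNReal.ofReal_tsum_of_nonneg (fun z => mul_nonneg (hnn z) (Real.exp_pos _).le) h).symm

theorem exists_expMoment (hnn : ∀ z, 0 ≤ μ z) (hsum : HasSum μ 1) (hA2 : A2 μ) :
    ∃ r : ℝ, 0 < r ∧ ExpMoment μ r := by
  obtain ⟨U, hU, hDU, hfin⟩ := hA2
  have h0 : (0 : Fin d → ℝ) ∈ U := by
    refine hDU ?_
    have : phiE μ 0 = 1 := by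
      simpa [phiE, dotZ] using tsum_ofReal_eq_one hnn hsum
    simp [Dset, this]
  obtain ⟨ε, hε, hball⟩ := Metric.isOpen_iff.1 hU 0 h0
  refine ⟨ε / 2, by positivity, ?_⟩
  have hs : ∀ s : Fin d → Bool, Summable fun z => μ z * Real.exp (dotZ ((ε / 2) • signVec s) z) := by
    intro s
    have hmem : (ε / 2) • signVec s ∈ U := by
      refine hball ?_
      rw [mem_ball_zero_iff, norm_smul, Real.norm_of_nonneg (by positivity)]
      have := norm_signVec_le s
      nlinarith
    have := ENNReal.summable_toReal (hfin _ hmem)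
    refine this.congr fun z => ?_
    rw [ENNReal.toReal_ofReal (mul_nonneg (hnn z) (Real.exp_pos _).le)]
  refine Summable.of_nonneg_of_le (fun z => mul_nonneg (hnn z) (Real.exp_pos _).le)
    (fun z => ?_) (summable_sum fun s (_ : s ∈ Finset.univ) => hs s)
  rw [← Finset.mul_sum]
  have := hnn z
  gcongr
  exact exp_oneNorm_le _ _

/-- The exponential `x ↦ exp (a · x)`. -/
noncomputable def expFun (a : Fin d → ℝ) : (Fin d → ℤ) → ℝ≥0∞ :=
  fun x => ENNReal.ofReal (Real.exp (dotZ a x))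

theorem tsum_expFun (hnn : ∀ z, 0 ≤ μ z) (a : Fin d → ℝ) (x : Fin d → ℤ) :
    ∑' z, ENNReal.ofReal (μ z) * expFun a (x + z) = phiE μ a * expFun a x := by
  unfold phiE expFun
  rw [← ENNReal.tsum_mul_right]
  refine tsum_congr fun z => ?_
  rw [dotZ_add, Real.exp_add, ← ENNReal.ofReal_mul (hnn z), ← ENNReal.ofReal_mul
    (mul_nonneg (hnn z) (Real.exp_pos _).le)]
  congr 1
  ring

theorem stepOp_expFun_le (hnn : ∀ z, 0 ≤ μ z) (A : Set (Fin d → ℤ)) (a : Fin d → ℝ) :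
    stepOp (fun z => ENNReal.ofReal (μ z)) A (expFun a) ≤ phiE μ a • expFun a := fun x =>
  (stepOp_le_tsum _ _ _ _).trans (tsum_expFun hnn a x).le

/-- Taylor bound for the normalised generating function in exponential form. -/
theorem ExpMoment.phiE_le (hnn : ∀ z, 0 ≤ μ z) (hsum : HasSum μ 1) {r : ℝ} (hr : 0 < r)
    (h : ExpMoment μ r) :
    ∃ K : ℝ, 0 ≤ K ∧ ∀ a : Fin d → ℝ, ‖a‖ ≤ r / 2 →
      phiE μ a ≤ ENNReal.ofReal (Real.exp (dotR a (Mvec μ) + K * ‖a‖ ^ 2)) := by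
  obtain ⟨K, hK, hT⟩ := h.taylor hnn hr
  refine ⟨K, hK, fun a ha => ?_⟩
  rw [phiE_eq_ofReal hnn (h.summable_exp hnn (by linarith))]
  refine ENNReal.ofReal_le_ofReal ((hT a ha).trans ?_)
  rw [hsum.tsum_eq]
  linarith [Real.add_one_le_exp (dotR a (Mvec μ) + K * ‖a‖ ^ 2)]

/-- Uniform bound for the Green functions of the walk with drift. -/
theorem exists_potential_bound (hnn : ∀ z, 0 ≤ μ z) (hsum : HasSum μ 1) {r : ℝ} (hr : 0 < r)
    (h : ExpMoment μ r) (hM : Mvec μ ≠ 0) :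
    ∃ C : ℝ, 0 < C ∧ ∀ A : Set (Fin d → ℤ), ∀ y x,
      potential (stepOp (fun z => ENNReal.ofReal (μ z)) A) (massAt A y) x ≤ ENNReal.ofReal C := by
  obtain ⟨K, hK, hT⟩ := h.phiE_le hnn hsum hr
  obtain ⟨j, hj⟩ := Function.ne_iff.1 hM
  simp only [Pi.zero_apply] at hj
  obtain ⟨a, ha⟩ : ∃ a : Fin d → ℝ, phiE μ a < 1 := by
    have hMj : 0 < |Mvec μ j| := abs_pos.2 hj
    set t : ℝ := min (r / 2) (|Mvec μ j| / (2 * (K + 1))) with ht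
    have ht0 : 0 < t := by positivity
    have ht1 : t ≤ r / 2 := min_le_left _ _
    have ht2 : t * (K + 1) ≤ |Mvec μ j| / 2 := by
      calc t * (K + 1) ≤ |Mvec μ j| / (2 * (K + 1)) * (K + 1) := by
            gcongr; exact min_le_right _ _
        _ = _ := by field_simp
    obtain ⟨σ, hσ, hσM⟩ : ∃ σ : ℝ, |σ| = 1 ∧ σ * Mvec μ j = -|Mvec μ j| := by
      rcases le_or_gt 0 (Mvec μ j) with h0 | h0
      · exact ⟨-1, by simp, by rw [abs_of_nonneg h0]; ring⟩
      · exact ⟨1, by simp, by rw [abs_of_neg h0]; ring⟩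
    have hn : ‖(Pi.single j (t * σ) : Fin d → ℝ)‖ = t := by
      rw [Pi.norm_single, norm_mul, Real.norm_eq_abs σ, hσ, Real.norm_of_nonneg ht0.le, mul_one]
    refine ⟨Pi.single j (t * σ), (hT _ (by rw [hn]; exact ht1)).trans_lt ?_⟩
    rw [hn, dotR_single, mul_assoc, hσM, ← ENNReal.ofReal_one]
    refine ENNReal.ofReal_lt_ofReal_iff_of_nonneg (Real.exp_pos _).le |>.2 ?_
    rw [← Real.exp_zero]
    refine Real.exp_lt_exp.2 ?_
    nlinarith
  have hsub : (1 : ℝ≥0∞) - phiE μ a ≠ 0 := (tsub_pos_of_lt ha).ne'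
  have hsub' : (1 : ℝ≥0∞) - phiE μ a ≠ ⊤ := ENNReal.sub_ne_top ENNReal.one_ne_top
  refine ⟨((1 - phiE μ a)⁻¹).toReal, ENNReal.toReal_pos (ENNReal.inv_ne_zero.2 hsub')
    (ENNReal.inv_ne_top.2 hsub), fun A y => ?_⟩
  rw [ENNReal.ofReal_toReal (ENNReal.inv_ne_top.2 hsub)]
  set C := (1 - phiE μ a)⁻¹ with hC
  set e : (Fin d → ℤ) → ℝ≥0∞ := fun x => min 1 (expFun a (x - y)) with he
  have hstep1 : ∀ x, stepOp (fun z => ENNReal.ofReal (μ z)) A e x ≤ 1 := fun x =>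
    stepOp_le_const (tsum_ofReal_eq_one hnn hsum).le A (fun x => min_le_left _ _) x
  have hstep2 : ∀ x, stepOp (fun z => ENNReal.ofReal (μ z)) A e x
      ≤ phiE μ a * expFun a (x - y) := by
    intro x
    refine (stepOp_le_tsum _ _ _ _).trans ?_
    rw [← tsum_expFun hnn a (x - y)]
    refine ENNReal.tsum_le_tsum fun z => ?_
    gcongr
    rw [sub_add_eq_add_sub]
    exact min_le_right _ _
  have key : massAt A y + stepOp (fun z => ENNReal.ofReal (μ z)) A (C • e) ≤ C • e := by
    rw [map_smul]
    intro x
    simp only [Pi.add_apply, Pi.smul_apply, smul_eq_mul]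
    by_cases hxy : x = y
    · subst hxy
      have h1 : e x = 1 := by simp [he, expFun, dotZ]
      have h2 := hstep2 x
      have h3 : expFun a (x - x) = 1 := by simp [expFun, dotZ]
      rw [h3, mul_one] at h2
      calc massAt A x x + C * stepOp (fun z => ENNReal.ofReal (μ z)) A e x
          ≤ 1 + C * phiE μ a := by
            gcongr
            exact massAt_le_one A x x
        _ = C * (1 - phiE μ a) + C * phiE μ a := by
            rw [hC, ENNReal.inv_mul_cancel hsub hsub']
        _ = C * e x := by rw [← mul_add, tsub_add_cancel_of_le ha.le, h1]
    · simp only [massAt, hxy, false_and, if_false, zero_add]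
      gcongr
      exact le_min (hstep1 x) ((hstep2 x).trans (mul_le_of_le_one_left zero_le ha.le))
  intro x
  refine (potential_le_of_add_le _ key x).trans ?_
  simp only [Pi.smul_apply, smul_eq_mul]
  exact mul_le_of_le_one_right zero_le (min_le_left _ _)

end

end Exponentials

section Bernoulli

theorem exists_base {lam : ℝ} (hl : 1 < lam) :
    ∃ θ : ℝ, 0 < θ ∧ Real.exp θ + Real.exp (-(lam * θ)) < 2 := by
  set θ : ℝ := min (1 / lam) ((lam - 1) / (2 * (1 + lam ^ 2))) with hθ
  have h0 : 0 < θ := by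
    have : 0 < lam - 1 := by linarith
    positivity
  have h1 : θ * lam ≤ 1 := by
    calc θ * lam ≤ 1 / lam * lam := by gcongr; exact min_le_left _ _
      _ = 1 := by field_simp
  have h2 : θ * (2 * (1 + lam ^ 2)) ≤ lam - 1 := by
    calc θ * (2 * (1 + lam ^ 2)) ≤ (lam - 1) / (2 * (1 + lam ^ 2)) * (2 * (1 + lam ^ 2)) := by
          gcongr; exact min_le_right _ _
      _ = lam - 1 := by field_simp
  have h3 : θ ≤ 1 := by nlinarith
  refine ⟨θ, h0, ?_⟩
  have e1 := (abs_le.1 (Real.abs_exp_sub_one_sub_id_le (x := θ) (by rw [abs_of_pos h0]; exact h3))).2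
  have e2 := (abs_le.1 (Real.abs_exp_sub_one_sub_id_le (x := -(lam * θ))
    (by rw [abs_neg, abs_of_pos (by positivity)]; linarith))).2
  nlinarith

theorem choose_le_choose_succ_add {lam θ : ℝ} (hl : 1 < lam) (hθ : 0 < θ) (i j : ℕ) : (j.choose i : ℝ) ≤ lam * j.choose (i + 1) +
      Real.exp θ * (Real.exp θ ^ i * Real.exp (-(lam * θ)) ^ (j - i) * j.choose i) := by
  have hc : (j.choose (i + 1) : ℝ) * (i + 1) = j.choose i * ((j - i : ℕ) : ℝ) := by
    exact_mod_cast Nat.choose_succ_right_eq j i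
  rcases le_or_gt ((i : ℝ) + 1) (lam * ((j - i : ℕ) : ℝ)) with h | h
  · have h1 : (j.choose i : ℝ) ≤ lam * j.choose (i + 1) := by
      have hi : (0 : ℝ) < i + 1 := by positivity
      refine le_of_mul_le_mul_right ?_ hi
      calc (j.choose i : ℝ) * (i + 1) ≤ j.choose i * (lam * ((j - i : ℕ) : ℝ)) := by gcongr
        _ = lam * j.choose (i + 1) * (i + 1) := by rw [mul_assoc lam, hc]; ring
    exact h1.trans (le_add_of_nonneg_right (by positivity))
  · have h1 : 1 ≤ Real.exp θ * (Real.exp θ ^ i * Real.exp (-(lam * θ)) ^ (j - i)) := by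
      rw [← Real.exp_nat_mul, ← Real.exp_nat_mul, ← Real.exp_add, ← Real.exp_add]
      refine Real.one_le_exp ?_
      nlinarith
    calc (j.choose i : ℝ) ≤ Real.exp θ * (Real.exp θ ^ i * Real.exp (-(lam * θ)) ^ (j - i)) *
          j.choose i := le_mul_of_one_le_left (by positivity) h1
      _ = Real.exp θ * (Real.exp θ ^ i * Real.exp (-(lam * θ)) ^ (j - i) * j.choose i) := by ring
      _ ≤ _ := le_add_of_nonneg_left (by positivity)

variable {V : Type*}

theorem one_add_pow_apply (T : Module.End ℝ≥0∞ (V → ℝ≥0∞)) (j : ℕ) (f : V → ℝ≥0∞) (x : V) :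
    ((1 + T) ^ j) f x = ∑ i ∈ Finset.range (j + 1), (j.choose i : ℝ≥0∞) * (T ^ i) f x := by
  rw [add_comm (1 : Module.End ℝ≥0∞ (V → ℝ≥0∞)) T, (Commute.one_right T).add_pow]
  simp only [one_pow, mul_one, LinearMap.sum_apply, Finset.sum_apply]
  refine Finset.sum_congr rfl fun i _ => ?_
  rw [← nsmul_eq_mul', LinearMap.smul_apply, Pi.smul_apply, nsmul_eq_mul]

/-- A binomial number of steps in a direction is almost invariant under one further step. -/
theorem bernoulli_base {lam θ : ℝ} (hl : 1 < lam) (hθ : 0 < θ)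
    (T : Module.End ℝ≥0∞ (V → ℝ≥0∞)) {b f : V → ℝ≥0∞} (hb : T b ≤ b) {S : ℝ≥0∞}
    (hf : f ≤ S • b) (j : ℕ) :
    T (((1 + T) ^ j) f) ≤ ENNReal.ofReal lam • ((1 + T) ^ j) f +
      (ENNReal.ofReal (Real.exp θ) *
        ENNReal.ofReal (Real.exp θ + Real.exp (-(lam * θ))) ^ j * S) • b := by
  intro x
  have hTf : ∀ i, (T ^ i) f x ≤ S * b x := fun i => by
    have h1 := endo_mono (T ^ i) hf x
    have h2 := endo_pow_le T hb i x
    rw [map_smul] at h1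
    exact h1.trans (by simpa using mul_le_mul_right h2 S)
  have hT : T (((1 + T) ^ j) f) x =
      ∑ i ∈ Finset.range (j + 1), (j.choose i : ℝ≥0∞) * (T ^ (i + 1)) f x := by
    have hcomm : T * (1 + T) ^ j = (1 + T) ^ j * T :=
      ((Commute.one_right T).add_right (Commute.refl T)).pow_right j
    change (T * (1 + T) ^ j) f x = _
    rw [hcomm]
    change ((1 + T) ^ j) (T f) x = _
    rw [one_add_pow_apply]
    simp only [endo_pow_succ']
  simp only [Pi.add_apply, Pi.smul_apply, smul_eq_mul]
  rw [hT]
  set q := Real.exp θ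
  set p := Real.exp (-(lam * θ))
  have hterm : ∀ i ∈ Finset.range (j + 1), (j.choose i : ℝ≥0∞) * (T ^ (i + 1)) f x ≤
      ENNReal.ofReal lam * ((j.choose (i + 1) : ℝ≥0∞) * (T ^ (i + 1)) f x) +
      ENNReal.ofReal q * (ENNReal.ofReal (q ^ i * p ^ (j - i) * j.choose i)) * (S * b x) := by
    intro i _
    have h1 := choose_le_choose_succ_add hl hθ i j
    have h2 : (j.choose i : ℝ≥0∞) ≤ ENNReal.ofReal lam * (j.choose (i + 1) : ℝ≥0∞) +
        ENNReal.ofReal q * (ENNReal.ofReal (q ^ i * p ^ (j - i) * j.choose i)) := by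
      rw [← ENNReal.ofReal_natCast, ← ENNReal.ofReal_natCast, ← ENNReal.ofReal_mul (by linarith),
        ← ENNReal.ofReal_mul (Real.exp_pos _).le, ← ENNReal.ofReal_add (by positivity)
        (by positivity)]
      exact ENNReal.ofReal_le_ofReal h1
    calc (j.choose i : ℝ≥0∞) * (T ^ (i + 1)) f x
        ≤ (ENNReal.ofReal lam * (j.choose (i + 1) : ℝ≥0∞) +
          ENNReal.ofReal q * (ENNReal.ofReal (q ^ i * p ^ (j - i) * j.choose i))) *
          (T ^ (i + 1)) f x := mul_le_mul_left h2 _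
      _ = ENNReal.ofReal lam * ((j.choose (i + 1) : ℝ≥0∞) * (T ^ (i + 1)) f x) +
          ENNReal.ofReal q * (ENNReal.ofReal (q ^ i * p ^ (j - i) * j.choose i)) *
          (T ^ (i + 1)) f x := by ring
      _ ≤ _ := by gcongr; exact hTf _
  refine (Finset.sum_le_sum hterm).trans ?_
  rw [Finset.sum_add_distrib, ← Finset.mul_sum, ← Finset.sum_mul, ← Finset.mul_sum,
    mul_assoc (ENNReal.ofReal q * _)]
  gcongr
  · have h0 : ((1 + T) ^ j) f x =
        ∑ i ∈ Finset.range (j + 1 + 1), (j.choose i : ℝ≥0∞) * (T ^ i) f x := by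
      rw [one_add_pow_apply, Finset.sum_range_succ _ (j + 1)]
      simp
    rw [h0, Finset.sum_range_succ' _ (j + 1)]
    exact le_self_add
  · rw [← ENNReal.ofReal_pow (by positivity), add_pow, ENNReal.ofReal_sum_of_nonneg]
    exact fun i _ => by positivity

/-- An operator dominating a multiple of `1 + T` produces functions almost invariant under `T`. -/
theorem bernoulli_pow {lam θ : ℝ} (hl : 1 < lam) (hθ : 0 < θ)
    (Q T : Module.End ℝ≥0∞ (V → ℝ≥0∞)) (hQT : Commute Q T) {b : V → ℝ≥0∞}
    (hbt : ∀ x, b x ≠ ⊤) (hb : T b = b) (hQb : Q b ≤ b) {c ρ : ℝ≥0∞} (hρ : ρ + 2 * c = 1)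
    (hQ : ∀ f, (∀ x, b x = 0 → f x = 0) → c • (f + T f) ≤ Q f) (N : ℕ) :
    ∀ (j : ℕ) (S : ℝ≥0∞) (f : V → ℝ≥0∞), S ≠ ⊤ → f ≤ S • b →
      T (((1 + T) ^ j) ((Q ^ N) f)) ≤ ENNReal.ofReal lam • ((1 + T) ^ j) ((Q ^ N) f) +
      (ENNReal.ofReal (Real.exp θ) *
        ENNReal.ofReal (Real.exp θ + Real.exp (-(lam * θ))) ^ j *
        (ρ + c * ENNReal.ofReal (Real.exp θ + Real.exp (-(lam * θ)))) ^ N * S) • b := by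
  set q := ENNReal.ofReal (Real.exp θ)
  set s := ENNReal.ofReal (Real.exp θ + Real.exp (-(lam * θ)))
  induction N with
  | zero =>
    intro j S f _ hf
    simpa using bernoulli_base hl hθ T hb.le hf j
  | succ N ih =>
    intro j S f hS hf
    have hsupp : ∀ g : V → ℝ≥0∞, g ≤ S • b → ∀ x, b x = 0 → g x = 0 := fun g hg x hx => by
      have := hg x
      simpa [hx] using this
    have hf0 := hQ f (hsupp f hf)
    obtain ⟨f', hf'⟩ : ∃ f', Q f = c • (f + T f) + f' :=
      ⟨Q f - c • (f + T f), funext fun x => (add_tsub_cancel_of_le (hf0 x)).symm⟩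
    obtain ⟨g, hg⟩ : ∃ g, S • b = f + g :=
      ⟨S • b - f, funext fun x => (add_tsub_cancel_of_le (hf x)).symm⟩
    have hg0 := hQ g (hsupp g (hg ▸ le_add_self))
    have hf's : f' ≤ (ρ * S) • b := by
      intro x
      have h1 : Q (S • b) = Q f + Q g := by rw [hg, map_add]
      have h2 : S • b = T f + T g := by rw [← map_add, ← hg, map_smul, hb]
      rw [map_smul, hf'] at h1
      have e1 := congrFun h1 x
      have e2 := congrFun h2 x
      have e3 := congrFun hg x
      have e4 := hg0 x
      have e5 := mul_le_mul_right (hQb x) S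
      simp only [Pi.add_apply, Pi.smul_apply, smul_eq_mul] at e1 e2 e3 e4 e5 ⊢
      have hfin : 2 * c * (S * b x) ≠ ⊤ := by
        have hc : 2 * c ≠ ⊤ := ne_top_of_le_ne_top ENNReal.one_ne_top (hρ ▸ le_add_self)
        exact ENNReal.mul_ne_top hc (ENNReal.mul_ne_top hS (hbt x))
      refine (ENNReal.add_le_add_iff_right hfin).1 ?_
      calc f' x + 2 * c * (S * b x) = f' x + (c * (S * b x) + c * (S * b x)) := by ring
        _ = f' x + (c * (f x + g x) + c * (T f x + T g x)) := by rw [← e3, ← e2]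
        _ = c * (f x + T f x) + f' x + c * (g x + T g x) := by ring
        _ ≤ c * (f x + T f x) + f' x + Q g x := by gcongr
        _ = S * Q b x := e1.symm
        _ ≤ S * b x := e5
        _ = (ρ + 2 * c) * (S * b x) := by rw [hρ, one_mul]
        _ = _ := by ring
    have hρ1 : ρ ≤ 1 := hρ ▸ le_self_add
    have hρS : ρ * S ≠ ⊤ := ENNReal.mul_ne_top (ne_top_of_le_ne_top ENNReal.one_ne_top hρ1) hS
    have hc1 : c ≤ 1 := by
      rw [← hρ, two_mul, ← add_assoc]
      exact le_add_self
    have i1 := ih (j + 1) S f hS hf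
    have i2 := ih j (ρ * S) f' hρS hf's
    have hcomm : ∀ h, (Q ^ N) ((1 + T) h) = (1 + T) ((Q ^ N) h) := fun h => by
      have : Commute (Q ^ N) (1 + T) :=
        ((Commute.one_right Q).add_right hQT).pow_left N
      exact congrArg (fun L : Module.End ℝ≥0∞ (V → ℝ≥0∞) => L h) this
    have hexp : ((1 + T) ^ j) ((Q ^ (N + 1)) f) =
        c • ((1 + T) ^ (j + 1)) ((Q ^ N) f) + ((1 + T) ^ j) ((Q ^ N) f') := by
      rw [endo_pow_succ' Q, hf', map_add, map_add, map_smul, map_smul]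
      congr 2
      rw [endo_pow_succ', ← hcomm]
      rfl
    rw [hexp, map_add, map_smul]
    intro x
    have j1 := mul_le_mul_right (i1 x) c
    have j2 := i2 x
    simp only [Pi.add_apply, Pi.smul_apply, smul_eq_mul] at j1 j2 ⊢
    refine (add_le_add j1 j2).trans (le_of_eq ?_)
    ring

end Bernoulli

section Ratio

theorem exists_pow_lower_of_irred {V : Type*} [AddCommGroup V] {μ : V → ℝ} {A : Set V}
    (hirr : Irred μ A) {x x' : V} (hx : x ∈ A) (hx' : x' ∈ A) :
    ∃ (k : ℕ) (c : ℝ), 0 < c ∧ ∀ t : V, (∀ x ∈ A, x + t ∈ A) → ∀ f : V → ℝ≥0∞,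
      ENNReal.ofReal c * f (x' + t) ≤
        (stepOp (fun z => ENNReal.ofReal (μ z)) A ^ k) f (x + t) := by
  obtain ⟨n, p, h0, hn, hA, hpos⟩ := hirr x hx x' hx'
  have key : ∀ j ≤ n, ∃ c : ℝ, 0 < c ∧ ∀ t : V, (∀ x ∈ A, x + t ∈ A) → ∀ f : V → ℝ≥0∞,
      ENNReal.ofReal c * f (p j + t) ≤
        (stepOp (fun z => ENNReal.ofReal (μ z)) A ^ j) f (x + t) := by
    intro j
    induction j with
    | zero => exact fun _ => ⟨1, one_pos, fun t _ f => by simp [h0]⟩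
    | succ j ih =>
      intro hj
      obtain ⟨c, hc, h⟩ := ih (by omega)
      have hm := hpos j (by omega)
      refine ⟨c * μ (p (j + 1) - p j), by positivity, fun t ht f => ?_⟩
      rw [endo_pow_succ']
      refine le_trans ?_ (h t ht _)
      rw [ENNReal.ofReal_mul hc.le, mul_assoc, stepOp_of_mem _ _ (ht _ (hA j (by omega)))]
      gcongr
      refine le_trans (le_of_eq ?_) (ENNReal.le_tsum (p (j + 1) - p j))
      congr 2
      abel
  obtain ⟨c, hc, h⟩ := key n le_rfl
  exact ⟨n, c, hc, fun t ht f => by simpa [hn] using h t ht f⟩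

variable {d : ℕ} {μ : (Fin d → ℤ) → ℝ}

theorem expFun_zero (a : Fin d → ℝ) : expFun a 0 = 1 := by simp [expFun, dotZ]

theorem expFun_add (a : Fin d → ℝ) (x y : Fin d → ℤ) :
    expFun a (x + y) = expFun a x * expFun a y := by
  unfold expFun
  rw [dotZ_add, Real.exp_add, ENNReal.ofReal_mul (Real.exp_pos _).le]

theorem stepOp_expFun_sub_le (hnn : ∀ z, 0 ≤ μ z) (A : Set (Fin d → ℤ)) (a : Fin d → ℝ)
    (y : Fin d → ℤ) : stepOp (fun z => ENNReal.ofReal (μ z)) A (fun x => expFun a (x - y)) ≤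
      phiE μ a • fun x => expFun a (x - y) := by
  have h : (fun x => expFun a (x - y)) = expFun a (-y) • expFun a := by
    funext x
    simp [sub_eq_add_neg, expFun_add, mul_comm]
  rw [h, map_smul, smul_comm]
  intro x
  exact mul_le_mul_right (stepOp_expFun_le hnn A a x) _

/-- The Green function of the walk killed outside `posDom Λ` is almost invariant under
translations tangent to the boundary, up to an exponentially small error. -/
theorem exists_ratio_bound (hnn : ∀ z, 0 ≤ μ z) (hsum : HasSum μ 1) {r : ℝ} (hr : 0 < r)
    (hmom : ExpMoment μ r) (hM : Mvec μ ≠ 0) {Λ : Set (Fin d)} (hirr : Irred μ (posDom Λ))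
    {lam : ℝ} (hl : 1 < lam) (w : Fin d → ℤ) (hw : ∀ i ∈ Λ, w i = 0) :
    ∃ C γ : ℝ, 0 < C ∧ 0 < γ ∧ ∀ x ∈ posDom Λ, ∀ y,
      potential (stepOp (fun z => ENNReal.ofReal (μ z)) (posDom Λ)) (massAt (posDom Λ) y) (x + w) ≤
      ENNReal.ofReal lam * potential (stepOp (fun z => ENNReal.ofReal (μ z)) (posDom Λ))
        (massAt (posDom Λ) y) x + ENNReal.ofReal (C * Real.exp (-(γ * oneNorm (x - y)))) := by
  obtain ⟨S, hS, hpot⟩ := exists_potential_bound hnn hsum hr hmom hM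
  obtain ⟨θ, hθ, hs2⟩ := exists_base hl
  have h1w : (1 : Fin d → ℤ) + w ∈ posDom Λ := posDom_add (one_mem_posDom Λ) fun i hi => (hw i hi).ge
  obtain ⟨k, c', hc', hlow⟩ := exists_pow_lower_of_irred hirr (one_mem_posDom Λ) h1w
  obtain ⟨K, hK, hphi⟩ := hmom.phiE_le hnn hsum hr
  set P := stepOp (fun z => ENNReal.ofReal (μ z)) (posDom Λ) with hP
  set T : Module.End ℝ≥0∞ ((Fin d → ℤ) → ℝ≥0∞) := shiftOp w with hT
  have hmem : ∀ x : Fin d → ℤ, x + w ∈ posDom Λ ↔ x ∈ posDom Λ := fun x =>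
    forall₂_congr fun i hi => by simp [hw i hi]
  have hPT : Commute P T := stepOp_shiftOp_commute _ hmem
  set c : ℝ := min c' 1 / 2 with hc
  have hc0 : 0 < c := by positivity
  have hcle : c ≤ 1 / 2 := by
    have := min_le_right c' 1
    linarith
  have hcle' : c ≤ c' / 2 := by
    have := min_le_left c' 1
    linarith
  set Q : Module.End ℝ≥0∞ ((Fin d → ℤ) → ℝ≥0∞) := (2⁻¹ : ℝ≥0∞) • (1 + P ^ k) with hQdef
  have hQapp : ∀ f x, Q f x = 2⁻¹ * (f x + (P ^ k) f x) := fun f x => rfl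
  set b : (Fin d → ℤ) → ℝ≥0∞ := fun x => if x ∈ posDom Λ then 1 else 0 with hb
  have hQT : Commute Q T :=
    ((Commute.one_left T).add_left (hPT.pow_left k)).smul_left _
  have hTb : T b = b := by
    funext x
    simp [hT, hb, hmem]
  have hPb : P b ≤ b := by
    intro x
    by_cases hx : x ∈ posDom Λ
    · simp only [hb, hx, if_true]
      refine stepOp_le_const (tsum_ofReal_eq_one hnn hsum).le _ (fun y => ?_) x
      split_ifs <;> simp
    · simp [hP, stepOp_of_notMem _ _ hx]
  have hhalf : (2 : ℝ≥0∞)⁻¹ * 2 = 1 := ENNReal.inv_mul_cancel (by simp) (by simp)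
  have hQb : Q b ≤ b := by
    intro x
    rw [hQapp]
    calc 2⁻¹ * (b x + (P ^ k) b x) ≤ 2⁻¹ * (b x + b x) := by
          gcongr
          exact endo_pow_le P hPb k x
      _ = b x := by rw [← two_mul, ← mul_assoc, hhalf, one_mul]
  set ρ : ℝ := 1 - 2 * c with hρ
  have hρ0 : 0 ≤ ρ := by linarith
  have hρE : ENNReal.ofReal ρ + 2 * ENNReal.ofReal c = 1 := by
    rw [show (2 : ℝ≥0∞) = ENNReal.ofReal 2 by simp, ← ENNReal.ofReal_mul (by norm_num),
      ← ENNReal.ofReal_add hρ0 (by positivity), hρ]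
    simp
  have hQ : ∀ f : (Fin d → ℤ) → ℝ≥0∞, (∀ x, b x = 0 → f x = 0) →
      ENNReal.ofReal c • (f + T f) ≤ Q f := by
    intro f hf x
    by_cases hx : x ∈ posDom Λ
    · have h1 := hlow (x - 1) (fun y hy => posDom_add hy fun i hi => by
        have := hx i hi
        simp
        omega) f
      rw [show (1 : Fin d → ℤ) + w + (x - 1) = x + w by abel,
        show (1 : Fin d → ℤ) + (x - 1) = x by abel] at h1
      rw [hQapp]
      change ENNReal.ofReal c * (f x + f (x + w)) ≤ _
      rw [mul_add, mul_add]
      have h2 : ENNReal.ofReal c ≤ 2⁻¹ := by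
        rw [show (2⁻¹ : ℝ≥0∞) = ENNReal.ofReal (1 / 2) by
          rw [one_div, ENNReal.ofReal_inv_of_pos (by norm_num)]; simp]
        exact ENNReal.ofReal_le_ofReal hcle
      have h3 : ENNReal.ofReal c ≤ 2⁻¹ * ENNReal.ofReal c' := by
        rw [show (2⁻¹ : ℝ≥0∞) = ENNReal.ofReal (1 / 2) by
          rw [one_div, ENNReal.ofReal_inv_of_pos (by norm_num)]; simp,
          ← ENNReal.ofReal_mul (by norm_num)]
        exact ENNReal.ofReal_le_ofReal (by linarith)
      refine add_le_add (mul_le_mul_left h2 _) ((mul_le_mul_left h3 _).trans ?_)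
      rw [mul_assoc]
      exact mul_le_mul_right h1 _
    · have h1 : f x = 0 := hf x (by simp [hb, hx])
      have h2 : f (x + w) = 0 := hf _ (by simp [hb, hmem, hx])
      simp [hT, h1, h2]
  have hstep := fun N => bernoulli_pow hl hθ Q T hQT (b := b) (fun x => by
    simp only [hb]; split_ifs <;> simp) hTb hQb hρE hQ N 0 (ENNReal.ofReal S)
  simp only [pow_zero, Module.End.one_apply, mul_one] at hstep
  set s : ℝ := Real.exp θ + Real.exp (-(lam * θ)) with hs
  have hs0 : 0 < s := by positivity
  obtain ⟨β, hβ, hβE⟩ : ∃ β : ℝ, 0 < β ∧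
      ENNReal.ofReal ρ + ENNReal.ofReal c * ENNReal.ofReal s = ENNReal.ofReal (Real.exp (-β)) := by
    refine ⟨-Real.log (ρ + c * s), ?_, ?_⟩
    · have h1 : ρ + c * s < 1 := by nlinarith
      have := Real.log_neg (by positivity : 0 < ρ + c * s) h1
      linarith
    · rw [neg_neg, Real.exp_log (by positivity), ENNReal.ofReal_add hρ0 (by positivity),
        ENNReal.ofReal_mul hc0.le]
  set θ' : ℝ := min (r / 2) 1 with hθ'
  have hθ'0 : 0 < θ' := by positivity
  set b0 : ℝ := ∑ i, |Mvec μ i| + K with hb0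
  have hb00 : 0 ≤ b0 := add_nonneg (Finset.sum_nonneg fun i _ => abs_nonneg _) hK
  set W : ℝ := (oneNorm w : ℝ) with hW
  set ι : ℝ := θ' / (2 * (1 + b0 * k)) with hι
  have hι0 : 0 < ι := by positivity
  refine ⟨Real.exp θ * S * Real.exp β + k * Real.exp (b0 * k + θ' * W) , min (β * ι) (θ' / 2),
    by positivity, by positivity, fun x hx y => ?_⟩
  set u := potential P (massAt (posDom Λ) y) with hu
  set n : ℝ := (oneNorm (x - y) : ℝ) with hn
  have hn0 : 0 ≤ n := Nat.cast_nonneg _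
  obtain ⟨σ, hσ⟩ := exists_signVec (x - y)
  set a : Fin d → ℝ := (-θ') • signVec σ with ha
  have hnorm : ‖a‖ ≤ θ' := by
    rw [ha, norm_smul, norm_neg, Real.norm_of_nonneg hθ'0.le]
    exact mul_le_of_le_one_right hθ'0.le (norm_signVec_le σ)
  have haE : phiE μ a ≤ ENNReal.ofReal (Real.exp b0) := by
    refine (hphi a (hnorm.trans (min_le_left _ _))).trans (ENNReal.ofReal_le_ofReal ?_)
    gcongr
    have h1 : ‖a‖ ≤ 1 := hnorm.trans (min_le_right _ _)
    refine add_le_add (Finset.sum_le_sum fun i _ => ?_)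
      (mul_le_of_le_one_right hK (pow_le_one₀ (norm_nonneg _) h1))
    refine (le_abs_self _).trans ?_
    rw [abs_mul]
    exact mul_le_of_le_one_left (abs_nonneg _) ((norm_le_pi_norm a i).trans h1)
  set E := ENNReal.ofReal (Real.exp b0) with hE
  have hE1 : 1 ≤ E := by
    rw [hE, ENNReal.one_le_ofReal]
    exact Real.one_le_exp hb00
  set e : (Fin d → ℤ) → ℝ≥0∞ := fun x => expFun a (x - y) with he
  have hPe : P e ≤ E • e := fun z =>
    (stepOp_expFun_sub_le hnn _ a y z).trans (mul_le_mul_left haE _)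
  have hme : massAt (posDom Λ) y ≤ e := by
    intro z
    unfold massAt
    split_ifs with h
    · simp [he, h.1, expFun_zero]
    · exact zero_le
  set g : (Fin d → ℤ) → ℝ≥0∞ := ∑ i ∈ Finset.range k, (P ^ i) (massAt (posDom Λ) y) with hg
  have hge : g ≤ (k * E ^ k) • e := by
    intro z
    rw [hg, Finset.sum_apply]
    refine (Finset.sum_le_card_nsmul _ _ (E ^ k * e z) fun i hi => ?_).trans ?_
    · refine ((endo_mono (P ^ i) hme z).trans (endo_pow_le_smul P hPe i z)).trans ?_
      exact mul_le_mul_left (pow_le_pow_right₀ hE1 (Finset.mem_range.1 hi).le) _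
    · simp [mul_assoc]
  have hQe : Q e ≤ E ^ k • e := by
    intro z
    rw [hQapp]
    calc 2⁻¹ * (e z + (P ^ k) e z) ≤ 2⁻¹ * (E ^ k * e z + E ^ k * e z) := by
          gcongr
          · exact le_mul_of_one_le_left zero_le (one_le_pow₀ hE1)
          · exact endo_pow_le_smul P hPe k z
      _ = (E ^ k • e) z := by rw [← two_mul, ← mul_assoc, hhalf, one_mul]; rfl
  have huk : u = (P ^ k) u + g := eq_pow_add_sum P (potential_stepOp _ _ _) k
  have huQ : u = (2⁻¹ : ℝ≥0∞) • g + Q u := by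
    funext z
    have h1 := congrFun huk z
    simp only [Pi.add_apply, Pi.smul_apply, smul_eq_mul] at h1 ⊢
    rw [hQapp]
    calc u z = 2⁻¹ * 2 * u z := by rw [hhalf, one_mul]
      _ = 2⁻¹ * (u z + u z) := by ring
      _ = 2⁻¹ * (u z + ((P ^ k) u z + g z)) := by nth_rw 2 [h1]
      _ = _ := by ring
  have hub : u ≤ ENNReal.ofReal S • b := by
    intro z
    by_cases hz : z ∈ posDom Λ
    · simpa [hb, hz] using hpot (posDom Λ) y z
    · have : u z = 0 := by
        rw [hu, potential_stepOp]
        simp [massAt, hz, stepOp_of_notMem _ _ hz]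
      simp [this]
  set N : ℕ := ⌊ι * n⌋₊ with hN
  have hN1 : (N : ℝ) ≤ ι * n := Nat.floor_le (by positivity)
  have hN2 : ι * n < N + 1 := Nat.lt_floor_add_one _
  have huN := eq_pow_add_sum Q huQ N
  have h1 := hstep N u ENNReal.ofReal_ne_top hub x
  have hQu : (Q ^ N) u x ≤ u x := by
    nth_rw 2 [huN]
    exact le_self_add
  have hsum' : (∑ m ∈ Finset.range N, (Q ^ m) ((2⁻¹ : ℝ≥0∞) • g)) (x + w) ≤
      ENNReal.ofReal (N * (k * Real.exp b0 ^ k * (Real.exp b0 ^ k) ^ N *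
        Real.exp (-(θ' * n) + θ' * W))) := by
    have hex : e (x + w) ≤ ENNReal.ofReal (Real.exp (-(θ' * n) + θ' * W)) := by
      refine ENNReal.ofReal_le_ofReal (Real.exp_le_exp.2 ?_)
      rw [add_sub_right_comm, dotZ_add, ha, dotZ_smul, hσ]
      have h2 := (abs_le.1 (abs_dotZ_le a w)).2
      rw [ha] at h2
      have h3 : ‖(-θ') • signVec σ‖ * (oneNorm w : ℝ) ≤ θ' * W := by gcongr
      linarith
    rw [Finset.sum_apply]
    refine (Finset.sum_le_card_nsmul _ _ (k * E ^ k * (E ^ k) ^ N *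
      ENNReal.ofReal (Real.exp (-(θ' * n) + θ' * W))) fun m hm => ?_).trans (le_of_eq ?_)
    · have h2 : (2⁻¹ : ℝ≥0∞) • g ≤ (k * E ^ k) • e := fun z =>
        (mul_le_of_le_one_left zero_le (by simp)).trans (hge z)
      have h3 := endo_mono (Q ^ m) h2 (x + w)
      have h4 := endo_pow_le_smul Q hQe m (x + w)
      rw [map_smul (Q ^ m) (k * E ^ k : ℝ≥0∞) e] at h3
      refine h3.trans ?_
      simp only [Pi.smul_apply, smul_eq_mul] at h4 ⊢
      rw [mul_assoc (k * E ^ k : ℝ≥0∞) _ _]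
      refine mul_le_mul_right (h4.trans (mul_le_mul' ?_ hex)) _
      exact pow_le_pow_right₀ (one_le_pow₀ hE1) (Finset.mem_range.1 hm).le
    · rw [Finset.card_range, nsmul_eq_mul, ENNReal.ofReal_mul (by positivity),
        ENNReal.ofReal_mul (by positivity), ENNReal.ofReal_mul (by positivity),
        ENNReal.ofReal_mul (by positivity), ENNReal.ofReal_natCast, ENNReal.ofReal_natCast,
        ENNReal.ofReal_pow (by positivity), ENNReal.ofReal_pow (by positivity),
        ENNReal.ofReal_pow (by positivity)]
  have hreal : Real.exp θ * Real.exp (-β) ^ N * S + N * (k * Real.exp b0 ^ k *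
      (Real.exp b0 ^ k) ^ N * Real.exp (-(θ' * n) + θ' * W)) ≤
      (Real.exp θ * S * Real.exp β + k * Real.exp (b0 * k + θ' * W)) *
        Real.exp (-(min (β * ι) (θ' / 2) * n)) := by
    rw [add_mul]
    refine add_le_add ?_ ?_
    · rw [← Real.exp_nat_mul, mul_right_comm, mul_assoc _ (Real.exp β), ← Real.exp_add]
      gcongr
      have : min (β * ι) (θ' / 2) * n ≤ β * ι * n := by
        gcongr
        exact min_le_left _ _
      nlinarith
    · have hNe : (N : ℝ) ≤ Real.exp N := by linarith [Real.add_one_le_exp (N : ℝ)]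
      calc (N : ℝ) * (k * Real.exp b0 ^ k * (Real.exp b0 ^ k) ^ N *
            Real.exp (-(θ' * n) + θ' * W))
          ≤ Real.exp N * (k * Real.exp b0 ^ k * (Real.exp b0 ^ k) ^ N *
            Real.exp (-(θ' * n) + θ' * W)) := by gcongr
        _ = k * Real.exp (N + k * b0 + N * (k * b0) + (-(θ' * n) + θ' * W)) := by
            rw [← Real.exp_nat_mul, ← Real.exp_nat_mul]
            simp only [Real.exp_add]
            ring
        _ ≤ k * Real.exp (b0 * k + θ' * W + -(min (β * ι) (θ' / 2) * n)) := by
            refine mul_le_mul_of_nonneg_left (Real.exp_le_exp.2 ?_) (Nat.cast_nonneg k)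
            have h5 : min (β * ι) (θ' / 2) * n ≤ θ' / 2 * n := by
              gcongr
              exact min_le_right _ _
            have h6 : (N : ℝ) * (1 + b0 * k) ≤ θ' / 2 * n := by
              calc (N : ℝ) * (1 + b0 * k) ≤ ι * n * (1 + b0 * k) := by gcongr
                _ = θ' / 2 * n := by rw [hι]; field_simp
            nlinarith
        _ = _ := by rw [Real.exp_add, mul_assoc]
  calc u (x + w) = T ((Q ^ N) u) x + (∑ m ∈ Finset.range N, (Q ^ m) ((2⁻¹ : ℝ≥0∞) • g)) (x + w) :=
        congrFun huN (x + w)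
    _ ≤ (ENNReal.ofReal lam * u x + ENNReal.ofReal (Real.exp θ * Real.exp (-β) ^ N * S)) +
        ENNReal.ofReal (N * (k * Real.exp b0 ^ k * (Real.exp b0 ^ k) ^ N *
        Real.exp (-(θ' * n) + θ' * W))) := by
      refine add_le_add (h1.trans ?_) hsum'
      simp only [Pi.add_apply, Pi.smul_apply, smul_eq_mul]
      refine add_le_add (mul_le_mul_right hQu _) ?_
      rw [hβE, ENNReal.ofReal_mul (by positivity), ENNReal.ofReal_mul (by positivity),
        ENNReal.ofReal_pow (by positivity)]
      refine mul_le_of_le_one_right zero_le ?_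
      simp only [hb]
      split_ifs <;> simp
    _ = ENNReal.ofReal lam * u x + ENNReal.ofReal (Real.exp θ * Real.exp (-β) ^ N * S +
        N * (k * Real.exp b0 ^ k * (Real.exp b0 ^ k) ^ N * Real.exp (-(θ' * n) + θ' * W))) := by
      rw [add_assoc, ← ENNReal.ofReal_add (by positivity) (by positivity)]
    _ ≤ _ := by
      gcongr

end Ratio

section LawOfLargeNumbers

variable {d : ℕ} {μ : (Fin d → ℤ) → ℝ}

theorem one_le_pow_add_expFun (hnn : ∀ z, 0 ≤ μ z) (hsum : HasSum μ 1) {Λ : Set (Fin d)}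
    {θ : ℝ} (hθ : 0 ≤ θ) {ρ : ℝ≥0∞} (hρ1 : 1 ≤ ρ)
    (hρ : ∀ i ∈ Λ, phiE μ (Pi.single i (-θ)) ≤ ρ) (n : ℕ) (x : Fin d → ℤ) :
    1 ≤ (stepOp (fun z => ENNReal.ofReal (μ z)) (posDom Λ) ^ n)
      (fun y => if y ∈ posDom Λ then 1 else 0) x +
      ρ ^ n * ∑ i, if i ∈ Λ then expFun (Pi.single i (-θ)) x else 0 := by
  have hout : ∀ x : Fin d → ℤ, x ∉ posDom Λ →
      1 ≤ ∑ i, if i ∈ Λ then expFun (Pi.single i (-θ)) x else 0 := by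
    intro x hx
    obtain ⟨i, hi, hxi⟩ : ∃ i ∈ Λ, x i ≤ 0 := by
      by_contra! h
      exact hx h
    refine le_trans ?_ (Finset.single_le_sum
      (f := fun i => if i ∈ Λ then expFun (Pi.single i (-θ)) x else 0)
      (fun _ _ => zero_le) (Finset.mem_univ i))
    simp only [hi, if_true, expFun, ENNReal.one_le_ofReal, dotZ_single]
    refine Real.one_le_exp ?_
    have : (x i : ℝ) ≤ 0 := by exact_mod_cast hxi
    nlinarith
  induction n generalizing x with
  | zero =>
    by_cases hx : x ∈ posDom Λ
    · simp [hx]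
    · simpa [hx] using hout x hx
  | succ n ih =>
    by_cases hx : x ∈ posDom Λ
    · rw [endo_pow_succ, stepOp_of_mem _ _ hx]
      calc (1 : ℝ≥0∞) = ∑' z, ENNReal.ofReal (μ z) * 1 := by
            simp [tsum_ofReal_eq_one hnn hsum]
        _ ≤ ∑' z, ENNReal.ofReal (μ z) *
            ((stepOp (fun z => ENNReal.ofReal (μ z)) (posDom Λ) ^ n)
              (fun y => if y ∈ posDom Λ then 1 else 0) (x + z) +
            ρ ^ n * ∑ i, if i ∈ Λ then expFun (Pi.single i (-θ)) (x + z) else 0) :=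
          ENNReal.tsum_le_tsum fun z => mul_le_mul_right (ih (x + z)) _
        _ ≤ _ := by
          simp only [mul_add, ENNReal.tsum_add]
          refine add_le_add le_rfl ?_
          simp only [mul_left_comm _ (ρ ^ n), ENNReal.tsum_mul_left]
          rw [pow_succ, mul_assoc]
          refine mul_le_mul_right ?_ _
          simp only [Finset.mul_sum]
          rw [Summable.tsum_finsetSum fun _ _ => ENNReal.summable]
          refine Finset.sum_le_sum fun i _ => ?_
          by_cases hi : i ∈ Λ
          · simp only [hi, if_true]
            rw [tsum_expFun hnn]
            exact mul_le_mul_left (hρ i hi) _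
          · simp [hi]
    · exact (hout x hx).trans ((le_mul_of_one_le_left zero_le (one_le_pow₀ hρ1)).trans
        le_add_self)

/-- Law of large numbers for the killed walk started far from the boundary. -/
theorem lln (hnn : ∀ z, 0 ≤ μ z) (hsum : HasSum μ 1) {r : ℝ} (hr : 0 < r)
    (hmom : ExpMoment μ r) {Λ : Set (Fin d)} (hm : ∀ i ∈ Λ, 0 ≤ Mvec μ i) {η : ℝ} (hη : 0 < η) :
    ∃ n0 : ℕ, ∀ n ≥ n0, ∀ u : Fin d → ℤ, (∀ i ∈ Λ, η * n ≤ u i) →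
      2⁻¹ ≤ (stepOp (fun z => ENNReal.ofReal (μ z)) (posDom Λ) ^ n)
        (fun z => if z ∈ posDom Λ ∧ ∀ j, |(z j : ℝ) - u j - n * Mvec μ j| ≤ η * n
          then 1 else 0) u := by
  obtain ⟨K, hK, hphi⟩ := hmom.phiE_le hnn hsum hr
  set θ : ℝ := min (r / 2) (η / (2 * (K + 1))) with hθ
  have hθ0 : 0 < θ := by positivity
  have hθ1 : θ ≤ r / 2 := min_le_left _ _
  have hθ2 : K * θ ^ 2 ≤ θ * η / 2 := by
    have : θ * (K + 1) ≤ η / 2 := by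
      calc θ * (K + 1) ≤ η / (2 * (K + 1)) * (K + 1) := by gcongr; exact min_le_right _ _
        _ = _ := by field_simp
    nlinarith
  have hphi1 : ∀ (σ : ℝ), |σ| = 1 → ∀ j, phiE μ (Pi.single j (σ * θ)) ≤
      ENNReal.ofReal (Real.exp (σ * θ * Mvec μ j + K * θ ^ 2)) := by
    intro σ hσ j
    have hn : ‖(Pi.single j (σ * θ) : Fin d → ℝ)‖ = θ := by
      rw [Pi.norm_single, norm_mul, Real.norm_eq_abs, hσ, Real.norm_of_nonneg hθ0.le, one_mul]
    have := hphi (Pi.single j (σ * θ)) (by rw [hn]; exact hθ1)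
    rwa [hn, dotR_single] at this
  obtain ⟨n0, hn0⟩ : ∃ n0 : ℕ, ∀ n ≥ n0, 3 * d * Real.exp (-(θ * η / 2) * n) ≤ 1 / 2 := by
    have ht : Tendsto (fun n : ℕ => 3 * d * Real.exp (-(θ * η / 2) * n)) atTop (𝓝 (3 * d * 0)) := by
      refine Tendsto.const_mul _ (Real.tendsto_exp_atBot.comp ?_)
      exact tendsto_natCast_atTop_atTop.const_mul_atTop_of_neg
        (neg_neg_of_pos (by positivity))
    rw [mul_zero] at ht
    exact eventually_atTop.1 (ht.eventually_le_const (by norm_num))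
  refine ⟨n0, fun n hn u hu => ?_⟩
  set P := stepOp (fun z => ENNReal.ofReal (μ z)) (posDom Λ) with hP
  set ε : ℝ≥0∞ := ENNReal.ofReal (Real.exp (-(θ * η / 2) * n)) with hε
  have ha := one_le_pow_add_expFun hnn hsum hθ0.le (ρ := ENNReal.ofReal (Real.exp (K * θ ^ 2)))
    (by rw [ENNReal.one_le_ofReal]; exact Real.one_le_exp (by positivity)) (Λ := Λ)
    (fun i hi => by
      have := hphi1 (-1) (by simp) i
      rw [neg_one_mul] at this
      refine this.trans (ENNReal.ofReal_le_ofReal (Real.exp_le_exp.2 ?_))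
      have := mul_nonneg hθ0.le (hm i hi)
      linarith) n u
  have ha2 : ENNReal.ofReal (Real.exp (K * θ ^ 2)) ^ n *
      (∑ i, if i ∈ Λ then expFun (Pi.single i (-θ)) u else 0) ≤ d * ε := by
    rw [Finset.mul_sum]
    refine (Finset.sum_le_card_nsmul _ _ ε fun i _ => ?_).trans (by simp)
    by_cases hi : i ∈ Λ
    · simp only [hi, if_true, expFun]
      rw [← ENNReal.ofReal_pow (Real.exp_pos _).le, ← ENNReal.ofReal_mul (by positivity),
        ← Real.exp_nat_mul, ← Real.exp_add, dotZ_single]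
      refine ENNReal.ofReal_le_ofReal (Real.exp_le_exp.2 ?_)
      have h1 := mul_le_mul_of_nonneg_left (hu i hi) hθ0.le
      have h2 := mul_le_mul_of_nonneg_left hθ2 (Nat.cast_nonneg (α := ℝ) n)
      linarith
    · simp [hi]
  set E : Fin d → ℝ → (Fin d → ℤ) → ℝ≥0∞ := fun j σ =>
    ENNReal.ofReal (Real.exp (-(σ * θ * (u j + n * Mvec μ j)) - θ * η * n)) •
      expFun (Pi.single j (σ * θ)) with hE
  have hsplit : (fun y => if y ∈ posDom Λ then (1 : ℝ≥0∞) else 0) ≤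
      (fun z => if z ∈ posDom Λ ∧ ∀ j, |(z j : ℝ) - u j - n * Mvec μ j| ≤ η * n
          then 1 else 0) + ∑ j, (E j 1 + E j (-1)) := by
    intro z
    simp only [Pi.add_apply]
    by_cases hz : z ∈ posDom Λ
    · by_cases hbox : ∀ j, |(z j : ℝ) - u j - n * Mvec μ j| ≤ η * n
      · simp [hz, hbox]
      · push Not at hbox
        obtain ⟨j, hj⟩ := hbox
        have hge : ∀ σ : ℝ, η * n < σ * ((z j : ℝ) - u j - n * Mvec μ j) → 1 ≤ E j σ z := by
          intro σ hσ
          simp only [hE, Pi.smul_apply, smul_eq_mul, expFun, dotZ_single]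
          rw [← ENNReal.ofReal_mul (Real.exp_pos _).le, ← Real.exp_add, ENNReal.one_le_ofReal]
          refine Real.one_le_exp ?_
          nlinarith
        have h1 : 1 ≤ E j 1 z + E j (-1) z := by
          rcases lt_abs.1 hj with h | h
          · exact (hge 1 (by linarith)).trans le_self_add
          · exact (hge (-1) (by linarith)).trans le_add_self
        simp only [hz, if_true]
        refine le_trans h1 (le_trans ?_ le_add_self)
        rw [Finset.sum_apply]
        exact Finset.single_le_sum (f := fun j => (E j 1 + E j (-1)) z)
          (fun _ _ => zero_le) (Finset.mem_univ j)
    · simp [hz]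
  have hEb : ∀ j σ, |σ| = 1 → (P ^ n) (E j σ) u ≤ ε := by
    intro j σ hσ
    have h1 := endo_pow_le_smul P (stepOp_expFun_le hnn (posDom Λ) (Pi.single j (σ * θ))) n u
    have h2 := pow_le_pow_left' (hphi1 σ hσ j) n
    rw [hE, map_smul]
    simp only [Pi.smul_apply, smul_eq_mul] at h1 ⊢
    refine (mul_le_mul_right (h1.trans (mul_le_mul_left h2 _)) _).trans ?_
    unfold expFun
    rw [← ENNReal.ofReal_pow (Real.exp_pos _).le, ← ENNReal.ofReal_mul (by positivity),
      ← ENNReal.ofReal_mul (by positivity), ← Real.exp_nat_mul, ← Real.exp_add, ← Real.exp_add,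
      dotZ_single]
    refine ENNReal.ofReal_le_ofReal (Real.exp_le_exp.2 ?_)
    have h2 := mul_le_mul_of_nonneg_left hθ2 (Nat.cast_nonneg (α := ℝ) n)
    linarith
  have hb := endo_mono (P ^ n) hsplit u
  rw [map_add, map_sum, Pi.add_apply, Finset.sum_apply] at hb
  have hb2 : ∑ j, (P ^ n) (E j 1 + E j (-1)) u ≤ d * (2 * ε) := by
    refine (Finset.sum_le_card_nsmul _ _ (2 * ε) fun j _ => ?_).trans (by simp)
    rw [map_add, two_mul]
    exact add_le_add (hEb j 1 (by simp)) (hEb j (-1) (by simp))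
  set X := (P ^ n) (fun z => if z ∈ posDom Λ ∧ ∀ j, |(z j : ℝ) - u j - n * Mvec μ j| ≤ η * n
          then 1 else 0) u with hX
  have hfin : 1 ≤ X + 2⁻¹ := by
    calc (1 : ℝ≥0∞) ≤ _ := ha
      _ ≤ (X + d * (2 * ε)) + d * ε := add_le_add (hb.trans (add_le_add le_rfl hb2)) ha2
      _ = X + 3 * d * ε := by ring
      _ ≤ X + 2⁻¹ := by
        refine add_le_add le_rfl ?_
        have h1 := ENNReal.ofReal_le_ofReal (hn0 n hn)
        rw [ENNReal.ofReal_mul (by positivity), ENNReal.ofReal_mul (by positivity)] at h1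
        simpa [hε] using h1
  have : (2⁻¹ : ℝ≥0∞) + 2⁻¹ ≤ X + 2⁻¹ := by rwa [ENNReal.inv_two_add_inv_two]
  exact (ENNReal.add_le_add_iff_right (by simp)).1 this

end LawOfLargeNumbers

section LowerBounds

variable {d : ℕ} {μ : (Fin d → ℤ) → ℝ}

theorem oneNorm_le_of_forall_abs_le {x : Fin d → ℤ} {b : ℝ} (h : ∀ i, |(x i : ℝ)| ≤ b) :
    (oneNorm x : ℝ) ≤ d * b := by
  unfold oneNorm
  push_cast
  refine (Finset.sum_le_card_nsmul _ _ b fun i _ => ?_).trans (by simp)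
  rw [Nat.cast_natAbs]
  simpa using h i

/-- Lower bound along the drift of an exponentially tilted walk. -/
theorem exists_reach_tilted (hnn : ∀ z, 0 ≤ μ z) {Λ : Set (Fin d)} (hirr : Irred μ (posDom Λ))
    {c m : Fin d → ℝ} {ϕ : ℝ} (hϕ : 1 ≤ ϕ)
    (hs : HasSum (fun z => μ z * Real.exp (dotZ c z)) ϕ) {r : ℝ} (hr : 0 < r)
    (hmom : ExpMoment (fun z => μ z * Real.exp (dotZ c z) / ϕ) r)
    (hm : Mvec (fun z => μ z * Real.exp (dotZ c z) / ϕ) = m) (hm0 : ∀ i ∈ Λ, 0 ≤ m i)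
    {ε : ℝ} (hε : 0 < ε) :
    ∃ n0 : ℕ, ∀ n ≥ n0, Reach (fun z => ENNReal.ofReal (μ z)) (posDom Λ)
      (n * (dotR c m + ε)) 1 (fun i => 1 + ⌊(n : ℝ) * m i⌋) := by
  have hϕ0 : 0 < ϕ := by linarith
  have hnn' : ∀ z, 0 ≤ μ z * Real.exp (dotZ c z) / ϕ := fun z =>
    div_nonneg (mul_nonneg (hnn z) (Real.exp_pos _).le) hϕ0.le
  have hsum' : HasSum (fun z => μ z * Real.exp (dotZ c z) / ϕ) 1 := by
    simpa [div_self hϕ0.ne'] using hs.div_const ϕ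
  obtain ⟨κ, hκ, hlin⟩ := exists_reach_linear hirr
  set D : ℝ := d * (3 * κ + ‖c‖) + 1 with hD
  have hD0 : 0 < D := by positivity
  set η : ℝ := ε / (2 * D) with hη
  have hη0 : 0 < η := by positivity
  have hηD : η * (d * (3 * κ + ‖c‖)) ≤ ε / 2 := by
    calc η * (d * (3 * κ + ‖c‖)) ≤ η * D := by gcongr; linarith
      _ = ε / 2 := by rw [hη]; field_simp
  obtain ⟨n0, hn0⟩ := lln hnn' hsum' hr hmom (Λ := Λ) (by rwa [hm]) hη0
  rw [hm] at hn0
  obtain ⟨n1, hn1⟩ := exists_nat_ge ((3 * κ * d + 1) * 2 / ε)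
  refine ⟨max n0 n1, fun n hn => ?_⟩
  have hnε : 3 * κ * d + 1 ≤ n * ε / 2 := by
    have : (3 * κ * d + 1) * 2 / ε ≤ n := hn1.trans (by exact_mod_cast (le_max_right _ _).trans hn)
    rw [div_le_iff₀ hε] at this
    linarith
  set u : Fin d → ℤ := fun _ => 1 + ⌈η * n⌉ with hu
  set v : Fin d → ℤ := fun i => 1 + ⌊(n : ℝ) * m i⌋ with hv
  have hceil0 : 0 ≤ ⌈η * n⌉ := Int.ceil_nonneg (by positivity)
  have hceil1 : (⌈η * n⌉ : ℝ) < η * n + 1 := Int.ceil_lt_add_one _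
  have hceil2 : η * n ≤ ⌈η * n⌉ := Int.le_ceil _
  have hceil0' : (0 : ℝ) ≤ ⌈η * n⌉ := by exact_mod_cast hceil0
  have huB : u ∈ posDom Λ := fun i _ => by simp only [hu]; omega
  have hvB : v ∈ posDom Λ := fun i hi => by
    have : 0 ≤ ⌊(n : ℝ) * m i⌋ := Int.floor_nonneg.2 (mul_nonneg (Nat.cast_nonneg _) (hm0 i hi))
    simp only [hv]
    omega
  have h1 := hlin 1 (one_mem_posDom Λ) u huB
  have hu1 : (oneNorm (u - 1) : ℝ) ≤ d * (η * n + 1) :=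
    oneNorm_le_of_forall_abs_le fun i => by
      simp only [hu, Pi.sub_apply, Pi.one_apply]
      push_cast
      rw [add_sub_cancel_left, abs_of_nonneg hceil0']
      exact hceil1.le
  set ℓ : ℝ := dotZ c u + n * dotR c m + d * (‖c‖ * (η * n)) + κ * (d * (2 * (η * n) + 2)) with hℓ
  have h2 : Reach (fun z => ENNReal.ofReal (μ z)) (posDom Λ) (ℓ - dotZ c u + 1) u v := by
    intro f hf
    set F : (Fin d → ℤ) → ℝ≥0∞ := fun x => expFun (-c) x * f x with hF
    have hFsup : stepOp (fun z => ENNReal.ofReal (μ z * Real.exp (dotZ c z) / ϕ)) (posDom Λ) F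
        ≤ F := by
      intro x
      by_cases hx : x ∈ posDom Λ
      · rw [stepOp_of_mem _ _ hx]
        have h3 := hf x
        rw [stepOp_of_mem _ _ hx] at h3
        refine le_trans ?_ (mul_le_mul_right h3 (expFun (-c) x))
        rw [← ENNReal.tsum_mul_left]
        refine ENNReal.tsum_le_tsum fun z => ?_
        simp only [hF]
        rw [← mul_assoc, ← mul_assoc]
        refine mul_le_mul_left ?_ _
        unfold expFun
        rw [← ENNReal.ofReal_mul (hnn' z), ← ENNReal.ofReal_mul (Real.exp_pos _).le]
        refine ENNReal.ofReal_le_ofReal ?_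
        rw [dotZ_add, Real.exp_add]
        have h4 : Real.exp (dotZ c z) * Real.exp (dotZ (-c) z) = 1 := by
          rw [← Real.exp_add, ← dotZ_add_left]
          simp [dotZ]
        calc μ z * Real.exp (dotZ c z) / ϕ * (Real.exp (dotZ (-c) x) * Real.exp (dotZ (-c) z))
            = μ z * Real.exp (dotZ (-c) x) / ϕ *
              (Real.exp (dotZ c z) * Real.exp (dotZ (-c) z)) := by ring
          _ = μ z * Real.exp (dotZ (-c) x) / ϕ := by rw [h4, mul_one]
          _ ≤ μ z * Real.exp (dotZ (-c) x) :=
            div_le_self (mul_nonneg (hnn z) (Real.exp_pos _).le) hϕ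
          _ = _ := mul_comm _ _
      · simp [stepOp_of_notMem _ _ hx]
    set g : (Fin d → ℤ) → ℝ≥0∞ := fun z =>
      if z ∈ posDom Λ ∧ ∀ j, |(z j : ℝ) - u j - n * m j| ≤ η * n then 1 else 0 with hg
    have hgF : (ENNReal.ofReal (Real.exp (-ℓ)) * f v) • g ≤ F := by
      intro z
      simp only [Pi.smul_apply, smul_eq_mul, hg]
      split_ifs with hz
      · have h5 := hlin z hz.1 v hvB f hf
        rw [mul_one]
        refine le_trans ?_ (mul_le_mul_right h5 (expFun (-c) z))
        rw [← mul_assoc]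
        refine mul_le_mul_left ?_ _
        unfold expFun
        rw [← ENNReal.ofReal_mul (Real.exp_pos _).le, ← Real.exp_add]
        refine ENNReal.ofReal_le_ofReal (Real.exp_le_exp.2 ?_)
        have h6 : (oneNorm (v - z) : ℝ) ≤ d * (2 * (η * n) + 2) :=
          oneNorm_le_of_forall_abs_le fun i => by
            have h7 := abs_le.1 (hz.2 i)
            have h8 := Int.floor_le ((n : ℝ) * m i)
            have h9 := Int.lt_floor_add_one ((n : ℝ) * m i)
            simp only [hu, hv, Pi.sub_apply] at h7 ⊢
            push_cast at h7 ⊢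
            rw [abs_le]
            constructor <;> linarith
        have h7 : dotZ (-c) z = -dotZ c z := by simp [dotZ]
        have h8 : dotZ c z - dotZ c u - n * dotR c m ≤ d * (‖c‖ * (η * n)) := by
          have : dotZ c z - dotZ c u - n * dotR c m =
              ∑ j, c j * ((z j : ℝ) - u j - n * m j) := by
            unfold dotZ dotR
            rw [Finset.mul_sum, ← Finset.sum_sub_distrib, ← Finset.sum_sub_distrib]
            exact Finset.sum_congr rfl fun j _ => by ring
          rw [this]
          refine (Finset.sum_le_card_nsmul _ _ (‖c‖ * (η * n)) fun j _ => ?_).trans (by simp)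
          refine (le_abs_self _).trans ?_
          rw [abs_mul]
          exact mul_le_mul (norm_le_pi_norm c j) (hz.2 j) (abs_nonneg _) (norm_nonneg _)
        have h9 := mul_le_mul_of_nonneg_left h6 hκ
        rw [h7]
        linarith
      · simp
    have h3 := endo_mono (stepOp (fun z => ENNReal.ofReal (μ z * Real.exp (dotZ c z) / ϕ))
      (posDom Λ) ^ n) hgF u
    have h4 := endo_pow_le _ hFsup n u
    have h5 := hn0 n ((le_max_left _ _).trans hn) u fun i _ => by
      simp only [hu]
      push_cast
      linarith
    rw [map_smul] at h3
    have h6 : ENNReal.ofReal (Real.exp (-ℓ)) * f v * 2⁻¹ ≤ expFun (-c) u * f u :=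
      (mul_le_mul_right h5 _).trans (h3.trans h4)
    have h7 : expFun c u * expFun (-c) u = 1 := by
      unfold expFun
      rw [← ENNReal.ofReal_mul (Real.exp_pos _).le, ← Real.exp_add, ← dotZ_add_left]
      simp [dotZ]
    calc ENNReal.ofReal (Real.exp (-(ℓ - dotZ c u + 1))) * f v
        ≤ expFun c u * (ENNReal.ofReal (Real.exp (-ℓ)) * f v * 2⁻¹) := by
          have h8 : ENNReal.ofReal (Real.exp (-(ℓ - dotZ c u + 1))) ≤
              expFun c u * ENNReal.ofReal (Real.exp (-ℓ)) * 2⁻¹ := by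
            rw [show (2⁻¹ : ℝ≥0∞) = ENNReal.ofReal (1 / 2) by
              rw [one_div, ENNReal.ofReal_inv_of_pos (by norm_num)]; simp]
            unfold expFun
            rw [← ENNReal.ofReal_mul (Real.exp_pos _).le, ← Real.exp_add,
              ← ENNReal.ofReal_mul (Real.exp_pos _).le]
            refine ENNReal.ofReal_le_ofReal ?_
            rw [show -(ℓ - dotZ c u + 1) = dotZ c u + -ℓ + -1 by ring, Real.exp_add _ (-1)]
            gcongr
            rw [Real.exp_neg, ← one_div]
            have := Real.add_one_le_exp (1 : ℝ)
            gcongr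
            linarith
          refine (mul_le_mul_left h8 _).trans (le_of_eq ?_)
          ring
      _ ≤ expFun c u * (expFun (-c) u * f u) := mul_le_mul_right h6 _
      _ = f u := by rw [← mul_assoc, h7, one_mul]
  refine (h1.trans h2).mono ?_
  have h3 := mul_le_mul_of_nonneg_left hu1 hκ
  have h4 := mul_le_mul_of_nonneg_left hηD (Nat.cast_nonneg (α := ℝ) n)
  rw [hℓ]
  nlinarith

/-- Lower bound along sequences asymptotic to the drift. -/
theorem eventually_reach_of_tendsto (hnn : ∀ z, 0 ≤ μ z) (hsum : HasSum μ 1) {r : ℝ} (hr : 0 < r)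
    (hmom : ExpMoment μ r) (hM : Mvec μ ≠ 0) (hM0 : ∀ i, 0 ≤ Mvec μ i)
    {Λ : Set (Fin d)} (hirr : Irred μ (posDom Λ)) {xs : ℕ → Fin d → ℤ}
    (hxs : ∀ n, xs n ∈ posAll) (hx1 : Tendsto (fun n => znorm (xs n)) atTop atTop)
    (hx2 : Tendsto (fun n i => (xs n i : ℝ) / znorm (xs n)) atTop
      (𝓝 (fun i => Mvec μ i / rnorm (Mvec μ)))) {δ : ℝ} (hδ : 0 < δ) :
    ∀ᶠ n in atTop, Reach (fun z => ENNReal.ofReal (μ z)) (posDom Λ)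
      (δ * oneNorm (xs n)) 1 (xs n) := by
  obtain ⟨κ, hκ, hlin⟩ := exists_reach_linear hirr
  set R := rnorm (Mvec μ) with hR
  have hR0 : 0 < R := by
    obtain ⟨j, hj⟩ := Function.ne_iff.1 hM
    exact lt_of_lt_of_le (abs_pos.2 hj) (Finset.single_le_sum (f := fun i => |Mvec μ i|)
      (fun _ _ => abs_nonneg _) (Finset.mem_univ j))
  have hMR : ∀ i, Mvec μ i ≤ R := fun i => (le_abs_self _).trans
    (Finset.single_le_sum (f := fun i => |Mvec μ i|) (fun _ _ => abs_nonneg _) (Finset.mem_univ i))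
  set ε : ℝ := δ / (4 * (κ * d + 1)) with hε
  have hε0 : 0 < ε := by positivity
  have hεκ : κ * d * ε ≤ δ / 4 := by
    calc κ * d * ε ≤ (κ * d + 1) * ε := by gcongr; linarith
      _ = δ / 4 := by rw [hε]; field_simp
  obtain ⟨n0, hn0⟩ := exists_reach_tilted hnn hirr (c := 0) (m := Mvec μ) (ϕ := 1) le_rfl
    (by simpa [dotZ] using hsum) hr (by simpa [dotZ] using hmom) (by simp [dotZ])
    (fun i _ => hM0 i) (ε := δ * R / 4) (by positivity)
  have hconv : ∀ᶠ n in atTop, ∀ i, |(xs n i : ℝ) / znorm (xs n) - Mvec μ i / R| < ε := by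
    rw [eventually_all]
    intro i
    have := (tendsto_pi_nhds.1 hx2 i)
    simpa [Real.dist_eq] using (Metric.tendsto_nhds.1 this) ε hε0
  filter_upwards [hconv, hx1.eventually_ge_atTop (R * (n0 + 1)), hx1.eventually_ge_atTop 1,
    hx1.eventually_ge_atTop (κ * (d * (R + 2)) * 2 / δ)] with n hn hL1 hL2 hL3
  rw [znorm_eq_oneNorm] at hL1 hL2 hL3
  simp only [znorm_eq_oneNorm] at hn
  set L : ℝ := (oneNorm (xs n) : ℝ) with hL
  set t : ℕ := ⌊L / R⌋₊ with ht
  have ht1 : (t : ℝ) ≤ L / R := Nat.floor_le (by positivity)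
  have ht2 : L / R < t + 1 := Nat.lt_floor_add_one _
  have htn : n0 ≤ t := Nat.le_floor (by rw [le_div_iff₀ hR0]; nlinarith)
  have h1 := hn0 t htn
  have hvB : (fun i => 1 + ⌊(t : ℝ) * Mvec μ i⌋ : Fin d → ℤ) ∈ posDom Λ := fun i _ => by
    have : 0 ≤ ⌊(t : ℝ) * Mvec μ i⌋ :=
      Int.floor_nonneg.2 (mul_nonneg (Nat.cast_nonneg _) (hM0 i))
    simp only
    omega
  have h2 := hlin _ hvB (xs n) (posAll_subset_posDom Λ (hxs n))
  refine (h1.trans h2).mono ?_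
  have h3 : (oneNorm (xs n - fun i => 1 + ⌊(t : ℝ) * Mvec μ i⌋) : ℝ) ≤ d * (ε * L + R + 2) :=
    oneNorm_le_of_forall_abs_le fun i => by
      have h4 := Int.floor_le ((t : ℝ) * Mvec μ i)
      have h5 := Int.lt_floor_add_one ((t : ℝ) * Mvec μ i)
      have h6 := abs_lt.1 (hn i)
      have hL0 : 0 < L := by linarith
      have h7 : (xs n i : ℝ) / L * L = xs n i := by field_simp
      have h8 : Mvec μ i / R * L = L / R * Mvec μ i := by ring
      have h9 : (xs n i : ℝ) - L / R * Mvec μ i ≤ ε * L := by nlinarith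
      have h10 : -(ε * L) ≤ (xs n i : ℝ) - L / R * Mvec μ i := by nlinarith
      have h11 := mul_le_mul_of_nonneg_right ht1 (hM0 i)
      have h12 := mul_le_mul_of_nonneg_right ht2.le (hM0 i)
      have h13 := hMR i
      simp only [Pi.sub_apply]
      push_cast
      rw [abs_le]
      constructor <;> nlinarith
  have h4 := mul_le_mul_of_nonneg_left h3 hκ
  have h5 : (t : ℝ) * (dotR 0 (Mvec μ) + δ * R / 4) ≤ δ / 4 * L := by
    have : dotR 0 (Mvec μ) = 0 := by simp [dotR]
    rw [this, zero_add]
    calc (t : ℝ) * (δ * R / 4) ≤ L / R * (δ * R / 4) := by gcongr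
      _ = δ / 4 * L := by field_simp
  rw [div_le_iff₀ hδ] at hL3
  have h6 := mul_le_mul_of_nonneg_right hεκ (by positivity : 0 ≤ L)
  nlinarith

end LowerBounds

section Exponential

variable {d : ℕ} {μ : (Fin d → ℤ) → ℝ}

theorem exists_dotZ_ne_zero_of_irred (hirr : Irred μ (posDom (∅ : Set (Fin d)))) {c : Fin d → ℝ}
    (hc : c ≠ 0) : ∃ z, 0 < μ z ∧ dotZ c z ≠ 0 := by
  obtain ⟨j, hj⟩ := Function.ne_iff.1 hc
  obtain ⟨k, p, h0, hk, -, hp⟩ := hirr 0 (by simp [posDom]) (Pi.single j 1) (by simp [posDom])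
  by_contra! H
  have key : ∀ n ≤ k, dotZ c (p n) = 0 := by
    intro n
    induction n with
    | zero => intro _; simp [h0, dotZ]
    | succ n ih =>
      intro hn
      have h1 := H _ (hp n (by omega))
      rw [dotZ_sub, ih (by omega)] at h1
      linarith
  have := key k le_rfl
  rw [hk] at this
  apply hj
  simpa [dotZ, Pi.single_apply] using this

theorem ExpMoment.one_le_tsum (hnn : ∀ z, 0 ≤ μ z) (hsum : HasSum μ 1) {r : ℝ} (hr : 0 < r)
    (h : ExpMoment μ r) {c : Fin d → ℝ} (hc : ‖c‖ ≤ r) (hcM : dotR c (Mvec μ) = 0) :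
    1 ≤ ∑' z, μ z * Real.exp (dotZ c z) := by
  have h1 := hsum.add (h.summable_dotZ hnn hr c)
  rw [hcM, add_zero] at h1
  refine hasSum_le (fun z => ?_) h1 (h.summable_exp hnn hc).hasSum
  nlinarith [Real.add_one_le_exp (dotZ c z), hnn z]

theorem ExpMoment.one_lt_tsum (hnn : ∀ z, 0 ≤ μ z) (hsum : HasSum μ 1) {r : ℝ} (hr : 0 < r)
    (h : ExpMoment μ r) (hirr : Irred μ (posDom (∅ : Set (Fin d)))) {c : Fin d → ℝ} (hc : ‖c‖ ≤ r)
    (hc0 : c ≠ 0) (hcM : dotR c (Mvec μ) = 0) :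
    1 < ∑' z, μ z * Real.exp (dotZ c z) := by
  have h1 := hsum.add (h.summable_dotZ hnn hr c)
  rw [hcM, add_zero] at h1
  obtain ⟨z, hz, hcz⟩ := exists_dotZ_ne_zero_of_irred hirr hc0
  refine hasSum_lt (i := z) (fun z => ?_) ?_ h1 (h.summable_exp hnn hc).hasSum
  · show μ z + μ z * dotZ c z ≤ _
    nlinarith [Real.add_one_le_exp (dotZ c z), hnn z]
  · nlinarith [Real.add_one_lt_exp hcz, hz]

theorem ExpMoment.continuousOn_tsum (hnn : ∀ z, 0 ≤ μ z) {r : ℝ}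
    (h : ExpMoment μ r) :
    ContinuousOn (fun c : Fin d → ℝ => ∑' z, μ z * Real.exp (dotZ c z)) (Metric.closedBall 0 r) := by
  refine _root_.continuousOn_tsum (u := fun z => μ z * Real.exp (r * oneNorm z)) (fun z => ?_) h ?_
  · unfold dotZ
    fun_prop
  · intro z c hc
    rw [Real.norm_of_nonneg (mul_nonneg (hnn z) (Real.exp_pos _).le)]
    refine mul_le_mul_of_nonneg_left (Real.exp_le_exp.2 ?_) (hnn z)
    refine (le_abs_self _).trans ((abs_dotZ_le c z).trans ?_)
    have : ‖c‖ ≤ r := by simpa using hc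
    gcongr

theorem eq_zero_of_forall_mul_add_sq_nonneg {a K η : ℝ} (hη : 0 < η) (hK : 0 ≤ K)
    (h : ∀ t, |t| ≤ η → 0 ≤ t * a + K * t ^ 2) : a = 0 := by
  by_contra ha
  have ha' := abs_pos.2 ha
  set σ := min (1 / (2 * (K + 1))) (η / |a|) with hσ
  have hσ0 : 0 < σ := lt_min (by positivity) (by positivity)
  have h1 : σ * (2 * (K + 1)) ≤ 1 := by
    rw [← le_div_iff₀ (by positivity)]; exact min_le_left _ _
  have h2 : σ * |a| ≤ η := by rw [← le_div_iff₀ ha']; exact min_le_right _ _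
  have h3 := h (-(σ * a)) (by rwa [abs_neg, abs_mul, abs_of_pos hσ0])
  have h4 : 0 < σ * a ^ 2 := by positivity
  nlinarith

theorem ExpMoment.tilt (hnn : ∀ z, 0 ≤ μ z) {r : ℝ} (h : ExpMoment μ r) {c : Fin d → ℝ}
    (hc : ‖c‖ ≤ r / 2) : ExpMoment (fun z => μ z * Real.exp (dotZ c z)) (r / 2) := by
  refine Summable.of_nonneg_of_le (fun z => ?_) (fun z => ?_) h
  · exact mul_nonneg (mul_nonneg (hnn z) (Real.exp_pos _).le) (Real.exp_pos _).le
  · rw [mul_assoc, ← Real.exp_add]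
    refine mul_le_mul_of_nonneg_left (Real.exp_le_exp.2 ?_) (hnn z)
    have := (le_abs_self _).trans (abs_dotZ_le c z)
    have h2 : ‖c‖ * oneNorm z ≤ r / 2 * oneNorm z := by gcongr
    linarith

/-- Existence of an exponential tilt, supported on `Λ`, whose drift points in direction `i`. -/
theorem exists_tilt (hnn : ∀ z, 0 ≤ μ z) (hsum : HasSum μ 1) {r : ℝ} (hr : 0 < r)
    (hmom : ExpMoment μ r) (hirr0 : Irred μ (posDom (∅ : Set (Fin d)))) {Λ : Set (Fin d)}
    (hΛ : ∀ i ∈ Λ, Mvec μ i = 0) {i : Fin d} (hi : i ∈ Λ) {ρ : ℝ} (hρ : 0 < ρ)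
    (hρr : ρ ≤ r / 2) :
    ∃ (c : Fin d → ℝ) (s : ℝ), ‖c‖ ≤ ρ ∧ (∀ j ∉ Λ, c j = 0) ∧ 0 < s ∧
      ∀ j ∈ Λ, Mvec (fun z => μ z * Real.exp (dotZ c z)) j = if j = i then s else 0 := by
  set φ : (Fin d → ℝ) → ℝ := fun c => ∑' z, μ z * Real.exp (dotZ c z) with hφ
  have hcont : ContinuousOn φ (Metric.closedBall 0 r) := hmom.continuousOn_tsum hnn
  set S : Set (Fin d → ℝ) := {c | ∀ j ∉ Λ, c j = 0} with hS
  have hSc : IsClosed S := by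
    simp only [hS, Set.ofPred_forall]
    exact isClosed_iInter fun j => isClosed_iInter fun _ =>
      isClosed_eq (continuous_apply j) continuous_const
  have hSM : ∀ c ∈ S, dotR c (Mvec μ) = 0 := by
    intro c hc
    refine Finset.sum_eq_zero fun j _ => ?_
    by_cases hj : j ∈ Λ
    · rw [hΛ j hj, mul_zero]
    · rw [hc j hj, zero_mul]
  have hball : IsCompact (Metric.closedBall (0 : Fin d → ℝ) ρ ∩ S) :=
    (isCompact_closedBall _ _).inter_right hSc
  have hsph : IsCompact (Metric.sphere (0 : Fin d → ℝ) ρ ∩ S) :=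
    (isCompact_sphere _ _).inter_right hSc
  have hsub : Metric.closedBall (0 : Fin d → ℝ) ρ ⊆ Metric.closedBall 0 r :=
    Metric.closedBall_subset_closedBall (by linarith)
  obtain ⟨c1, hc1, hmin1⟩ := hsph.exists_isMinOn (f := φ)
    ⟨Pi.single i ρ, by simp [hρ.le, Pi.norm_single], fun j hj => by
      rw [Pi.single_eq_of_ne]; rintro rfl; exact hj hi⟩
    (hcont.mono (Set.inter_subset_left.trans (Metric.sphere_subset_closedBall.trans hsub)))
  have hc1n : ‖c1‖ = ρ := by simpa using hc1.1
  have h1 : 1 < φ c1 := hmom.one_lt_tsum hnn hsum hr hirr0 (by linarith)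
    (by rintro rfl; simp at hc1n; linarith) (hSM c1 hc1.2)
  set s := (φ c1 - 1) / (2 * ρ) with hs
  have hs0 : 0 < s := div_pos (by linarith) (by linarith)
  have hsρ : s * ρ = (φ c1 - 1) / 2 := by rw [hs]; field_simp
  obtain ⟨c, hc, hmin⟩ := hball.exists_isMinOn (f := fun c => φ c - s * c i)
    ⟨0, by simp [hρ.le], fun j _ => rfl⟩
    ((hcont.mono (Set.inter_subset_left.trans hsub)).sub (by fun_prop))
  have hcρ : ‖c‖ ≤ ρ := by simpa using hc.1
  have hφ0 : φ 0 = 1 := by simpa [hφ, dotZ] using hsum.tsum_eq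
  have hlt : ‖c‖ < ρ := by
    refine lt_of_le_of_ne hcρ fun hne => ?_
    have h2 : φ c1 ≤ φ c := hmin1 ⟨by simpa using hne, hc.2⟩
    have h3 : φ c - s * c i ≤ φ 0 - s * (0 : Fin d → ℝ) i := hmin ⟨by simp [hρ.le], fun j _ => rfl⟩
    have h4 : s * c i ≤ s * ρ := by
      refine mul_le_mul_of_nonneg_left ?_ hs0.le
      exact (le_abs_self _).trans ((norm_le_pi_norm c i).trans hcρ)
    simp only [Pi.zero_apply, mul_zero, hφ0] at h3
    linarith
  refine ⟨c, s, hcρ, hc.2, hs0, fun j hj => ?_⟩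
  have hmt := hmom.tilt hnn (hcρ.trans hρr)
  have hnn' : ∀ z, 0 ≤ μ z * Real.exp (dotZ c z) :=
    fun z => mul_nonneg (hnn z) (Real.exp_pos _).le
  obtain ⟨K, hK, hT⟩ := hmt.taylor hnn' (by positivity)
  rw [← sub_eq_zero]
  refine eq_zero_of_forall_mul_add_sq_nonneg (η := min (ρ - ‖c‖) (r / 2 / 2))
    (lt_min (by linarith) (by positivity)) hK fun t ht => ?_
  have ht1 : ‖(Pi.single j t : Fin d → ℝ)‖ = |t| := by rw [Pi.norm_single]; rfl
  have h2 := hT (Pi.single j t) (by rw [ht1]; exact ht.trans (min_le_right _ _))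
  have h3 : φ c - s * c i ≤ φ (c + Pi.single j t) - s * (c + Pi.single j t : Fin d → ℝ) i := by
    refine hmin ⟨?_, fun k hk => ?_⟩
    · rw [mem_closedBall_zero_iff]
      refine (norm_add_le _ _).trans ?_
      rw [ht1]
      linarith [ht.trans (min_le_left _ _)]
    · rw [Pi.add_apply, hc.2 k hk, Pi.single_eq_of_ne, add_zero]
      rintro rfl; exact hk hj
  have h4 : φ (c + Pi.single j t) =
      ∑' z, μ z * Real.exp (dotZ c z) * Real.exp (dotZ (Pi.single j t) z) := by
    simp only [hφ]
    refine tsum_congr fun z => ?_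
    rw [dotZ_add_left, Real.exp_add, mul_assoc]
  rw [← h4, ht1, dotR_single, sq_abs] at h2
  change φ (c + Pi.single j t) ≤ φ c + _ + _ at h2
  rw [Pi.add_apply, mul_add] at h3
  by_cases hji : j = i
  · subst hji
    simp only [Pi.single_eq_same, if_true] at h3 ⊢
    linarith
  · rw [Pi.single_eq_of_ne (Ne.symm hji)] at h3
    simp only [hji, if_false]
    linarith

theorem exists_reach_single (hnn : ∀ z, 0 ≤ μ z) (hsum : HasSum μ 1) {r : ℝ} (hr : 0 < r)
    (hmom : ExpMoment μ r) (hirr0 : Irred μ (posDom (∅ : Set (Fin d)))) {Λ : Set (Fin d)}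
    (hirr : Irred μ (posDom Λ)) (hΛ : ∀ i ∈ Λ, Mvec μ i = 0) {i : Fin d} (hi : i ∈ Λ) {δ : ℝ}
    (hδ : 0 < δ) :
    ∃ K : ℕ, 1 ≤ K ∧ ∃ w : Fin d → ℤ, (∀ j ∈ Λ, w j = 0) ∧
      Reach (fun z => ENNReal.ofReal (μ z)) (posDom Λ) (δ * K) 1 (1 + Pi.single i (K : ℤ) + w) := by
  obtain ⟨c, s, hc, hcΛ, hs, hsm⟩ := exists_tilt hnn hsum hr hmom hirr0 hΛ hi
    (ρ := min (δ / 2) (r / 2)) (lt_min (by positivity) (by positivity)) (min_le_right _ _)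
  have hcr : ‖c‖ ≤ r / 2 := hc.trans (min_le_right _ _)
  have hcM : dotR c (Mvec μ) = 0 := by
    refine Finset.sum_eq_zero fun j _ => ?_
    by_cases hj : j ∈ Λ
    · rw [hΛ j hj, mul_zero]
    · rw [hcΛ j hj, zero_mul]
  set ϕ := ∑' z, μ z * Real.exp (dotZ c z) with hϕdef
  have hϕ : 1 ≤ ϕ := hmom.one_le_tsum hnn hsum hr (by linarith) hcM
  have hϕ0 : 0 < ϕ := by linarith
  have hmt : ExpMoment (fun z => μ z * Real.exp (dotZ c z) / ϕ) (r / 2) := by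
    have := (hmom.tilt hnn hcr).div_const ϕ
    refine this.congr fun z => ?_
    ring
  set m := Mvec (fun z => μ z * Real.exp (dotZ c z) / ϕ) with hm
  have hmj : ∀ j ∈ Λ, m j = if j = i then s / ϕ else 0 := by
    intro j hj
    have : m j = Mvec (fun z => μ z * Real.exp (dotZ c z)) j / ϕ := by
      rw [hm, Mvec, Mvec, ← tsum_div_const]
      exact tsum_congr fun z => by ring
    rw [this, hsm j hj]
    split_ifs <;> simp
  have hmi : m i = s / ϕ := by rw [hmj i hi, if_pos rfl]
  have hmi0 : 0 < m i := by rw [hmi]; positivity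
  have hcm : dotR c m = c i * m i := by
    refine Finset.sum_eq_single i (fun j _ hji => ?_) (by simp)
    by_cases hj : j ∈ Λ
    · rw [hmj j hj, if_neg hji, mul_zero]
    · rw [hcΛ j hj, zero_mul]
  have hci : c i * m i ≤ δ / 2 * m i := by
    refine mul_le_mul_of_nonneg_right ?_ hmi0.le
    exact (le_abs_self _).trans ((norm_le_pi_norm c i).trans (hc.trans (min_le_left _ _)))
  obtain ⟨n0, hn0⟩ := exists_reach_tilted hnn hirr hϕ
    (hmom.summable_exp hnn (by linarith)).hasSum (by positivity) hmt hm.symm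
    (fun j hj => by rw [hmj j hj]; split_ifs <;> positivity) (ε := δ * m i / 4) (by positivity)
  obtain ⟨n1, hn1⟩ := exists_nat_ge (4 / m i)
  set n := max n0 n1 with hn
  have hnm : 4 ≤ (n : ℝ) * m i := by
    rw [← div_le_iff₀ hmi0]
    exact hn1.trans (by exact_mod_cast le_max_right _ _)
  have hfl := Int.lt_floor_add_one ((n : ℝ) * m i)
  have hfl0 : 0 ≤ ⌊(n : ℝ) * m i⌋ := Int.floor_nonneg.2 (by linarith)
  obtain ⟨K, hK⟩ := Int.eq_ofNat_of_zero_le hfl0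
  have hKR : ((⌊(n : ℝ) * m i⌋ : ℤ) : ℝ) = K := by rw [hK]; simp
  rw [hKR] at hfl
  refine ⟨K, ?_, (fun j => 1 + ⌊(n : ℝ) * m j⌋) - (1 + Pi.single i (K : ℤ)), ?_, ?_⟩
  · have : (1 : ℝ) ≤ K := by linarith
    exact_mod_cast this
  · intro j hj
    by_cases hji : j = i
    · subst hji
      simp [hK]
    · simp [hmj j hj, hji]
  · rw [add_sub_cancel]
    refine (hn0 n (le_max_left _ _)).mono ?_
    rw [hcm]
    have h5 : (n : ℝ) * (c i * m i + δ * m i / 4) ≤ n * (δ / 2 * m i + δ * m i / 4) := by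
      gcongr
    have h6 : δ * (n * m i * (3 / 4)) ≤ δ * K := by
      refine mul_le_mul_of_nonneg_left ?_ hδ.le
      linarith
    nlinarith

theorem Reach.nsmul {ν : (Fin d → ℤ) → ℝ≥0∞} {Λ : Set (Fin d)} {k : ℝ} {u t : Fin d → ℤ}
    (ht : ∀ j ∈ Λ, 0 ≤ t j) (hu : u ∈ posDom Λ) (h : Reach ν (posDom Λ) k 1 (1 + t)) (q : ℕ) :
    Reach ν (posDom Λ) (q * k) u (u + q • t) := by
  induction q with
  | zero => simpa using Reach.refl u
  | succ q ih =>
    have h1 : Reach ν (posDom Λ) k (u + q • t) (u + (q + 1) • t) := by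
      have := h.shift (t := u + q • t - 1) fun x hx => posDom_add hx fun j hj => by
        have h1 : 0 < u j := hu j hj
        have h2 : 0 ≤ (q : ℤ) * t j := mul_nonneg (by positivity) (ht j hj)
        simp only [Pi.sub_apply, Pi.add_apply, nsmul_eq_mul, Pi.one_apply]
        change 0 ≤ u j + (q : ℤ) * t j - 1
        linarith
      convert this using 1
      · abel
      · rw [succ_nsmul]; abel
    refine (ih.trans h1).mono (le_of_eq ?_)
    push_cast
    ring

theorem exists_reach_lift_finset (hnn : ∀ z, 0 ≤ μ z) (hsum : HasSum μ 1) {r : ℝ} (hr : 0 < r)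
    (hmom : ExpMoment μ r) (hirr0 : Irred μ (posDom (∅ : Set (Fin d)))) {Λ : Set (Fin d)}
    (hirr : Irred μ (posDom Λ)) (hΛ : ∀ i ∈ Λ, Mvec μ i = 0) {δ : ℝ} (hδ : 0 < δ)
    (s : Finset (Fin d)) (hsΛ : ∀ i ∈ s, i ∈ Λ) :
    ∃ C R : ℝ, 0 ≤ C ∧ 0 ≤ R ∧ ∀ v ∈ posDom Λ, ∃ w ∈ posDom Λ,
      (∀ i ∈ Λ, w i = if i ∈ s then v i else 1) ∧ (oneNorm w : ℝ) ≤ R * (oneNorm v + 1) ∧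
      Reach (fun z => ENNReal.ofReal (μ z)) (posDom Λ) (C + s.card * δ * oneNorm v) 1 w := by
  induction s using Finset.induction_on with
  | empty =>
    refine ⟨0, oneNorm (1 : Fin d → ℤ), le_rfl, by positivity, fun v _ =>
      ⟨1, one_mem_posDom Λ, by simp, ?_, by simpa using Reach.refl 1⟩⟩
    nlinarith [show (0 : ℝ) ≤ (oneNorm (1 : Fin d → ℤ) : ℝ) * oneNorm v by positivity]
  | insert i s his ih =>
    obtain ⟨C, R, hC, hR, H⟩ := ih fun j hj => hsΛ j (Finset.mem_insert_of_mem hj)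
    have hi : i ∈ Λ := hsΛ i (Finset.mem_insert_self _ _)
    obtain ⟨K, hK, w0, hw0, hreach⟩ := exists_reach_single hnn hsum hr hmom hirr0 hirr hΛ hi hδ
    obtain ⟨κ, hκ, hlin⟩ := exists_reach_linear hirr
    refine ⟨C + κ * K, R + (K + oneNorm w0) + K, by positivity, by positivity, fun v hv => ?_⟩
    obtain ⟨w, hw, hwv, hwn, hwr⟩ := H v hv
    obtain ⟨n, hn⟩ := Int.eq_ofNat_of_zero_le (show 0 ≤ v i - 1 by have := hv i hi; omega)
    have hn' : n ≤ oneNorm v := by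
      have := natAbs_le_oneNorm v i
      omega
    have hdm := Nat.div_add_mod n K
    have hml : n % K ≤ K := (Nat.mod_lt _ hK).le
    have hqn : n / K ≤ n := Nat.div_le_self _ _
    set q := n / K
    set ρ := n % K
    set t : Fin d → ℤ := Pi.single i (K : ℤ) + w0 with ht
    have htΛ : ∀ j ∈ Λ, t j = if j = i then (K : ℤ) else 0 := by
      intro j hj
      simp [ht, hw0 j hj, Pi.single_apply]
    have htΛ0 : ∀ j ∈ Λ, 0 ≤ t j := by
      intro j hj
      rw [htΛ j hj]
      split_ifs <;> positivity
    have h1 := hreach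
    rw [add_assoc, ← ht] at h1
    have h2 := Reach.nsmul htΛ0 hw h1 q
    have hmem : w + q • t ∈ posDom Λ := posDom_add hw fun j hj => by
      rw [Pi.smul_apply]
      exact nsmul_nonneg (htΛ0 j hj) _
    have hmem2 : w + q • t + Pi.single i (ρ : ℤ) ∈ posDom Λ := posDom_add hmem fun j hj => by
      rw [Pi.single_apply]
      split_ifs <;> positivity
    have h3 := hlin _ hmem _ hmem2
    rw [add_sub_cancel_left, oneNorm_single, Int.natAbs_natCast] at h3
    have hKq : (K : ℝ) * q + ρ = n := by exact_mod_cast hdm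
    have hnR : (n : ℝ) ≤ oneNorm v := by exact_mod_cast hn'
    have hqR : (q : ℝ) ≤ oneNorm v := by exact_mod_cast hqn.trans hn'
    have hρR : (ρ : ℝ) ≤ K := by exact_mod_cast hml
    refine ⟨_, hmem2, fun j hj => ?_, ?_, ((hwr.trans h2).trans h3).mono ?_⟩
    · simp only [Pi.add_apply, Pi.smul_apply, htΛ j hj, hwv j hj, Finset.mem_insert,
        Pi.single_apply]
      by_cases hji : j = i
      · subst hji
        simp only [his, if_true, if_false, true_or, nsmul_eq_mul]
        zify at hdm
        have hn3 : v j - 1 = (n : ℤ) := hn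
        linarith [mul_comm (q : ℤ) K]
      · simp [hji]
    · have h4 : oneNorm (w + q • t + Pi.single i (ρ : ℤ)) ≤ oneNorm w + q * (K + oneNorm w0) + ρ := by
        refine (oneNorm_add_le _ _).trans (add_le_add ((oneNorm_add_le _ _).trans
          (add_le_add le_rfl ?_)) (by simp [oneNorm_single]))
        rw [oneNorm_smul]
        refine Nat.mul_le_mul_left _ ((oneNorm_add_le _ _).trans ?_)
        simp [oneNorm_single]
      have h5 : (oneNorm (w + q • t + Pi.single i (ρ : ℤ)) : ℝ) ≤
          oneNorm w + q * (K + oneNorm w0) + ρ := by exact_mod_cast h4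
      have h6 : (q : ℝ) * (K + oneNorm w0) ≤ oneNorm v * (K + oneNorm w0) := by gcongr
      have h7 : 0 ≤ (K : ℝ) * oneNorm v := by positivity
      nlinarith
    · rw [Finset.card_insert_of_notMem his]
      push_cast
      have h8 : (q : ℝ) * (δ * K) ≤ δ * oneNorm v := by
        have : (q : ℝ) * K ≤ oneNorm v := by nlinarith [show (0 : ℝ) ≤ ρ by positivity]
        nlinarith
      have h9 : κ * ρ ≤ κ * K := by gcongr
      linarith

/-- From `1` the walk reaches a point above any prescribed `Λ`-coordinates at subexponential
cost, when the drift vanishes on `Λ`. -/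
theorem exists_reach_lift (hnn : ∀ z, 0 ≤ μ z) (hsum : HasSum μ 1) {r : ℝ} (hr : 0 < r)
    (hmom : ExpMoment μ r) (hirr0 : Irred μ (posDom (∅ : Set (Fin d)))) {Λ : Set (Fin d)}
    (hirr : Irred μ (posDom Λ)) (hΛ : ∀ i ∈ Λ, Mvec μ i = 0) {δ : ℝ} (hδ : 0 < δ) :
    ∃ C R : ℝ, 0 ≤ C ∧ 0 ≤ R ∧ ∀ v ∈ posDom Λ, ∃ w ∈ posDom Λ,
      (∀ i ∈ Λ, w i = v i) ∧ (oneNorm w : ℝ) ≤ R * (oneNorm v + 1) ∧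
      Reach (fun z => ENNReal.ofReal (μ z)) (posDom Λ) (C + δ * oneNorm v) 1 w := by
  obtain ⟨C, R, hC, hR, H⟩ := exists_reach_lift_finset hnn hsum hr hmom hirr0 hirr hΛ
    (δ := δ / (d + 1)) (by positivity) (Finset.univ.filter (· ∈ Λ)) (by simp)
  refine ⟨C, R, hC, hR, fun v hv => ?_⟩
  obtain ⟨w, hw, hwv, hwn, hwr⟩ := H v hv
  refine ⟨w, hw, fun i hi => by simp [hwv i hi, hi], hwn, hwr.mono ?_⟩
  have h1 : ((Finset.univ.filter (· ∈ Λ)).card : ℝ) ≤ d + 1 := by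
    have := Finset.card_le_univ (Finset.univ.filter (· ∈ Λ))
    rw [Fintype.card_fin] at this
    have h2 : ((Finset.univ.filter (· ∈ Λ)).card : ℝ) ≤ d := by exact_mod_cast this
    linarith
  have h2 : ((Finset.univ.filter (· ∈ Λ)).card : ℝ) * (δ / (d + 1)) ≤ (d + 1) * (δ / (d + 1)) := by
    gcongr
  rw [mul_div_cancel₀ _ (by positivity)] at h2
  gcongr

end Exponential

theorem massAt_self {V : Type*} [AddCommGroup V] {A : Set V} {y : V} (hy : y ∈ A) :
    massAt A y y = 1 := by
  rw [massAt_of_mem hy, Pi.single_eq_same]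

theorem massAt_of_ne {V : Type*} [AddCommGroup V] (A : Set V) {x y : V} (h : x ≠ y) :
    massAt A y x = 0 := by
  by_cases hy : y ∈ A
  · rw [massAt_of_mem hy, Pi.single_eq_of_ne h]
  · rw [massAt_of_notMem hy, Pi.zero_apply]

section Domination

variable {d : ℕ} {μ : (Fin d → ℤ) → ℝ}

/-- One step of the walk killed outside `A`, as an operator. -/
noncomputable abbrev walkOp (μ : (Fin d → ℤ) → ℝ) (A : Set (Fin d → ℤ)) :
    Module.End ℝ≥0∞ ((Fin d → ℤ) → ℝ≥0∞) :=
  stepOp (fun z => ENNReal.ofReal (μ z)) A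

/-- The `ℝ≥0∞`-valued Green function `x ↦ G_A(x, y)`. -/
noncomputable abbrev greenE (μ : (Fin d → ℤ) → ℝ) (A : Set (Fin d → ℤ)) (y : Fin d → ℤ) :
    (Fin d → ℤ) → ℝ≥0∞ :=
  potential (walkOp μ A) (massAt A y)

theorem stepOp_greenE_le (μ : (Fin d → ℤ) → ℝ) (A : Set (Fin d → ℤ)) (y : Fin d → ℤ) :
    walkOp μ A (greenE μ A y) ≤ greenE μ A y := by
  conv_rhs => rw [greenE, potential_stepOp]
  exact le_add_self

theorem one_le_greenE (μ : (Fin d → ℤ) → ℝ) {A : Set (Fin d → ℤ)} {y : Fin d → ℤ} (hy : y ∈ A) :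
    1 ≤ greenE μ A y y := by
  rw [greenE, potential_stepOp, Pi.add_apply, massAt_self hy]
  exact le_self_add

theorem exists_ratio_bound_finset (hnn : ∀ z, 0 ≤ μ z) (hsum : HasSum μ 1) {r : ℝ} (hr : 0 < r)
    (hmom : ExpMoment μ r) (hM : Mvec μ ≠ 0) {Λ : Set (Fin d)} (hirr : Irred μ (posDom Λ))
    {lam : ℝ} (hl : 1 < lam) (W : Finset (Fin d → ℤ)) (hW : ∀ w ∈ W, ∀ i ∈ Λ, w i = 0) :
    ∃ C γ : ℝ, 0 < C ∧ 0 < γ ∧ ∀ w ∈ W, ∀ x ∈ posDom Λ, ∀ y,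
      greenE μ (posDom Λ) y (x + w) ≤ ENNReal.ofReal lam * greenE μ (posDom Λ) y x +
        ENNReal.ofReal (C * Real.exp (-(γ * oneNorm (x - y)))) := by
  induction W using Finset.induction_on with
  | empty => exact ⟨1, 1, one_pos, one_pos, by simp⟩
  | insert w W hw ih =>
    obtain ⟨C, γ, hC, hγ, H⟩ := ih fun v hv => hW v (Finset.mem_insert_of_mem hv)
    obtain ⟨C', γ', hC', hγ', H'⟩ := exists_ratio_bound hnn hsum hr hmom hM hirr hl w
      (hW w (Finset.mem_insert_self _ _))
    have aux : ∀ C₁ γ₁ : ℝ, 0 ≤ C₁ → C₁ ≤ max C C' → min γ γ' ≤ γ₁ → ∀ n : ℕ,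
        ENNReal.ofReal (C₁ * Real.exp (-(γ₁ * n))) ≤
          ENNReal.ofReal (max C C' * Real.exp (-(min γ γ' * n))) := by
      intro C₁ γ₁ h0 h1 h2 n
      refine ENNReal.ofReal_le_ofReal (mul_le_mul h1 (Real.exp_le_exp.2 (neg_le_neg ?_))
        (Real.exp_pos _).le (h0.trans h1))
      gcongr
    refine ⟨max C C', min γ γ', lt_max_of_lt_left hC, lt_min hγ hγ', fun v hv x hx y => ?_⟩
    rcases Finset.mem_insert.1 hv with rfl | hv
    · exact (H' x hx y).trans (add_le_add le_rfl
        (aux _ _ hC'.le (le_max_right _ _) (min_le_right _ _) _))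
    · exact (H v hv x hx y).trans (add_le_add le_rfl
        (aux _ _ hC.le (le_max_left _ _) (min_le_left _ _) _))

theorem le_of_unit_step_le {Λ : Set (Fin d)} {g : (Fin d → ℤ) → ℝ≥0∞} {lam η : ℝ≥0∞}
    (hl : 1 ≤ lam) {L : ℕ}
    (h : ∀ u ∈ posDom Λ, oneNorm u ≤ L → ∀ j ∉ Λ, ∀ ε : ℤ, ε = 1 ∨ ε = -1 →
      g (u + Pi.single j ε) ≤ lam * g u + η) {x : Fin d → ℤ} (hx : x ∈ posDom Λ) (n : ℕ) :
    ∀ z ∈ posDom Λ, (∀ i ∈ Λ, z i = x i) → oneNorm (x - z) = n → oneNorm z + n ≤ L →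
      g x ≤ lam ^ n * (g z + n * η) := by
  induction n with
  | zero =>
    intro z _ _ hn _
    rw [oneNorm_eq_zero, sub_eq_zero] at hn
    simp [hn]
  | succ n ih =>
    intro z hz hzx hn hL
    have hne : z ≠ x := by
      rintro rfl
      rw [sub_self, oneNorm_eq_zero.2 rfl] at hn
      omega
    obtain ⟨i, ε, hε, hi, hstep, hmem⟩ := exists_unit_step hne
    have hiΛ : i ∉ Λ := fun hi' => hi (hzx i hi')
    have hzn : oneNorm (z + Pi.single i ε) ≤ oneNorm z + 1 := by
      refine (oneNorm_add_le _ _).trans (add_le_add le_rfl ?_)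
      rw [oneNorm_single]
      rcases hε with rfl | rfl <;> simp
    have h1 := ih (z + Pi.single i ε) (hmem Λ hz hx) (fun j hj => by
      rw [Pi.add_apply, Pi.single_eq_of_ne (by rintro rfl; exact hiΛ hj), add_zero, hzx j hj])
      (by omega) (by omega)
    have h2 := h z hz (by omega) i hiΛ ε hε
    calc g x ≤ lam ^ n * (g (z + Pi.single i ε) + n * η) := h1
      _ ≤ lam ^ n * (lam * g z + η + n * η) := by gcongr
      _ ≤ lam ^ n * (lam * g z + lam * η + lam * (n * η)) := by
          refine mul_le_mul_right (add_le_add (add_le_add le_rfl ?_) ?_) _ <;>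
            exact le_mul_of_one_le_left' hl
      _ = lam ^ (n + 1) * (g z + (n + 1 : ℕ) * η) := by
          push_cast
          ring

theorem exists_greenE_le (hnn : ∀ z, 0 ≤ μ z) (hsum : HasSum μ 1) {r : ℝ} (hr : 0 < r)
    (hmom : ExpMoment μ r) (hM : Mvec μ ≠ 0) (hM0 : ∀ i, 0 ≤ Mvec μ i)
    (hirr0 : Irred μ (posDom (∅ : Set (Fin d)))) {Λ : Set (Fin d)}
    (hirr : Irred μ (posDom Λ)) (hΛ : ∀ i ∈ Λ, Mvec μ i = 0) {xs : ℕ → Fin d → ℤ}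
    (hxs : ∀ n, xs n ∈ posAll) (hx1 : Tendsto (fun n => znorm (xs n)) atTop atTop)
    (hx2 : Tendsto (fun n i => (xs n i : ℝ) / znorm (xs n)) atTop
      (𝓝 (fun i => Mvec μ i / rnorm (Mvec μ)))) {δ : ℝ} (hδ : 0 < δ) :
    ∃ C : ℝ, 0 ≤ C ∧ ∀ᶠ n in atTop, ∀ x ∈ posDom Λ,
      greenE μ (posDom Λ) (xs n) x ≤
        ENNReal.ofReal (C * Real.exp (δ * oneNorm x)) * greenE μ (posDom Λ) (xs n) 1 := by
  obtain ⟨C₀, R, hC₀, hR, hlift⟩ := exists_reach_lift hnn hsum hr hmom hirr0 hirr hΛ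
    (δ := δ / 2) (by positivity)
  obtain ⟨Cb, hCb, hbound⟩ := exists_potential_bound hnn hsum hr hmom hM
  set b : ℝ := δ / (4 * (R + 1)) with hb
  have hb0 : 0 < b := by positivity
  obtain ⟨C, γ, hC, hγ, hratio⟩ := exists_ratio_bound_finset hnn hsum hr hmom hM hirr
    (lam := Real.exp b) (Real.one_lt_exp_iff.2 hb0)
    ((Finset.univ.filter (· ∉ Λ) ×ˢ {1, -1}).image fun p : Fin d × ℤ => Pi.single p.1 p.2) (by
      intro w hw i hi
      simp only [Finset.mem_image, Finset.mem_product, Finset.mem_filter] at hw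
      obtain ⟨p, ⟨⟨-, hp⟩, -⟩, rfl⟩ := hw
      exact Pi.single_eq_of_ne (by rintro rfl; exact hp hi) _)
  set θ : ℝ := 1 / (4 * (2 * R + 1)) with hθ
  have hθ0 : 0 < θ := by positivity
  have hθ1 : (2 * R + 1) * θ = 1 / 4 := by rw [hθ]; field_simp
  set D : ℝ := Real.exp (δ / 4) * (Real.exp C₀ + (R + 1) / (δ / 4) * Real.exp (δ / 4) * C) with hD
  refine ⟨max D Cb, le_max_of_le_right hCb.le, ?_⟩
  filter_upwards [eventually_reach_of_tendsto hnn hsum hr hmom hM hM0 hirr hxs hx1 hx2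
      (show 0 < γ / 2 by positivity),
    eventually_reach_of_tendsto hnn hsum hr hmom hM hM0 hirr hxs hx1 hx2
      (show 0 < δ * θ by positivity), hx1.eventually_ge_atTop (4 * (2 * R + 1))] with n h1 h2 h3 x hx
  rw [znorm_eq_oneNorm] at h3
  set y := xs n
  set g := greenE μ (posDom Λ) y with hg
  have hgs : walkOp μ (posDom Λ) g ≤ g := stepOp_greenE_le _ _ _
  have hgy : 1 ≤ g y := one_le_greenE μ (posAll_subset_posDom Λ (hxs n))
  have hlow : ∀ k, Reach (fun z => ENNReal.ofReal (μ z)) (posDom Λ) k 1 y →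
      ENNReal.ofReal (Real.exp (-k)) ≤ g 1 := fun k hk =>
    (le_mul_of_one_le_right' hgy).trans (hk g hgs)
  rcases le_or_gt (oneNorm x : ℝ) (θ * oneNorm y) with hxy | hxy
  · obtain ⟨z, hz, hzx, hzn, hzr⟩ := hlift x hx
    have hgz : g z ≤ ENNReal.ofReal (Real.exp (C₀ + δ / 2 * oneNorm x)) * g 1 := by
      have := hzr g hgs
      calc g z = ENNReal.ofReal (Real.exp (C₀ + δ / 2 * oneNorm x)) *
            (ENNReal.ofReal (Real.exp (-(C₀ + δ / 2 * oneNorm x))) * g z) := by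
            rw [← mul_assoc, ← ENNReal.ofReal_mul (Real.exp_pos _).le, ← Real.exp_add]
            simp
        _ ≤ _ := by gcongr
    have hn1 : oneNorm (x - z) ≤ oneNorm x + oneNorm z := oneNorm_sub_le x z
    set m := oneNorm (x - z) with hm
    have hmR : (m : ℝ) ≤ (R + 1) * (oneNorm x + 1) := by
      have : (m : ℝ) ≤ oneNorm x + oneNorm z := by exact_mod_cast hn1
      linarith
    have hη : ENNReal.ofReal (C * Real.exp (-(γ / 2 * oneNorm y))) ≤ ENNReal.ofReal C * g 1 := by
      rw [ENNReal.ofReal_mul hC.le]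
      exact mul_le_mul_right (hlow _ h1) _
    have hstep := le_of_unit_step_le (Λ := Λ) (g := g) (lam := ENNReal.ofReal (Real.exp b))
      (η := ENNReal.ofReal C * g 1) (by simpa using hb0.le) (L := oneNorm z + m)
      (fun u hu huL j hj ε hε => by
        refine (hratio (Pi.single j ε) (Finset.mem_image.2 ⟨(j, ε), by
          rcases hε with rfl | rfl <;> simp [hj], rfl⟩) u hu y).trans (add_le_add le_rfl ?_)
        refine le_trans (ENNReal.ofReal_le_ofReal ?_) hη
        refine mul_le_mul_of_nonneg_left (Real.exp_le_exp.2 (neg_le_neg ?_)) hC.le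
        have h4 : oneNorm y ≤ oneNorm u + oneNorm (u - y) := by
          rw [oneNorm_sub_comm]; exact oneNorm_le_add_sub y u
        have h5 : (oneNorm y : ℝ) ≤ oneNorm u + oneNorm (u - y) := by exact_mod_cast h4
        have h6 : (oneNorm u : ℝ) ≤ oneNorm z + (oneNorm x + oneNorm z) := by
          exact_mod_cast huL.trans (by omega)
        have h7 : (2 * R + 1) * (oneNorm x : ℝ) ≤ (2 * R + 1) * (θ * oneNorm y) := by gcongr
        have h8 : (2 * R + 1) * (θ * oneNorm y) = oneNorm y / 4 := by
          rw [← mul_assoc, hθ1]; ring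
        have h9 : (oneNorm y : ℝ) / 2 ≤ oneNorm (u - y) := by nlinarith
        nlinarith) hx m z hz hzx rfl le_rfl
    refine hstep.trans ?_
    have e1 : ENNReal.ofReal (Real.exp b) ^ m ≤
        ENNReal.ofReal (Real.exp (δ / 4 * (oneNorm x + 1))) := by
      rw [← ENNReal.ofReal_pow (Real.exp_pos _).le, ← Real.exp_nat_mul]
      refine ENNReal.ofReal_le_ofReal (Real.exp_le_exp.2 ?_)
      calc (m : ℝ) * b ≤ (R + 1) * (oneNorm x + 1) * b := by gcongr
        _ = δ / 4 * (oneNorm x + 1) := by rw [hb]; field_simp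
    have e2 : (m : ℝ≥0∞) * (ENNReal.ofReal C * g 1) ≤
        ENNReal.ofReal ((R + 1) / (δ / 4) * Real.exp (δ / 4 * (oneNorm x + 1)) * C) * g 1 := by
      rw [← mul_assoc, ← ENNReal.ofReal_natCast, ← ENNReal.ofReal_mul (by positivity)]
      refine mul_le_mul_left (ENNReal.ofReal_le_ofReal (mul_le_mul_of_nonneg_right ?_ hC.le)) _
      have := Real.add_one_le_exp (δ / 4 * (oneNorm x + 1))
      calc (m : ℝ) ≤ (R + 1) / (δ / 4) * (δ / 4 * (oneNorm x + 1)) := by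
            refine hmR.trans (le_of_eq ?_)
            field_simp
        _ ≤ _ := by gcongr; linarith
    calc ENNReal.ofReal (Real.exp b) ^ m * (g z + m * (ENNReal.ofReal C * g 1))
        ≤ ENNReal.ofReal (Real.exp (δ / 4 * (oneNorm x + 1))) *
          (ENNReal.ofReal (Real.exp (C₀ + δ / 2 * oneNorm x)) * g 1 +
          ENNReal.ofReal ((R + 1) / (δ / 4) * Real.exp (δ / 4 * (oneNorm x + 1)) * C) * g 1) :=
          mul_le_mul' e1 (add_le_add hgz e2)
      _ = ENNReal.ofReal (Real.exp (δ / 4 * (oneNorm x + 1)) *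
          (Real.exp (C₀ + δ / 2 * oneNorm x) +
          (R + 1) / (δ / 4) * Real.exp (δ / 4 * (oneNorm x + 1)) * C)) * g 1 := by
          rw [← add_mul, ← ENNReal.ofReal_add (by positivity) (by positivity), ← mul_assoc,
            ← ENNReal.ofReal_mul (by positivity)]
      _ ≤ _ := by
          refine mul_le_mul_left (ENNReal.ofReal_le_ofReal ?_) _
          refine le_trans ?_ (mul_le_mul_of_nonneg_right (le_max_left D Cb) (Real.exp_pos _).le)
          have hN : (0 : ℝ) ≤ oneNorm x := by positivity
          have q1 : Real.exp (C₀ + δ / 2 * oneNorm x) ≤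
              Real.exp C₀ * Real.exp (3 / 4 * δ * oneNorm x) := by
            rw [← Real.exp_add]
            exact Real.exp_le_exp.2 (by nlinarith [mul_nonneg hδ.le hN])
          have q2 : Real.exp (δ / 4 * (oneNorm x + 1)) =
              Real.exp (δ / 4) * Real.exp (δ / 4 * oneNorm x) := by
            rw [← Real.exp_add]; ring_nf
          have q3 : Real.exp (δ / 4 * oneNorm x) ≤ Real.exp (3 / 4 * δ * oneNorm x) :=
            Real.exp_le_exp.2 (by nlinarith [mul_nonneg hδ.le hN])
          have q4 : Real.exp (δ * oneNorm x) =
              Real.exp (δ / 4 * oneNorm x) * Real.exp (3 / 4 * δ * oneNorm x) := by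
            rw [← Real.exp_add]; ring_nf
          rw [q2, q4, hD]
          calc _ ≤ Real.exp (δ / 4) * Real.exp (δ / 4 * oneNorm x) *
                (Real.exp C₀ * Real.exp (3 / 4 * δ * oneNorm x) + (R + 1) / (δ / 4) *
                  (Real.exp (δ / 4) * Real.exp (3 / 4 * δ * oneNorm x)) * C) := by gcongr
            _ = _ := by ring
  · calc g x ≤ ENNReal.ofReal Cb := hbound _ _ _
      _ = ENNReal.ofReal (Cb * Real.exp (δ * oneNorm x)) *
          ENNReal.ofReal (Real.exp (-(δ * oneNorm x))) := by
          rw [← ENNReal.ofReal_mul (by positivity), mul_assoc, ← Real.exp_add]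
          simp
      _ ≤ _ := by
          refine mul_le_mul' (ENNReal.ofReal_le_ofReal ?_) (le_trans
            (ENNReal.ofReal_le_ofReal (Real.exp_le_exp.2 (neg_le_neg ?_))) (hlow _ h2))
          · gcongr
            exact le_max_right _ _
          · rw [mul_assoc]
            gcongr

end Domination

section Exit

variable {d : ℕ} {μ : (Fin d → ℤ) → ℝ}

theorem dotR_add_left (a b q : Fin d → ℝ) : dotR (a + b) q = dotR a q + dotR b q := by
  simp [dotR, add_mul, Finset.sum_add_distrib]

theorem dotR_smul (t : ℝ) (a q : Fin d → ℝ) : dotR (t • a) q = t * dotR a q := by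
  simp [dotR, Finset.mul_sum, mul_assoc]

theorem dotR_signVec_le (s : Fin d → Bool) (q : Fin d → ℝ) : dotR (signVec s) q ≤ ∑ i, |q i| :=
  Finset.sum_le_sum fun i _ => (le_abs_self _).trans (by rw [abs_mul, abs_signVec, one_mul])

/-- The point with coordinates `1` on `Λ` and `t` off `Λ`. -/
noncomputable def rayPoint (Λ : Set (Fin d)) (t : ℕ) : Fin d → ℤ := fun i => if i ∈ Λ then 1 else t

theorem oneNorm_rayPoint_le (Λ : Set (Fin d)) (t : ℕ) :
    (oneNorm (rayPoint Λ t) : ℝ) ≤ d * ((t : ℝ) + 1) := by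
  refine oneNorm_le_of_forall_abs_le fun i => ?_
  have : (0 : ℝ) ≤ t := by positivity
  unfold rayPoint
  split_ifs
  · simp
  · rw [Int.cast_natCast, abs_of_nonneg this]; linarith

theorem exists_exit_bound (hnn : ∀ z, 0 ≤ μ z) (hsum : HasSum μ 1) {r : ℝ} (hr : 0 < r)
    (hmom : ExpMoment μ r) (hM0 : ∀ i, 0 ≤ Mvec μ i) :
    ∃ δ : ℝ, 0 < δ ∧ ∃ W : (Fin d → ℤ) → ℝ≥0∞, (∀ x, W x ≠ ⊤) ∧
      Tendsto (fun t => W (rayPoint (LambdaM μ) t)) atTop (𝓝 0) ∧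
      ∀ (C : ℝ≥0∞) (Φ : (Fin d → ℤ) → ℝ≥0∞),
        (∀ x, Φ x ≤ C * ENNReal.ofReal (Real.exp (δ * oneNorm x))) →
        (∀ x, Φ x ≠ 0 → x ∈ posDom (LambdaM μ) ∧ x ∉ posAll) →
        ∀ x, potential (walkOp μ posAll) (walkOp μ posAll Φ) x ≤ C * W x := by
  set Λ := LambdaM μ with hΛ
  obtain ⟨K, hK, hphi⟩ := hmom.phiE_le hnn hsum hr
  obtain ⟨m, hm, hm0⟩ : ∃ m : ℝ, (∀ i, i ∉ Λ → m ≤ Mvec μ i) ∧ 0 < m := by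
    have h1 : ∀ᶠ m in 𝓝[>] (0 : ℝ), ∀ i, i ∉ Λ → m ≤ Mvec μ i := by
      refine Filter.eventually_all.2 fun i => ?_
      by_cases hi : i ∈ Λ
      · exact Filter.Eventually.of_forall fun _ h => absurd hi h
      · have hpos : 0 < Mvec μ i := lt_of_le_of_ne (hM0 i) fun h => hi h.symm
        filter_upwards [Ioo_mem_nhdsGT hpos] with m hm _ using hm.2.le
    exact (h1.and self_mem_nhdsWithin).exists
  set Q : ℝ := ∑ i, |Mvec μ i| with hQ
  have hQ0 : 0 ≤ Q := Finset.sum_nonneg fun i _ => abs_nonneg _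
  set η : ℝ := min (1 / (2 * (d + 1))) (m / (2 * (Q + 1))) with hη
  have hη0 : 0 < η := lt_min (by positivity) (by positivity)
  have hηd : η * (d + 1) ≤ 1 / 2 := by
    calc η * (d + 1) ≤ 1 / (2 * (d + 1)) * (d + 1) := by gcongr; exact min_le_left _ _
      _ = 1 / 2 := by field_simp
  have hηQ : η * Q ≤ m / 2 := by
    calc η * Q ≤ m / (2 * (Q + 1)) * (Q + 1) := by
          gcongr
          · exact min_le_right _ _
          · linarith
      _ = m / 2 := by field_simp
  have hη1 : η ≤ 1 := by
    have : (0 : ℝ) ≤ η * d := by positivity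
    linarith
  set ε : ℝ := min (r / 4) (m / (16 * (K + 1))) with hε
  have hε0 : 0 < ε := lt_min (by positivity) (by positivity)
  have hεr : ε ≤ r / 4 := min_le_left _ _
  have hεK : ε * (16 * (K + 1)) ≤ m := by
    rw [← le_div_iff₀ (by positivity)]; exact min_le_right _ _
  set a : Fin d → (Fin d → Bool) → Fin d → ℝ :=
    fun i s => Pi.single i (-ε) + (η * ε) • signVec s with ha
  set W₀ : (Fin d → ℤ) → ℝ≥0∞ :=
    ∑ p ∈ Finset.univ.filter (fun p : Fin d × (Fin d → Bool) => p.1 ∉ Λ), expFun (a p.1 p.2)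
    with hW₀
  set c : ℝ≥0∞ := ENNReal.ofReal (Real.exp (-(ε * m / 4))) with hc
  have hc1 : c < 1 := by
    rw [hc, ENNReal.ofReal_lt_one, Real.exp_lt_one_iff]
    have : 0 < ε * m := by positivity
    linarith
  have hdot : ∀ i s x, dotZ (a i s) x = -ε * x i + η * ε * dotZ (signVec s) x := by
    intro i s x
    rw [ha, dotZ_add_left, dotZ_single, dotZ_smul]
  have hφ : ∀ i s, i ∉ Λ → phiE μ (a i s) ≤ c := by
    intro i s hi
    have hnorm : ‖a i s‖ ≤ 2 * ε := by
      refine (norm_add_le _ _).trans ?_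
      rw [Pi.norm_single, norm_smul, norm_neg, Real.norm_of_nonneg hε0.le,
        Real.norm_of_nonneg (by positivity)]
      have := norm_signVec_le s
      have h1 : η * ε * ‖signVec s‖ ≤ 1 * ε * 1 := by gcongr
      linarith
    refine (hphi _ (hnorm.trans (by linarith))).trans
      (ENNReal.ofReal_le_ofReal (Real.exp_le_exp.2 ?_))
    rw [ha, dotR_add_left, dotR_single, dotR_smul]
    have h1 : η * ε * dotR (signVec s) (Mvec μ) ≤ η * ε * Q := by
      gcongr; exact dotR_signVec_le s _
    have h2 : K * ‖a i s‖ ^ 2 ≤ K * (2 * ε) ^ 2 := by gcongr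
    have h3 : ε * m ≤ ε * Mvec μ i := by gcongr; exact hm i hi
    have h4 : ε * (η * Q) ≤ ε * (m / 2) := by gcongr
    have h5 : ε * (ε * (16 * (K + 1))) ≤ ε * m := by gcongr
    change -ε * Mvec μ i + η * ε * dotR (signVec s) (Mvec μ) + K * ‖a i s‖ ^ 2 ≤ _
    nlinarith [mul_pos hε0 hε0]
  have hPW : walkOp μ posAll W₀ ≤ c • W₀ := by
    rw [hW₀, map_sum, Finset.smul_sum]
    refine Finset.sum_le_sum fun p hp => (stepOp_expFun_le hnn _ _).trans ?_
    intro x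
    exact mul_le_mul_left (hφ p.1 p.2 (Finset.mem_filter.1 hp).2) _
  have hW₀top : ∀ x, W₀ x ≠ ⊤ := by
    intro x
    rw [hW₀, Finset.sum_apply]
    exact ENNReal.sum_ne_top.2 fun p _ => ENNReal.ofReal_ne_top
  have hinv : (1 - c)⁻¹ ≠ ⊤ := by
    rw [Ne, ENNReal.inv_eq_top, tsub_eq_zero_iff_le]; exact not_le.2 hc1
  refine ⟨η * ε, by positivity, fun x => (1 - c)⁻¹ * W₀ x,
    fun x => ENNReal.mul_ne_top hinv (hW₀top x), ?_, ?_⟩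
  · rw [← mul_zero ((1 - c)⁻¹)]
    refine ENNReal.Tendsto.const_mul ?_ (Or.inr hinv)
    have hzero : (0 : ℝ≥0∞) =
        ∑ p ∈ Finset.univ.filter (fun p : Fin d × (Fin d → Bool) => p.1 ∉ Λ), 0 := by simp
    rw [hzero]
    simp only [hW₀, Finset.sum_apply]
    refine tendsto_finsetSum _ fun p hp => ?_
    have hp' : p.1 ∉ Λ := (Finset.mem_filter.1 hp).2
    have h1 : Tendsto (fun t : ℕ => ENNReal.ofReal (Real.exp (ε / 2 - ε / 2 * t))) atTop (𝓝 0) := by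
      rw [← ENNReal.ofReal_zero]
      refine ENNReal.tendsto_ofReal (Real.tendsto_exp_atBot.comp ?_)
      refine Filter.tendsto_atBot_add_const_left _ _ (Filter.tendsto_neg_atTop_atBot.comp ?_)
      exact Tendsto.const_mul_atTop (by positivity) tendsto_natCast_atTop_atTop
    refine tendsto_of_tendsto_of_tendsto_of_le_of_le tendsto_const_nhds h1 (fun t => zero_le)
      fun t => ENNReal.ofReal_le_ofReal (Real.exp_le_exp.2 ?_)
    rw [hdot]
    have e1 : (rayPoint Λ t p.1 : ℝ) = t := by simp [rayPoint, hp']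
    have e2 : dotZ (signVec p.2) (rayPoint Λ t) ≤ d * ((t : ℝ) + 1) := by
      refine (le_abs_self _).trans ((abs_dotZ_le _ _).trans ?_)
      calc ‖signVec p.2‖ * (oneNorm (rayPoint Λ t) : ℝ) ≤ 1 * (oneNorm (rayPoint Λ t) : ℝ) := by
            gcongr; exact norm_signVec_le _
        _ ≤ _ := by rw [one_mul]; exact oneNorm_rayPoint_le Λ t
    rw [e1]
    have e3 : η * ε * dotZ (signVec p.2) (rayPoint Λ t) ≤ η * ε * (d * ((t : ℝ) + 1)) := by gcongr
    have e4 : ε * ((t : ℝ) + 1) * (η * (d + 1)) ≤ ε * ((t : ℝ) + 1) * (1 / 2) := by gcongr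
    have e5 : 0 ≤ ε * ((t : ℝ) + 1) * η := by positivity
    nlinarith
  · intro C Φ hΦ hsupp x
    have hΦW : Φ ≤ C • W₀ := by
      intro x
      by_cases h0 : Φ x = 0
      · rw [h0]; exact zero_le
      obtain ⟨hxB, hxA⟩ := hsupp x h0
      obtain ⟨i, hi⟩ : ∃ i, x i ≤ 0 := by
        by_contra! h
        exact hxA h
      have hiΛ : i ∉ Λ := fun h => absurd (hxB i h) (not_lt.2 hi)
      refine (hΦ x).trans (mul_le_mul_right ?_ C)
      refine (ENNReal.ofReal_le_ofReal (exp_oneNorm_le _ x)).trans ?_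
      rw [ENNReal.ofReal_sum_of_nonneg fun _ _ => (Real.exp_pos _).le, hW₀, Finset.sum_apply]
      have hinj : ∑ s : Fin d → Bool, expFun (a i s) x ≤
          ∑ p ∈ Finset.univ.filter (fun p : Fin d × (Fin d → Bool) => p.1 ∉ Λ),
            expFun (a p.1 p.2) x := by
        rw [← Finset.sum_image (s := Finset.univ) (g := fun s => (i, s))
          (f := fun p : Fin d × (Fin d → Bool) => expFun (a p.1 p.2) x)
          (fun s _ s' _ h => (Prod.ext_iff.1 h).2)]
        refine Finset.sum_le_sum_of_subset fun p hp => ?_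
        obtain ⟨s, -, rfl⟩ := Finset.mem_image.1 hp
        simpa using hiΛ
      refine le_trans (Finset.sum_le_sum fun s _ => ENNReal.ofReal_le_ofReal
        (Real.exp_le_exp.2 ?_)) hinj
      rw [hdot, dotZ_smul]
      have : (x i : ℝ) ≤ 0 := by exact_mod_cast hi
      nlinarith
    have h1 : walkOp μ posAll (C • W₀) ≤ c • (C • W₀) := by
      rw [map_smul, smul_comm]
      intro x
      exact mul_le_mul_right (hPW x) _
    calc potential (walkOp μ posAll) (walkOp μ posAll Φ) x
        ≤ potential (walkOp μ posAll) Φ x := by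
          rw [← potential_stepOp_comm]
          conv_rhs => rw [potential_stepOp]
          exact le_add_self
      _ ≤ potential (walkOp μ posAll) (C • W₀) x := potential_mono _ hΦW x
      _ ≤ (1 - c)⁻¹ * (C • W₀) x := potential_le_geom _ h1 x
      _ = _ := by rw [Pi.smul_apply, smul_eq_mul]; ring

end Exit

section Induced

variable {d : ℕ} {μ : (Fin d → ℤ) → ℝ}

theorem ofReal_muL (hnn : ∀ z, 0 ≤ μ z) (hsum : HasSum μ 1) (Λ : Set (Fin d)) (w : ↥Λ → ℤ) :
    ENNReal.ofReal (muL μ Λ w) = ∑' z, if projL Λ z = w then ENNReal.ofReal (μ z) else 0 := by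
  rw [muL, ENNReal.ofReal_tsum_of_nonneg]
  · exact tsum_congr fun z => by split_ifs <;> simp
  · intro z
    split_ifs
    exacts [hnn z, le_rfl]
  · refine Summable.of_nonneg_of_le (fun z => ?_) (fun z => ?_) hsum.summable
    · split_ifs
      exacts [hnn z, le_rfl]
    · split_ifs
      exacts [le_rfl, hnn z]

theorem muL_nonneg (hnn : ∀ z, 0 ≤ μ z) (Λ : Set (Fin d)) (w : ↥Λ → ℤ) : 0 ≤ muL μ Λ w :=
  tsum_nonneg fun z => by
    split_ifs
    exacts [hnn z, le_rfl]

theorem tsum_ofReal_muL_mul (hnn : ∀ z, 0 ≤ μ z) (hsum : HasSum μ 1) (Λ : Set (Fin d))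
    (u : ↥Λ → ℤ) (φ : (↥Λ → ℤ) → ℝ≥0∞) :
    ∑' v, ENNReal.ofReal (muL μ Λ (v - u)) * φ v =
      ∑' z, ENNReal.ofReal (μ z) * φ (u + projL Λ z) := by
  simp only [ofReal_muL hnn hsum, ← ENNReal.tsum_mul_right]
  rw [ENNReal.tsum_comm]
  refine tsum_congr fun z => ?_
  rw [tsum_eq_single (u + projL Λ z)]
  · simp
  · intro v hv
    rw [if_neg, zero_mul]
    rintro h
    exact hv (by rw [h]; abel)

theorem harmOn_muL_iff (hnn : ∀ z, 0 ≤ μ z) (hsum : HasSum μ 1) {Λ : Set (Fin d)}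
    {f : (↥Λ → ℤ) → ℝ} (hf : ∀ u ∈ posL Λ, 0 < f u) :
    HarmOn (muL μ Λ) (posL Λ) f ↔ ∀ u ∈ posL Λ,
      ∑' z, ENNReal.ofReal (μ z) *
        (if u + projL Λ z ∈ posL Λ then ENNReal.ofReal (f (u + projL Λ z)) else 0) =
      ENNReal.ofReal (f u) := by
  have key : ∀ u, ∑' v, (if v ∈ posL Λ then muL μ Λ (v - u) * f v else 0) =
      (∑' z, ENNReal.ofReal (μ z) *
        (if u + projL Λ z ∈ posL Λ then ENNReal.ofReal (f (u + projL Λ z)) else 0)).toReal := by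
    intro u
    rw [← tsum_ofReal_muL_mul hnn hsum Λ u
      (fun v => if v ∈ posL Λ then ENNReal.ofReal (f v) else 0), ENNReal.tsum_toReal_eq]
    · refine tsum_congr fun v => ?_
      split_ifs with hv
      · rw [ENNReal.toReal_mul, ENNReal.toReal_ofReal (muL_nonneg hnn _ _),
          ENNReal.toReal_ofReal (hf v hv).le]
      · simp
    · intro v
      refine ENNReal.mul_ne_top ENNReal.ofReal_ne_top ?_
      split_ifs
      exacts [ENNReal.ofReal_ne_top, ENNReal.zero_ne_top]
  refine forall₂_congr fun u hu => ?_
  rw [key u]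
  constructor
  · intro h
    have h0 := hf u hu
    rw [h] at h0
    rw [h, ENNReal.ofReal_toReal (ENNReal.toReal_pos_iff.1 h0).2.ne]
  · intro h
    rw [h, ENNReal.toReal_ofReal (hf u hu).le]

theorem projL_mem_posL_iff {Λ : Set (Fin d)} {x : Fin d → ℤ} :
    projL Λ x ∈ posL Λ ↔ x ∈ posDom Λ :=
  ⟨fun h i hi => h ⟨i, hi⟩, fun h i => h i i.2⟩

/-- Lift of a function on `ℤ^Λ_+` to a function on `ℤ^{Λ,d}_+`. -/
noncomputable def liftFun (Λ : Set (Fin d)) (f : (↥Λ → ℤ) → ℝ) (x : Fin d → ℤ) : ℝ≥0∞ :=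
  if x ∈ posDom Λ then ENNReal.ofReal (f (projL Λ x)) else 0

theorem liftFun_of_mem {Λ : Set (Fin d)} (f : (↥Λ → ℤ) → ℝ) {x : Fin d → ℤ} (hx : x ∈ posDom Λ) :
    liftFun Λ f x = ENNReal.ofReal (f (projL Λ x)) := if_pos hx

theorem liftFun_ne_top (Λ : Set (Fin d)) (f : (↥Λ → ℤ) → ℝ) (x : Fin d → ℤ) :
    liftFun Λ f x ≠ ⊤ := by
  unfold liftFun
  split_ifs
  exacts [ENNReal.ofReal_ne_top, ENNReal.zero_ne_top]

theorem liftFun_congr {Λ : Set (Fin d)} (f : (↥Λ → ℤ) → ℝ) {x y : Fin d → ℤ}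
    (h : ∀ i ∈ Λ, x i = y i) : liftFun Λ f x = liftFun Λ f y := by
  have h1 : projL Λ x = projL Λ y := funext fun i => h i i.2
  have h2 : x ∈ posDom Λ ↔ y ∈ posDom Λ := by
    rw [← projL_mem_posL_iff, ← projL_mem_posL_iff, h1]
  simp only [liftFun, h1, h2]

theorem walkOp_liftFun (hnn : ∀ z, 0 ≤ μ z) (hsum : HasSum μ 1) {Λ : Set (Fin d)}
    {f : (↥Λ → ℤ) → ℝ} (hf : ∀ u ∈ posL Λ, 0 < f u) (hh : HarmOn (muL μ Λ) (posL Λ) f) :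
    walkOp μ (posDom Λ) (liftFun Λ f) = liftFun Λ f := by
  funext x
  by_cases hx : x ∈ posDom Λ
  · rw [stepOp_of_mem _ _ hx, liftFun_of_mem f hx,
      ← (harmOn_muL_iff hnn hsum hf).1 hh _ (projL_mem_posL_iff.2 hx)]
    refine tsum_congr fun z => ?_
    have h1 : projL Λ (x + z) = projL Λ x + projL Λ z := rfl
    rw [liftFun, ← projL_mem_posL_iff, h1]
  · rw [stepOp_of_notMem _ _ hx, liftFun, if_neg hx]

theorem exists_liftFun_le (hnn : ∀ z, 0 ≤ μ z) (hsum : HasSum μ 1) {r : ℝ} (hr : 0 < r)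
    (hmom : ExpMoment μ r) (hirr0 : Irred μ (posDom (∅ : Set (Fin d)))) {Λ : Set (Fin d)}
    (hirr : Irred μ (posDom Λ)) (hΛ : ∀ i ∈ Λ, Mvec μ i = 0) {f : (↥Λ → ℤ) → ℝ}
    (hf : ∀ u ∈ posL Λ, 0 < f u) (hh : HarmOn (muL μ Λ) (posL Λ) f) {δ : ℝ} (hδ : 0 < δ) :
    ∃ C : ℝ≥0∞, C ≠ ⊤ ∧ ∀ x, liftFun Λ f x ≤ C * ENNReal.ofReal (Real.exp (δ * oneNorm x)) := by
  obtain ⟨C, R, -, -, H⟩ := exists_reach_lift hnn hsum hr hmom hirr0 hirr hΛ hδ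
  refine ⟨liftFun Λ f 1 * ENNReal.ofReal (Real.exp C),
    ENNReal.mul_ne_top (liftFun_ne_top _ _ _) ENNReal.ofReal_ne_top, fun x => ?_⟩
  by_cases hx : x ∈ posDom Λ
  · obtain ⟨w, -, hwx, -, hw⟩ := H x hx
    have h1 := hw (liftFun Λ f) (walkOp_liftFun hnn hsum hf hh).le
    rw [liftFun_congr f hwx] at h1
    calc liftFun Λ f x = ENNReal.ofReal (Real.exp (C + δ * oneNorm x)) *
          (ENNReal.ofReal (Real.exp (-(C + δ * oneNorm x))) * liftFun Λ f x) := by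
          rw [← mul_assoc, ← ENNReal.ofReal_mul (Real.exp_pos _).le, ← Real.exp_add]
          simp
      _ ≤ ENNReal.ofReal (Real.exp (C + δ * oneNorm x)) * liftFun Λ f 1 := by gcongr
      _ = _ := by
          rw [Real.exp_add, ENNReal.ofReal_mul (Real.exp_pos _).le]
          ring
  · rw [liftFun, if_neg hx]
    exact zero_le

theorem indicator_eq_exit_add (μ : (Fin d → ℤ) → ℝ) {A B : Set (Fin d → ℤ)} (hAB : A ⊆ B)
    {F : (Fin d → ℤ) → ℝ≥0∞} (hF : walkOp μ B F = F) :
    A.indicator F = walkOp μ A (exitPayoff A B F) + walkOp μ A (A.indicator F) := by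
  have hsplit : exitPayoff A B F + A.indicator F = F := by
    funext x
    by_cases hA : x ∈ A
    · simp [exitPayoff, hA]
    · by_cases hB : x ∈ B
      · simp [exitPayoff, hA, hB]
      · have : F x = 0 := by rw [← hF, stepOp_of_notMem _ _ hB]
        simp [exitPayoff, hA, hB, this]
  rw [← map_add, hsplit]
  funext x
  by_cases hA : x ∈ A
  · rw [Set.indicator_of_mem hA, stepOp_of_mem _ _ hA, ← stepOp_of_mem _ _ (hAB hA)]
    exact (congrFun hF x).symm
  · rw [Set.indicator_of_notMem hA, stepOp_of_notMem _ _ hA]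

/-- Expected value of `F` at the exit time from `posAll`, on the event that the walk is
still in `posDom Λ`. -/
noncomputable def exitPart (μ : (Fin d → ℤ) → ℝ) (F : (Fin d → ℤ) → ℝ≥0∞) :
    (Fin d → ℤ) → ℝ≥0∞ :=
  potential (walkOp μ posAll) (walkOp μ posAll (exitPayoff posAll (posDom (LambdaM μ)) F))

theorem exitPart_le {F : (Fin d → ℤ) → ℝ≥0∞} (hF : walkOp μ (posDom (LambdaM μ)) F = F) :
    exitPart μ F ≤ posAll.indicator F :=
  potential_le_of_add_le _ (indicator_eq_exit_add μ (posAll_subset_posDom _) hF).ge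

theorem hfun_eq_toReal (hnn : ∀ z, 0 ≤ μ z) (hsum : HasSum μ 1)
    {f : (↥(LambdaM μ) → ℤ) → ℝ} (hf : ∀ u ∈ posL (LambdaM μ), 0 < f u)
    (hh : HarmOn (muL μ (LambdaM μ)) (posL (LambdaM μ)) f) {x : Fin d → ℤ} (hx : x ∈ posAll) :
    hfun μ f x = (liftFun (LambdaM μ) f x - exitPart μ (liftFun (LambdaM μ) f) x).toReal := by
  have hxB : x ∈ posDom (LambdaM μ) := posAll_subset_posDom (LambdaM μ) hx
  have hle := exitPart_le (walkOp_liftFun hnn hsum hf hh) x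
  rw [Set.indicator_of_mem hx] at hle
  have hpay : exitPayoff posAll (posDom (LambdaM μ)) (liftFun (LambdaM μ) f) =
      exitPayoff posAll (posDom (LambdaM μ)) fun y => ENNReal.ofReal (f (projL (LambdaM μ) y)) := by
    funext y
    unfold exitPayoff
    split_ifs with h
    · exact liftFun_of_mem f (by tauto)
    · rfl
  have hE : exitPart μ (liftFun (LambdaM μ) f) x ≠ ⊤ := ne_top_of_le_ne_top (liftFun_ne_top _ _ _) hle
  rw [ENNReal.toReal_sub_of_le hle (liftFun_ne_top _ _ _), liftFun_of_mem f hxB,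
    ENNReal.toReal_ofReal (hf _ (projL_mem_posL_iff.2 hxB)).le, hfun, exitPart, hpay,
    exitExp_eq_toReal hnn hsum posAll (posDom (LambdaM μ)) (fun y => f (projL (LambdaM μ) y))
      (fun y hy => (hf _ (projL_mem_posL_iff.2 hy)).le)]
  rw [exitPart, hpay] at hE
  exact hE

theorem harmOn_toReal {A : Set (Fin d → ℤ)} (hnn : ∀ z, 0 ≤ μ z) {H : (Fin d → ℤ) → ℝ≥0∞}
    (hH : walkOp μ A H = H) (hfin : ∀ x, H x ≠ ⊤) {h : (Fin d → ℤ) → ℝ}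
    (hh : ∀ x ∈ A, h x = (H x).toReal) : HarmOn μ A h := by
  intro x hx
  rw [hh x hx, ← hH, stepOp_of_mem _ _ hx, ENNReal.tsum_toReal_eq
    fun z => ENNReal.mul_ne_top ENNReal.ofReal_ne_top (hfin _),
    ← (Equiv.addLeft x).tsum_eq fun y => if y ∈ A then μ (y - x) * h y else 0]
  refine tsum_congr fun z => ?_
  rw [Equiv.coe_addLeft, add_sub_cancel_left]
  split_ifs with hz
  · rw [ENNReal.toReal_mul, ENNReal.toReal_ofReal (hnn z), hh _ hz]
  · rw [← hH, stepOp_of_notMem _ _ hz]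
    simp

theorem hfun_pos_and_harmOn (hnn : ∀ z, 0 ≤ μ z) (hsum : HasSum μ 1) {r : ℝ} (hr : 0 < r)
    (hmom : ExpMoment μ r) (hM0 : ∀ i, 0 ≤ Mvec μ i) (hA1 : A1 μ)
    {f : (↥(LambdaM μ) → ℤ) → ℝ} (hf : ∀ u ∈ posL (LambdaM μ), 0 < f u)
    (hh : HarmOn (muL μ (LambdaM μ)) (posL (LambdaM μ)) f) :
    (∀ x ∈ posAll, 0 < hfun μ f x) ∧ HarmOn μ posAll (hfun μ f) := by
  set F := liftFun (LambdaM μ) f with hFdef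
  have hF : walkOp μ (posDom (LambdaM μ)) F = F := walkOp_liftFun hnn hsum hf hh
  set v : (Fin d → ℤ) → ℝ≥0∞ := posAll.indicator F with hv
  set E := exitPart μ F with hEdef
  have hEv : E ≤ v := exitPart_le hF
  have hvtop : ∀ x, v x ≠ ⊤ := fun x =>
    ne_top_of_le_ne_top (liftFun_ne_top (LambdaM μ) f x) (Set.indicator_le_self _ _ x)
  have hEtop : ∀ x, E x ≠ ⊤ := fun x => ne_top_of_le_ne_top (hvtop x) (hEv x)
  set H : (Fin d → ℤ) → ℝ≥0∞ := fun x => v x - E x with hH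
  have hHE : H + E = v := funext fun x => tsub_add_cancel_of_le (hEv x)
  have hEeq : E = walkOp μ posAll (exitPayoff posAll (posDom (LambdaM μ)) F) + walkOp μ posAll E :=
    potential_stepOp _ _ _
  have hHharm : walkOp μ posAll H = H := by
    have h1 : v = walkOp μ posAll (exitPayoff posAll (posDom (LambdaM μ)) F) + walkOp μ posAll v :=
      indicator_eq_exit_add μ (posAll_subset_posDom _) hF
    have h2 : H + E = walkOp μ posAll H + E := by
      calc H + E = v := hHE
        _ = walkOp μ posAll (exitPayoff posAll (posDom (LambdaM μ)) F) + walkOp μ posAll (H + E) := by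
          rw [hHE]; exact h1
        _ = walkOp μ posAll H + (walkOp μ posAll (exitPayoff posAll (posDom (LambdaM μ)) F) +
            walkOp μ posAll E) := by rw [map_add]; abel
        _ = _ := by rw [← hEeq]
    funext x
    exact ((ENNReal.add_left_inj (hEtop x)).1 (congrFun h2 x)).symm
  have hHtop : ∀ x, H x ≠ ⊤ := fun x => ne_top_of_le_ne_top (hvtop x) tsub_le_self
  have hhfun : ∀ x ∈ posAll, hfun μ f x = (H x).toReal := by
    intro x hx
    rw [hfun_eq_toReal hnn hsum hf hh hx, hH]
    simp only [hv, Set.indicator_of_mem hx]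
    rfl
  refine ⟨fun x hx => ?_, harmOn_toReal hnn hHharm hHtop hhfun⟩
  obtain ⟨δ, hδ, W, -, hW, hbound⟩ := exists_exit_bound hnn hsum hr hmom hM0
  obtain ⟨C, hC, hCF⟩ := exists_liftFun_le hnn hsum hr hmom (hA1 ∅) (hA1 (LambdaM μ)) (fun i hi => hi) hf hh hδ
  have hEW : ∀ x, E x ≤ C * W x := by
    refine hbound C _ (fun x => ?_) (fun x hx => ?_)
    · refine le_trans ?_ (hCF x)
      unfold exitPayoff
      split_ifs
      exacts [le_rfl, zero_le]
    · unfold exitPayoff at hx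
      split_ifs at hx with h
      · tauto
      · exact absurd rfl hx
  have hF1 : 0 < F 1 := by
    rw [hFdef, liftFun_of_mem f (one_mem_posDom (LambdaM μ))]
    exact ENNReal.ofReal_pos.2 (hf _ (projL_mem_posL_iff.2 (one_mem_posDom (LambdaM μ))))
  have hCW : Tendsto (fun t => C * W (rayPoint (LambdaM μ) t)) atTop (𝓝 0) := by
    rw [← mul_zero C]
    exact ENNReal.Tendsto.const_mul hW (Or.inr hC)
  obtain ⟨t, ht, ht1⟩ := ((hCW.eventually_lt_const hF1).and (Filter.eventually_ge_atTop 1)).exists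
  have htA : rayPoint (LambdaM μ) t ∈ posAll := by
    intro i
    unfold rayPoint
    split_ifs
    · exact one_pos
    · exact_mod_cast ht1
  have hHt : 0 < H (rayPoint (LambdaM μ) t) := by
    refine tsub_pos_of_lt ?_
    rw [hv, Set.indicator_of_mem htA, hFdef,
      liftFun_congr f (y := 1) (fun i hi => by simp [rayPoint, hi])]
    exact (hEW _).trans_lt ht
  have hirr : Irred μ posAll := by
    rw [← posDom_univ]; exact hA1 _
  obtain ⟨k, -, hk⟩ := exists_reach_of_irred hirr hx htA
  have h1 := hk H hHharm.le
  rw [hhfun x hx]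
  refine ENNReal.toReal_pos (ne_of_gt (lt_of_lt_of_le ?_ h1)) (hHtop x)
  exact ENNReal.mul_pos (by simp [Real.exp_pos]) hHt.ne'

end Induced

theorem tendsto_tsum_of_le_of_tsum_ne_top {α β : Type*} {l : Filter α} {a : α → β → ℝ≥0∞}
    {b c : β → ℝ≥0∞} (hc : ∑' z, c z ≠ ⊤) (hab : ∀ z, Tendsto (fun n => a n z) l (𝓝 (b z)))
    (hac : ∀ᶠ n in l, ∀ z, a n z ≤ c z) (hbc : ∀ z, b z ≤ c z) :
    Tendsto (fun n => ∑' z, a n z) l (𝓝 (∑' z, b z)) := by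
  have hcz := ENNReal.ne_top_of_tsum_ne_top hc
  have aux : ∀ f : β → ℝ≥0∞, (∀ z, f z ≤ c z) →
      ENNReal.ofReal (∑' z, (f z).toReal) = ∑' z, f z := by
    intro f hf
    rw [← ENNReal.tsum_toReal_eq fun z => ne_top_of_le_ne_top (hcz z) (hf z),
      ENNReal.ofReal_toReal (ne_top_of_le_ne_top hc (ENNReal.tsum_le_tsum hf))]
  have h1 : Tendsto (fun n => ∑' z, (a n z).toReal) l (𝓝 (∑' z, (b z).toReal)) := by
    refine tendsto_tsum_of_dominated_convergence (bound := fun z => (c z).toReal)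
      (ENNReal.summable_toReal hc)
      (fun z => (ENNReal.tendsto_toReal (ne_top_of_le_ne_top (hcz z) (hbc z))).comp (hab z)) ?_
    filter_upwards [hac] with n hn z
    rw [Real.norm_of_nonneg ENNReal.toReal_nonneg]
    exact ENNReal.toReal_mono (hcz z) (hn z)
  have h2 := ENNReal.tendsto_ofReal h1
  rw [aux b hbc] at h2
  refine h2.congr' ?_
  filter_upwards [hac] with n hn using aux _ hn

theorem exists_potential_weights {V : Type*} [AddCommGroup V] (ν : V → ℝ≥0∞) (A : Set V) (x : V) :
    ∃ c : V → ℝ≥0∞, ∀ Φ : V → ℝ≥0∞,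
      potential (stepOp ν A) (stepOp ν A Φ) x = ∑' v, c v * Φ v := by
  refine ⟨fun v => ∑' n, (stepOp ν A ^ (n + 1)) (Pi.single v 1) x, fun Φ => ?_⟩
  simp only [potential, ← endo_pow_succ', ← ENNReal.tsum_mul_right]
  rw [ENNReal.tsum_comm]
  exact tsum_congr fun n => stepOp_pow_eq_tsum ν A Φ (n + 1) x

theorem potential_add {V : Type*} [AddCommGroup V] (L : Module.End ℝ≥0∞ (V → ℝ≥0∞))
    (f g : V → ℝ≥0∞) (x : V) : potential L (f + g) x = potential L f x + potential L g x := by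
  simp only [potential, map_add, Pi.add_apply, ENNReal.tsum_add]

section Limit

variable {d : ℕ} {μ : (Fin d → ℤ) → ℝ}

theorem greenE_of_notMem {A : Set (Fin d → ℤ)} {x y : Fin d → ℤ} (hy : y ∈ A) (hx : x ∉ A) :
    greenE μ A y x = 0 := by
  rw [greenE, potential_stepOp, Pi.add_apply, stepOp_of_notMem _ _ hx, massAt_of_ne, add_zero]
  rintro rfl
  exact hx hy

theorem greenE_eq_add_exitPart {y : Fin d → ℤ} (hy : y ∈ posAll)
    (hfin : ∀ x, greenE μ (posDom (LambdaM μ)) y x ≠ ⊤) {x : Fin d → ℤ} (hx : x ∈ posAll) :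
    greenE μ (posDom (LambdaM μ)) y x =
      greenE μ posAll y x + exitPart μ (greenE μ (posDom (LambdaM μ)) y) x := by
  set B := posDom (LambdaM μ) with hB
  set g := greenE μ B y with hg
  have hAB : (posAll : Set (Fin d → ℤ)) ⊆ B := posAll_subset_posDom _
  have hgB : ∀ x ∉ B, g x = 0 := fun x hx => greenE_of_notMem (hAB hy) hx
  have hsplit : exitPayoff posAll B g + posAll.indicator g = g := by
    funext x
    by_cases hA : x ∈ posAll
    · simp [exitPayoff, hA]
    · by_cases hxB : x ∈ B
      · simp [exitPayoff, hA, hxB]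
      · simp [exitPayoff, hA, hxB, hgB x hxB]
  have hv : posAll.indicator g = (massAt posAll y + walkOp μ posAll (exitPayoff posAll B g)) +
      walkOp μ posAll (posAll.indicator g) := by
    rw [add_assoc, ← map_add, hsplit]
    funext x
    by_cases hA : x ∈ posAll
    · rw [Set.indicator_of_mem hA, Pi.add_apply, stepOp_of_mem _ _ hA, ← stepOp_of_mem _ _ (hAB hA)]
      have h1 : massAt posAll y x = massAt B y x := by
        rcases eq_or_ne x y with rfl | hne
        · rw [massAt_self hy, massAt_self (hAB hy)]
        · rw [massAt_of_ne _ hne, massAt_of_ne _ hne]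
      rw [h1]
      exact congrFun (potential_stepOp _ _ _) x
    · rw [Set.indicator_of_notMem hA, Pi.add_apply, stepOp_of_notMem _ _ hA, massAt_of_ne, add_zero]
      rintro rfl
      exact hA hy
  have ht : Tendsto (fun N => (walkOp μ posAll ^ N) (posAll.indicator g) x) atTop (𝓝 0) := by
    refine tendsto_of_tendsto_of_tendsto_of_le_of_le tendsto_const_nhds
      (tendsto_pow_potential _ B (massAt B y) x (hfin x)) (fun _ => zero_le) fun N => ?_
    refine (stepOp_pow_mono_set _ hAB _ N x).trans ?_
    exact endo_mono _ (Set.indicator_le_self _ _) x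
  have h := eq_potential_of_tendsto _ hv x ht
  rw [Set.indicator_of_mem hx, potential_add] at h
  exact h

theorem exitPart_congr_mul {F : (Fin d → ℤ) → ℝ≥0∞} (c : ℝ≥0∞) :
    exitPart μ (fun x => F x * c) = fun x => exitPart μ F x * c := by
  funext x
  obtain ⟨w, hw⟩ := exists_potential_weights (fun z => ENNReal.ofReal (μ z)) posAll x
  rw [exitPart, exitPart, hw, hw, ← ENNReal.tsum_mul_right]
  refine tsum_congr fun v => ?_
  unfold exitPayoff
  split_ifs
  · rw [mul_assoc]
  · simp

theorem tendsto_exitPart {l : Filter ℕ} {k : ℕ → (Fin d → ℤ) → ℝ≥0∞} {F D : (Fin d → ℤ) → ℝ≥0∞}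
    (hkF : ∀ x, Tendsto (fun n => k n x) l (𝓝 (F x))) (hkD : ∀ᶠ n in l, ∀ x, k n x ≤ D x)
    (hFD : ∀ x, F x ≤ D x) {x : Fin d → ℤ} (hD : exitPart μ D x ≠ ⊤) :
    Tendsto (fun n => exitPart μ (k n) x) l (𝓝 (exitPart μ F x)) := by
  obtain ⟨w, hw⟩ := exists_potential_weights (fun z => ENNReal.ofReal (μ z)) posAll x
  simp only [exitPart] at hD ⊢
  rw [hw] at hD
  simp only [hw]
  have hwtop : ∀ v, v ∉ posAll → v ∈ posDom (LambdaM μ) → D v ≠ 0 → w v ≠ ⊤ := by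
    intro v hv1 hv2 hv3 htop
    refine ENNReal.ne_top_of_tsum_ne_top hD v ?_
    simp [exitPayoff, hv1, hv2, htop, hv3]
  refine tendsto_tsum_of_le_of_tsum_ne_top hD (fun v => ?_) ?_ fun v => ?_
  · unfold exitPayoff
    split_ifs with h
    · by_cases hDv : D v = 0
      · have h1 : F v = 0 := le_antisymm (hDv ▸ hFD v) zero_le
        rw [h1, mul_zero]
        refine tendsto_const_nhds.congr' ?_
        filter_upwards [hkD] with n hn
        have h2 : k n v = 0 := le_antisymm (hDv ▸ hn v) zero_le
        rw [h2, mul_zero]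
      · exact ENNReal.Tendsto.const_mul (hkF v) (Or.inr (hwtop v h.1 h.2 hDv))
    · exact tendsto_const_nhds
  · filter_upwards [hkD] with n hn v
    unfold exitPayoff
    split_ifs
    · exact mul_le_mul_right (hn v) _
    · exact le_rfl
  · unfold exitPayoff
    split_ifs
    · exact mul_le_mul_right (hFD v) _
    · exact le_rfl

/-- Extension of a vector on `Λ` by `1`. -/
noncomputable def extendOne (Λ : Set (Fin d)) (u : ↥Λ → ℤ) : Fin d → ℤ :=
  fun i => if h : i ∈ Λ then u ⟨i, h⟩ else 1

theorem projL_extendOne (Λ : Set (Fin d)) (u : ↥Λ → ℤ) : projL Λ (extendOne Λ u) = u := by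
  funext i
  simp [projL, extendOne]

theorem exists_liftFun_eq (hnn : ∀ z, 0 ≤ μ z) (hsum : HasSum μ 1) {Λ : Set (Fin d)}
    {F : (Fin d → ℤ) → ℝ≥0∞} (hF : walkOp μ (posDom Λ) F = F) (htop : ∀ x, F x ≠ ⊤)
    (hpos : ∀ x ∈ posDom Λ, 0 < F x)
    (hinv : ∀ x ∈ posDom Λ, ∀ y, (∀ i ∈ Λ, x i = y i) → F y = F x) :
    ∃ f : (↥Λ → ℤ) → ℝ, (∀ u ∈ posL Λ, 0 < f u) ∧ HarmOn (muL μ Λ) (posL Λ) f ∧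
      liftFun Λ f = F := by
  have hext : ∀ u ∈ posL Λ, extendOne Λ u ∈ posDom Λ := fun u hu =>
    projL_mem_posL_iff.1 (by rwa [projL_extendOne])
  set f : (↥Λ → ℤ) → ℝ := fun u => (F (extendOne Λ u)).toReal with hf
  have hfpos : ∀ u ∈ posL Λ, 0 < f u := fun u hu =>
    ENNReal.toReal_pos (hpos _ (hext u hu)).ne' (htop _)
  have hlift : liftFun Λ f = F := by
    funext x
    by_cases hx : x ∈ posDom Λ
    · rw [liftFun_of_mem f hx, hf, ENNReal.ofReal_toReal (htop _)]
      exact hinv x hx _ fun i hi => by simp [extendOne, hi, projL]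
    · rw [liftFun, if_neg hx, ← hF, stepOp_of_notMem _ _ hx]
  refine ⟨f, hfpos, (harmOn_muL_iff hnn hsum hfpos).2 fun u hu => ?_, hlift⟩
  have h1 := congrFun hF (extendOne Λ u)
  rw [stepOp_of_mem _ _ (hext u hu), ← hlift, liftFun_of_mem f (hext u hu), projL_extendOne] at h1
  rw [← h1]
  refine tsum_congr fun z => ?_
  have h2 : projL Λ (extendOne Λ u + z) = u + projL Λ z := by
    conv_rhs => rw [← projL_extendOne Λ u]
    rfl
  rw [liftFun, ← projL_mem_posL_iff, h2]

end Limit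

section Limit

variable {d : ℕ} {μ : (Fin d → ℤ) → ℝ}

theorem exists_tendsto_ultrafilter {α β : Type*} (U : Ultrafilter β) (k : β → α → ℝ≥0∞) :
    ∃ F : α → ℝ≥0∞, ∀ x, Tendsto (fun n => k n x) U (𝓝 (F x)) := by
  refine ⟨fun x => (U.map fun n => k n x).lim, fun x => ?_⟩
  exact (U.map fun n => k n x).le_nhds_lim

theorem walkOp_eq_of_tendsto {A : Set (Fin d → ℤ)} {xs : ℕ → Fin d → ℤ} {c : ℕ → ℝ≥0∞}
    {l : Filter ℕ} [l.NeBot] {F : (Fin d → ℤ) → ℝ≥0∞} (hxs : ∀ n, xs n ∈ A)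
    (hx1 : Tendsto (fun n => oneNorm (xs n)) l atTop) (hmom : ∃ r, 0 < r ∧ ExpMoment μ r)
    (hnn : ∀ z, 0 ≤ μ z)
    (hlim : ∀ x, Tendsto (fun n => greenE μ A (xs n) x * c n) l (𝓝 (F x)))
    (hbd : ∀ δ : ℝ, 0 < δ → ∃ C : ℝ, 0 ≤ C ∧ ∀ᶠ n in l, ∀ x,
      greenE μ A (xs n) x * c n ≤ ENNReal.ofReal (C * Real.exp (δ * oneNorm x))) :
    walkOp μ A F = F := by
  funext x
  by_cases hx : x ∈ A
  swap
  · rw [stepOp_of_notMem _ _ hx]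
    refine (tendsto_nhds_unique (hlim x) (tendsto_const_nhds.congr fun n => ?_)).symm
    rw [greenE_of_notMem (hxs n) hx, zero_mul]
  obtain ⟨r, hr, hr'⟩ := hmom
  obtain ⟨C, hC, hCb⟩ := hbd r hr
  have hFC : ∀ x, F x ≤ ENNReal.ofReal (C * Real.exp (r * oneNorm x)) := fun x =>
    le_of_tendsto (hlim x) (hCb.mono fun n hn => hn x)
  have hadd : ∀ z, C * Real.exp (r * oneNorm (x + z)) ≤
      C * Real.exp (r * oneNorm x) * Real.exp (r * oneNorm z) := by
    intro z
    rw [mul_assoc, ← Real.exp_add, ← mul_add]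
    gcongr
    exact_mod_cast oneNorm_add_le x z
  have hsummable : ∑' z, ENNReal.ofReal (μ z) *
      ENNReal.ofReal (C * Real.exp (r * oneNorm x) * Real.exp (r * oneNorm z)) ≠ ⊤ := by
    have h1 : ∀ z, ENNReal.ofReal (μ z) *
        ENNReal.ofReal (C * Real.exp (r * oneNorm x) * Real.exp (r * oneNorm z)) =
        ENNReal.ofReal (C * Real.exp (r * oneNorm x) * (μ z * Real.exp (r * oneNorm z))) := by
      intro z
      rw [← ENNReal.ofReal_mul (hnn z)]
      congr 1
      ring
    simp only [h1]
    exact (Summable.mul_left _ hr').tsum_ofReal_ne_top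
  rw [stepOp_of_mem _ _ hx]
  have h2 : Tendsto (fun n => ∑' z, ENNReal.ofReal (μ z) * (greenE μ A (xs n) (x + z) * c n)) l
      (𝓝 (∑' z, ENNReal.ofReal (μ z) * F (x + z))) := by
    refine tendsto_tsum_of_le_of_tsum_ne_top hsummable
      (fun z => ENNReal.Tendsto.const_mul (hlim _) (Or.inr ENNReal.ofReal_ne_top)) ?_ fun z => ?_
    · filter_upwards [hCb] with n hn z
      exact mul_le_mul_right ((hn _).trans (ENNReal.ofReal_le_ofReal (hadd z))) _
    · exact mul_le_mul_right ((hFC _).trans (ENNReal.ofReal_le_ofReal (hadd z))) _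
  refine tendsto_nhds_unique h2 ((hlim x).congr' ?_)
  filter_upwards [hx1.eventually_gt_atTop (oneNorm x)] with n hn
  have hne : x ≠ xs n := by
    rintro h
    rw [← h] at hn
    exact lt_irrefl _ hn
  simp only [← mul_assoc, ENNReal.tsum_mul_right]
  rw [← stepOp_of_mem _ _ hx]
  congr 1
  conv_lhs => rw [greenE, potential_stepOp, Pi.add_apply, massAt_of_ne _ hne, zero_add]

theorem inv_greenE_one_le {A : Set (Fin d → ℤ)} {y : Fin d → ℤ} {k : ℝ} (hy : y ∈ A)
    (h : Reach (fun z => ENNReal.ofReal (μ z)) A k 1 y) :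
    (greenE μ A y 1)⁻¹ ≤ ENNReal.ofReal (Real.exp k) := by
  rw [ENNReal.inv_le_iff_inv_le, ← ENNReal.ofReal_inv_of_pos (Real.exp_pos _), ← Real.exp_neg]
  calc ENNReal.ofReal (Real.exp (-k)) = ENNReal.ofReal (Real.exp (-k)) * 1 := (mul_one _).symm
    _ ≤ ENNReal.ofReal (Real.exp (-k)) * greenE μ A y y := mul_le_mul_right (one_le_greenE μ hy) _
    _ ≤ greenE μ A y 1 := h _ (stepOp_greenE_le μ A y)

theorem limit_translate_le (hnn : ∀ z, 0 ≤ μ z) (hsum : HasSum μ 1) {r : ℝ} (hr : 0 < r)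
    (hmom : ExpMoment μ r) (hM : Mvec μ ≠ 0) (hM0 : ∀ i, 0 ≤ Mvec μ i)
    {Λ : Set (Fin d)} (hirr : Irred μ (posDom Λ)) {xs : ℕ → Fin d → ℤ} (hxs : ∀ n, xs n ∈ posAll)
    (hx1 : Tendsto (fun n => znorm (xs n)) atTop atTop)
    (hx2 : Tendsto (fun n i => (xs n i : ℝ) / znorm (xs n)) atTop
      (𝓝 (fun i => Mvec μ i / rnorm (Mvec μ))))
    {l : Filter ℕ} [l.NeBot] (hl : l ≤ atTop) {F : (Fin d → ℤ) → ℝ≥0∞}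
    (hlim : ∀ x, Tendsto (fun n => greenE μ (posDom Λ) (xs n) x *
      (greenE μ (posDom Λ) (xs n) 1)⁻¹) l (𝓝 (F x))) (htop : ∀ x, F x ≠ ⊤)
    {x : Fin d → ℤ} (hx : x ∈ posDom Λ) (w : Fin d → ℤ) (hw : ∀ i ∈ Λ, w i = 0) :
    F (x + w) ≤ F x := by
  have key : ∀ lam : ℝ, 1 < lam → F (x + w) ≤ ENNReal.ofReal lam * F x := by
    intro lam hlam
    obtain ⟨C, γ, hC, hγ, hb⟩ := exists_ratio_bound hnn hsum hr hmom hM hirr hlam w hw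
    have hreach := (eventually_reach_of_tendsto hnn hsum hr hmom hM hM0 hirr hxs hx1 hx2
      (half_pos hγ)).filter_mono hl
    have herr : Tendsto (fun n => ENNReal.ofReal (C * Real.exp (γ * oneNorm x) *
        Real.exp (-(γ / 2 * znorm (xs n))))) l (𝓝 0) := by
      rw [← ENNReal.ofReal_zero]
      refine ENNReal.tendsto_ofReal ?_
      rw [← mul_zero (C * Real.exp (γ * oneNorm x))]
      exact ((Real.tendsto_exp_neg_atTop_nhds_zero.comp
        (hx1.const_mul_atTop (half_pos hγ))).mono_left hl).const_mul _
    have h1 := (ENNReal.Tendsto.const_mul (a := ENNReal.ofReal lam) (hlim x)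
      (Or.inr ENNReal.ofReal_ne_top)).add herr
    rw [add_zero] at h1
    refine le_of_tendsto_of_tendsto (hlim (x + w)) h1 ?_
    filter_upwards [hreach] with n hn
    have h2 := inv_greenE_one_le (posAll_subset_posDom Λ (hxs n)) hn
    have h3 : C * Real.exp (-(γ * oneNorm (x - xs n))) * Real.exp (γ / 2 * oneNorm (xs n)) ≤
        C * Real.exp (γ * oneNorm x) * Real.exp (-(γ / 2 * znorm (xs n))) := by
      rw [mul_assoc, mul_assoc, ← Real.exp_add, ← Real.exp_add, znorm_eq_oneNorm]
      have h4 : (oneNorm (xs n) : ℝ) ≤ oneNorm x + oneNorm (x - xs n) := by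
        rw [oneNorm_sub_comm]
        exact_mod_cast oneNorm_le_add_sub (xs n) x
      have h5 := mul_le_mul_of_nonneg_left h4 hγ.le
      exact mul_le_mul_of_nonneg_left (Real.exp_le_exp.2 (by linarith)) hC.le
    calc greenE μ (posDom Λ) (xs n) (x + w) * (greenE μ (posDom Λ) (xs n) 1)⁻¹
        ≤ (ENNReal.ofReal lam * greenE μ (posDom Λ) (xs n) x +
          ENNReal.ofReal (C * Real.exp (-(γ * oneNorm (x - xs n))))) *
          (greenE μ (posDom Λ) (xs n) 1)⁻¹ := mul_le_mul_left (hb x hx (xs n)) _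
      _ ≤ _ := by
        rw [add_mul, mul_assoc]
        refine add_le_add le_rfl ?_
        refine (mul_le_mul_right h2 _).trans ?_
        rw [← ENNReal.ofReal_mul (by positivity)]
        exact ENNReal.ofReal_le_ofReal h3
  have h6 : Tendsto (fun lam : ℝ => ENNReal.ofReal lam * F x) (𝓝[>] 1)
      (𝓝 (ENNReal.ofReal 1 * F x)) :=
    ENNReal.Tendsto.mul_const
      (ENNReal.tendsto_ofReal (tendsto_id.mono_left nhdsWithin_le_nhds)) (Or.inr (htop x))
  rw [ENNReal.ofReal_one, one_mul] at h6
  exact ge_of_tendsto h6 (eventually_nhdsWithin_of_forall key)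

theorem exists_limit_greenE (hnn : ∀ z, 0 ≤ μ z) (hsum : HasSum μ 1) {r : ℝ} (hr : 0 < r)
    (hmom : ExpMoment μ r) (hM : Mvec μ ≠ 0) (hM0 : ∀ i, 0 ≤ Mvec μ i)
    (hirr0 : Irred μ (posDom (∅ : Set (Fin d)))) {Λ : Set (Fin d)} (hirr : Irred μ (posDom Λ))
    (hΛ : ∀ i ∈ Λ, Mvec μ i = 0) {xs : ℕ → Fin d → ℤ} (hxs : ∀ n, xs n ∈ posAll)
    (hx1 : Tendsto (fun n => znorm (xs n)) atTop atTop)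
    (hx2 : Tendsto (fun n i => (xs n i : ℝ) / znorm (xs n)) atTop
      (𝓝 (fun i => Mvec μ i / rnorm (Mvec μ))))
    (U : Ultrafilter ℕ) (hU : (U : Filter ℕ) ≤ atTop) :
    ∃ F : (Fin d → ℤ) → ℝ≥0∞, walkOp μ (posDom Λ) F = F ∧ (∀ x, F x ≠ ⊤) ∧
      (∀ x ∈ posDom Λ, 0 < F x) ∧ (∀ x ∈ posDom Λ, ∀ y, (∀ i ∈ Λ, x i = y i) → F y = F x) ∧
      (∀ x, Tendsto (fun n => greenE μ (posDom Λ) (xs n) x *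
        (greenE μ (posDom Λ) (xs n) 1)⁻¹) U (𝓝 (F x))) ∧
      ∀ δ : ℝ, 0 < δ → ∃ C : ℝ, 0 ≤ C ∧ ∀ᶠ n in (U : Filter ℕ), ∀ x,
        greenE μ (posDom Λ) (xs n) x * (greenE μ (posDom Λ) (xs n) 1)⁻¹ ≤
          ENNReal.ofReal (C * Real.exp (δ * oneNorm x)) := by
  have hxsB : ∀ n, xs n ∈ posDom Λ := fun n => posAll_subset_posDom Λ (hxs n)
  have hpos : ∀ n, greenE μ (posDom Λ) (xs n) 1 ≠ 0 := by
    intro n h0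
    obtain ⟨k, -, hk⟩ := exists_reach_of_irred hirr (one_mem_posDom Λ) (hxsB n)
    have h1 := inv_greenE_one_le (hxsB n) hk
    rw [h0, ENNReal.inv_zero] at h1
    exact ENNReal.ofReal_ne_top (top_le_iff.1 h1)
  obtain ⟨Cb, -, hCb⟩ := exists_potential_bound hnn hsum hr hmom hM
  have hfin : ∀ n x, greenE μ (posDom Λ) (xs n) x ≠ ⊤ := fun n x =>
    ne_top_of_le_ne_top ENNReal.ofReal_ne_top (hCb _ _ _)
  obtain ⟨F, hlim⟩ := exists_tendsto_ultrafilter U fun n x =>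
    greenE μ (posDom Λ) (xs n) x * (greenE μ (posDom Λ) (xs n) 1)⁻¹
  have hbd : ∀ δ : ℝ, 0 < δ → ∃ C : ℝ, 0 ≤ C ∧ ∀ᶠ n in (U : Filter ℕ), ∀ x,
      greenE μ (posDom Λ) (xs n) x * (greenE μ (posDom Λ) (xs n) 1)⁻¹ ≤
        ENNReal.ofReal (C * Real.exp (δ * oneNorm x)) := by
    intro δ hδ
    obtain ⟨C, hC, h⟩ := exists_greenE_le hnn hsum hr hmom hM hM0 hirr0 hirr hΛ hxs hx1 hx2 hδ
    refine ⟨C, hC, (h.filter_mono hU).mono fun n hn x => ?_⟩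
    by_cases hx : x ∈ posDom Λ
    · refine (mul_le_mul_left (hn x hx) _).trans ?_
      rw [mul_assoc, ENNReal.mul_inv_cancel (hpos n) (hfin n 1), mul_one]
    · rw [greenE_of_notMem (hxsB n) hx, zero_mul]
      exact zero_le
  have htop : ∀ x, F x ≠ ⊤ := by
    intro x
    obtain ⟨C, -, h⟩ := hbd 1 one_pos
    exact ne_top_of_le_ne_top ENNReal.ofReal_ne_top
      (le_of_tendsto (hlim x) (h.mono fun n hn => hn x))
  have hx1' : Tendsto (fun n => oneNorm (xs n)) (U : Filter ℕ) atTop := by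
    simp only [znorm_eq_oneNorm] at hx1
    exact (tendsto_natCast_atTop_iff.1 hx1).mono_left hU
  have hF := walkOp_eq_of_tendsto hxsB hx1' ⟨r, hr, hmom⟩ hnn hlim hbd
  have hF1 : F 1 = 1 := by
    refine tendsto_nhds_unique (hlim 1) (tendsto_const_nhds.congr fun n => ?_)
    rw [ENNReal.mul_inv_cancel (hpos n) (hfin n 1)]
  have hle := fun x (hx : x ∈ posDom Λ) w hw =>
    limit_translate_le hnn hsum hr hmom hM hM0 hirr hxs hx1 hx2 hU hlim htop hx w hw
  refine ⟨F, hF, htop, fun x hx => ?_, fun x hx y hxy => ?_, hlim, hbd⟩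
  · obtain ⟨k, -, hk⟩ := exists_reach_of_irred hirr hx (one_mem_posDom Λ)
    refine lt_of_lt_of_le ?_ (hk F hF.le)
    rw [hF1, mul_one]
    exact ENNReal.ofReal_pos.2 (Real.exp_pos _)
  · have hy : y ∈ posDom Λ := fun i hi => hxy i hi ▸ hx i hi
    have h1 := hle x hx (y - x) fun i hi => by simp [hxy i hi]
    have h2 := hle y hy (x - y) fun i hi => by simp [hxy i hi]
    rw [add_sub_cancel] at h1 h2
    exact le_antisymm h1 h2

end Limit

section Kernel

variable {d : ℕ} {μ : (Fin d → ℤ) → ℝ}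

theorem exists_tendsto_green_div (hnn : ∀ z, 0 ≤ μ z) (hsum : HasSum μ 1) {r : ℝ} (hr : 0 < r)
    (hmom : ExpMoment μ r) (hM : Mvec μ ≠ 0) (hM0 : ∀ i, 0 ≤ Mvec μ i) (hA1 : A1 μ)
    {x₀ : Fin d → ℤ} (hx₀ : x₀ ∈ posAll) {xs : ℕ → Fin d → ℤ} (hxs : ∀ n, xs n ∈ posAll)
    (hx1 : Tendsto (fun n => znorm (xs n)) atTop atTop)
    (hx2 : Tendsto (fun n i => (xs n i : ℝ) / znorm (xs n)) atTop
      (𝓝 (fun i => Mvec μ i / rnorm (Mvec μ))))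
    (U : Ultrafilter ℕ) (hU : (U : Filter ℕ) ≤ atTop) :
    ∃ f : (↥(LambdaM μ) → ℤ) → ℝ, (∀ u ∈ posL (LambdaM μ), 0 < f u) ∧
      HarmOn (muL μ (LambdaM μ)) (posL (LambdaM μ)) f ∧
      ∀ x ∈ posAll,
        Tendsto (fun n => green μ posAll x (xs n) / green μ posAll x₀ (xs n)) U
          (𝓝 (hfun μ f x / hfun μ f x₀)) := by
  obtain ⟨F, hF, htop, hpos, hinv, hlim, hbd⟩ := exists_limit_greenE hnn hsum hr hmom hM hM0
    (hA1 ∅) (hA1 (LambdaM μ)) (fun i hi => hi) hxs hx1 hx2 U hU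
  obtain ⟨f, hf, hh, hfF⟩ := exists_liftFun_eq hnn hsum hF htop hpos hinv
  obtain ⟨δ, hδ, W, hW, -, hexit⟩ := exists_exit_bound hnn hsum hr hmom hM0
  obtain ⟨C, hC, hCb⟩ := hbd δ hδ
  obtain ⟨Cb, -, hgb⟩ := exists_potential_bound hnn hsum hr hmom hM
  have hgfin : ∀ A n x, greenE μ A (xs n) x ≠ ⊤ := fun A n x =>
    ne_top_of_le_ne_top ENNReal.ofReal_ne_top (hgb _ _ _)
  have hD : ∀ x, exitPart μ
      (fun x => ENNReal.ofReal (C * Real.exp (δ * oneNorm x))) x ≠ ⊤ := by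
    intro x
    refine ne_top_of_le_ne_top (ENNReal.mul_ne_top ENNReal.ofReal_ne_top (hW x))
      (hexit (ENNReal.ofReal C) _ (fun y => ?_) (fun y hy => ?_) x)
    · unfold exitPayoff
      split_ifs
      · exact (ENNReal.ofReal_mul hC).le
      · exact zero_le
    · unfold exitPayoff at hy
      split_ifs at hy with h
      · exact ⟨h.2, h.1⟩
      · exact absurd rfl hy
  have hexlim := fun x => tendsto_exitPart (μ := μ) hlim hCb
    (fun x => le_of_tendsto (hlim x) (hCb.mono fun n hn => hn x)) (hD x)
  have hcfin : ∀ᶠ n in (U : Filter ℕ), (greenE μ (posDom (LambdaM μ)) (xs n) 1)⁻¹ ≠ ⊤ := by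
    refine Eventually.of_forall fun n => ?_
    obtain ⟨k, -, hk⟩ := exists_reach_of_irred (hA1 (LambdaM μ)) (one_mem_posDom _)
      (posAll_subset_posDom _ (hxs n))
    exact ne_top_of_le_ne_top ENNReal.ofReal_ne_top
      (inv_greenE_one_le (posAll_subset_posDom _ (hxs n)) hk)
  have hgreen : ∀ x ∈ posAll, Tendsto (fun n => greenE μ posAll (xs n) x *
      (greenE μ (posDom (LambdaM μ)) (xs n) 1)⁻¹) U (𝓝 (F x - exitPart μ F x)) := by
    intro x hx
    refine (ENNReal.Tendsto.sub (hlim x) (hexlim x) (Or.inl (htop x))).congr' ?_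
    filter_upwards [hcfin] with n hn
    have h1 := greenE_eq_add_exitPart (hxs n) (hgfin _ n) hx
    have h2 := congrArg (· * (greenE μ (posDom (LambdaM μ)) (xs n) 1)⁻¹) h1
    simp only [add_mul] at h2
    rw [exitPart_congr_mul]
    refine (ENNReal.eq_sub_of_add_eq ?_ h2.symm).symm
    refine ne_top_of_le_ne_top (ENNReal.mul_ne_top (hgfin (posDom (LambdaM μ)) n x) hn) ?_
    rw [h2]
    exact le_add_self
  have hreal : ∀ x ∈ posAll, Tendsto (fun n => green μ posAll x (xs n) *
      ((greenE μ (posDom (LambdaM μ)) (xs n) 1)⁻¹).toReal) U (𝓝 (hfun μ f x)) := by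
    intro x hx
    rw [hfun_eq_toReal hnn hsum hf hh hx, hfF]
    refine ((ENNReal.tendsto_toReal
      (ne_top_of_le_ne_top (htop x) tsub_le_self)).comp (hgreen x hx)).congr fun n => ?_
    rw [Function.comp_apply, ENNReal.toReal_mul, green_eq_toReal hnn hsum]
  obtain ⟨hpos', -⟩ := hfun_pos_and_harmOn hnn hsum hr hmom hM0 hA1 hf hh
  refine ⟨f, hf, hh, fun x hx => ?_⟩
  refine ((hreal x hx).div (hreal x₀ hx₀) (hpos' x₀ hx₀).ne').congr' ?_
  filter_upwards [hcfin] with n hn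
  refine mul_div_mul_right _ _ (ENNReal.toReal_ne_zero.2 ⟨?_, hn⟩)
  exact ENNReal.inv_ne_zero.2 (hgfin _ n 1)

theorem hfun_eq_const_mul (hnn : ∀ z, 0 ≤ μ z) (hsum : HasSum μ 1)
    {f g : (↥(LambdaM μ) → ℤ) → ℝ} (hf : ∀ u ∈ posL (LambdaM μ), 0 < f u)
    (hhf : HarmOn (muL μ (LambdaM μ)) (posL (LambdaM μ)) f)
    (hg : ∀ u ∈ posL (LambdaM μ), 0 < g u)
    (hhg : HarmOn (muL μ (LambdaM μ)) (posL (LambdaM μ)) g) {c : ℝ} (hc : 0 < c)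
    (hfg : ∀ u ∈ posL (LambdaM μ), f u = c * g u) {x : Fin d → ℤ} (hx : x ∈ posAll) :
    hfun μ f x = c * hfun μ g x := by
  have h1 : liftFun (LambdaM μ) f =
      fun x => liftFun (LambdaM μ) g x * ENNReal.ofReal c := by
    funext y
    by_cases hy : y ∈ posDom (LambdaM μ)
    · rw [liftFun_of_mem f hy, liftFun_of_mem g hy, hfg _ (projL_mem_posL_iff.2 hy), mul_comm c,
        ENNReal.ofReal_mul (hg _ (projL_mem_posL_iff.2 hy)).le]
    · simp [liftFun, hy]
  rw [hfun_eq_toReal hnn hsum hf hhf hx, hfun_eq_toReal hnn hsum hg hhg hx, h1,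
    exitPart_congr_mul, ← ENNReal.sub_mul fun _ _ => ENNReal.ofReal_ne_top, ENNReal.toReal_mul,
    ENNReal.toReal_ofReal hc.le, mul_comm]

end Kernel

end Helpers

theorem statement0 {d : ℕ} (μ : (Fin d → ℤ) → ℝ)
    (hnn : ∀ z, 0 ≤ μ z) (hsum : HasSum μ 1)
    (hA1 : A1 μ) (hA2 : A2 μ) (hA3 : A3 μ)
    (hM : ∀ i, 0 ≤ Mvec μ i) (x₀ : Fin d → ℤ) (hx₀ : x₀ ∈ posAll) :
    -- (i)
    (∀ f : (↥(LambdaM μ) → ℤ) → ℝ, (∀ u ∈ posL (LambdaM μ), 0 < f u) →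
      HarmOn (muL μ (LambdaM μ)) (posL (LambdaM μ)) f →
      (∀ x ∈ posAll, 0 < hfun μ f x) ∧ HarmOn μ posAll (hfun μ f)) ∧
    -- (ii)
    (∀ xs : ℕ → (Fin d → ℤ), (∀ n, xs n ∈ posAll) →
      Tendsto (fun n => znorm (xs n)) atTop atTop →
      Tendsto (fun n i => (xs n i : ℝ) / znorm (xs n)) atTop
        (𝓝 (fun i => Mvec μ i / rnorm (Mvec μ))) →
      Fundamental μ posAll x₀ xs →
      ∃ f : (↥(LambdaM μ) → ℤ) → ℝ, (∀ u ∈ posL (LambdaM μ), 0 < f u) ∧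
        HarmOn (muL μ (LambdaM μ)) (posL (LambdaM μ)) f ∧
        ∀ x ∈ posAll,
          Tendsto (fun n => green μ posAll x (xs n) / green μ posAll x₀ (xs n)) atTop
            (𝓝 (hfun μ f x / hfun μ f x₀))) ∧
    -- (iii)
    ((∀ f g : (↥(LambdaM μ) → ℤ) → ℝ,
        (∀ u ∈ posL (LambdaM μ), 0 < f u) →
        HarmOn (muL μ (LambdaM μ)) (posL (LambdaM μ)) f →
        (∀ u ∈ posL (LambdaM μ), 0 < g u) →
        HarmOn (muL μ (LambdaM μ)) (posL (LambdaM μ)) g →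
        ∃ c : ℝ, 0 < c ∧ ∀ u ∈ posL (LambdaM μ), f u = c * g u) →
      ∀ xs : ℕ → (Fin d → ℤ), (∀ n, xs n ∈ posAll) →
        Tendsto (fun n => znorm (xs n)) atTop atTop →
        Tendsto (fun n i => (xs n i : ℝ) / znorm (xs n)) atTop
          (𝓝 (fun i => Mvec μ i / rnorm (Mvec μ))) →
        Fundamental μ posAll x₀ xs ∧
        ∃ f : (↥(LambdaM μ) → ℤ) → ℝ, (∀ u ∈ posL (LambdaM μ), 0 < f u) ∧
          HarmOn (muL μ (LambdaM μ)) (posL (LambdaM μ)) f ∧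
          ∀ x ∈ posAll,
            Tendsto (fun n => green μ posAll x (xs n) / green μ posAll x₀ (xs n)) atTop
              (𝓝 (hfun μ f x / hfun μ f x₀))) := by
  obtain ⟨r, hr, hmom⟩ := exists_expMoment hnn hsum hA2
  have key := fun xs hxs hx1 hx2 U hU => exists_tendsto_green_div (xs := xs) hnn hsum hr hmom hA3
    hM hA1 hx₀ hxs hx1 hx2 U hU
  refine ⟨fun f hf hh => hfun_pos_and_harmOn hnn hsum hr hmom hM hA1 hf hh, ?_, ?_⟩
  · intro xs hxs hx1 hx2 hfund
    obtain ⟨f, hf, hh, hlim⟩ := key xs hxs hx1 hx2 (Ultrafilter.of atTop) (Ultrafilter.of_le _)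
    refine ⟨f, hf, hh, fun x hx => ?_⟩
    obtain ⟨L, hL⟩ := hfund x hx
    rwa [← tendsto_nhds_unique (hL.mono_left (Ultrafilter.of_le _)) (hlim x hx)]
  · intro huniq xs hxs hx1 hx2
    obtain ⟨f, hf, hh, -⟩ := key xs hxs hx1 hx2 (Ultrafilter.of atTop) (Ultrafilter.of_le _)
    have hlim : ∀ x ∈ posAll,
        Tendsto (fun n => green μ posAll x (xs n) / green μ posAll x₀ (xs n)) atTop
          (𝓝 (hfun μ f x / hfun μ f x₀)) := by
      intro x hx
      rw [tendsto_iff_ultrafilter]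
      intro U hU
      obtain ⟨g, hg, hhg, hlim⟩ := key xs hxs hx1 hx2 U hU
      obtain ⟨c, hc, hgf⟩ := huniq g f hg hhg hf hh
      have h := hlim x hx
      rwa [hfun_eq_const_mul hnn hsum hg hhg hf hh hc hgf hx,
        hfun_eq_const_mul hnn hsum hg hhg hf hh hc hgf hx₀, mul_div_mul_left _ _ hc.ne'] at h
    exact ⟨fun x hx => ⟨_, hlim x hx⟩, f, hf, hh, hlim⟩
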